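/- arXiv:2603.18179 — 3 statements merged into one kernel-verified Lean document; each statement's English description precedes it below -/
import Mathlib

section
/- Let G = F_q^n, let V ≤ G be a subspace, let A, D ⊆ V be nonempty with α := |A|/|V| and δ := |D|/|V|, and let ε ∈ (0,1]. Then either |⟨1_{−A} ∗ 1_A, 1_D⟩_{L²(μ_G)} − α²δ·μ_G(V)²| ≤ ε·α²δ·μ_G(V)², or there exists a subspace V' ≤ V with dim(V/V') = O_ε((log⁴ 2α⁻¹)(log⁴ 2δ⁻¹)) such that ‖1_A ∗ μ_{V'}‖_∞ ≥ (1 + cε)·α for an absolute constant c > 0. -/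
open scoped Classical Pointwise


theorem km_avg_exp {ι : Type*} (s : Finset ι) (X : ι → ℝ) (hX : ∀ i ∈ s, |X i| ≤ 1)
    (h0 : ∑ i ∈ s, X i = 0) (l : ℝ) :
    ∑ i ∈ s, Real.exp (l * X i) ≤ s.card * Real.exp (l ^ 2 / 2) := by
  have key : ∀ x : ℝ, |x| ≤ 1 → Real.exp (l * x) ≤ Real.cosh l + x * Real.sinh l := by
    intro x hx
    rw [abs_le] at hx
    have := convexOn_exp.2 (Set.mem_univ l) (Set.mem_univ (-l))
      (show 0 ≤ (1 + x) / 2 by linarith) (show 0 ≤ (1 - x) / 2 by linarith) (by ring)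
    simp only [smul_eq_mul] at this
    rw [Real.cosh_eq, Real.sinh_eq]
    calc Real.exp (l * x) = Real.exp ((1 + x) / 2 * l + (1 - x) / 2 * -l) := by ring_nf
      _ ≤ _ := this
      _ = _ := by ring
  calc ∑ i ∈ s, Real.exp (l * X i) ≤ ∑ i ∈ s, (Real.cosh l + X i * Real.sinh l) :=
        Finset.sum_le_sum fun i hi => key _ (hX i hi)
    _ = s.card * Real.cosh l := by
        rw [Finset.sum_add_distrib, ← Finset.sum_mul, h0]; simp
    _ ≤ _ := by gcongr; exact Real.cosh_le_exp_half_sq l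

section corr
variable {G : Type*} [AddCommGroup G] [Fintype G]

theorem km_corr (g h : G → ℝ) (k : ℕ) :
    ∑ s : Fin k → G, ∑ x, ∑ y, h (x - y) * ((∏ i, g (x + s i)) * ∏ i, g (y + s i)) =
      Fintype.card G * ∑ x, h x * (∑ z, g (x + z) * g z) ^ k := by
  have h1 : ∀ x y : G, h (x - y) * (∑ z, g (x - y + z) * g z) ^ k =
      ∑ s : Fin k → G, h (x - y) * ((∏ i, g (x + s i)) * ∏ i, g (y + s i)) := by
    intro x y
    rw [← Finset.mul_sum]
    congr 1
    have : ∑ z, g (x - y + z) * g z = ∑ z, g (x + z) * g (y + z) := by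
      rw [← Equiv.sum_comp (Equiv.addLeft y)]
      refine Finset.sum_congr rfl fun z _ => ?_
      simp [← add_assoc]
    rw [this]
    rw [← Fin.prod_const k, Finset.prod_univ_sum]
    simp [Finset.prod_mul_distrib]
  calc _ = ∑ x, ∑ y, ∑ s : Fin k → G,
        h (x - y) * ((∏ i, g (x + s i)) * ∏ i, g (y + s i)) := by
        rw [Finset.sum_comm]
        refine Finset.sum_congr rfl fun x _ => ?_
        rw [Finset.sum_comm]
    _ = ∑ y : G, ∑ x : G, h (x - y) * (∑ z, g (x - y + z) * g z) ^ k := by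
        simp_rw [h1]; rw [Finset.sum_comm]
    _ = ∑ y : G, ∑ x : G, h x * (∑ z, g (x + z) * g z) ^ k := by
        refine Finset.sum_congr rfl fun y _ => ?_
        exact Equiv.sum_comp (Equiv.subRight y) (fun x => h x * (∑ z, g (x + z) * g z) ^ k)
    _ = _ := by simp

theorem km_corr_nonneg (g : G → ℝ) (k : ℕ) : 0 ≤ ∑ x, (∑ z, g (x + z) * g z) ^ k := by
  have h := km_corr g (fun _ => 1) k
  have hN : (0 : ℝ) < Fintype.card G := by exact_mod_cast Fintype.card_pos
  have h2 : 0 ≤ ∑ s : Fin k → G, ∑ x, ∑ y, (1 : ℝ) * ((∏ i, g (x + s i)) * ∏ i, g (y + s i)) := by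
    refine Finset.sum_nonneg fun s _ => ?_
    simp only [one_mul]
    rw [← Finset.sum_mul_sum]
    exact mul_self_nonneg _
  rw [h] at h2
  simpa using (mul_nonneg_iff_of_pos_left hN).1 h2

end corr

/-- unbalancing -/
theorem km_unbalance {G : Type*} [Fintype G] (f : G → ℝ) (hf : ∀ k : ℕ, 0 ≤ ∑ x, f x ^ k) (D : Finset G) (hD : D.Nonempty)
    (ε : ℝ) (hε : 0 < ε) (h : ε * D.card < |∑ x ∈ D, f x|) (m : ℕ) (hm : Even m) :
    (D.card : ℝ) * (1 + ε) ^ m / 2 ≤ ∑ x, (1 + f x) ^ m := by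
  have hodd : ∑ x, (1 - f x) ^ m ≤ ∑ x, (1 + f x) ^ m := by
    have e : ∀ x, (1 + f x) ^ m - (1 - f x) ^ m =
        ∑ k ∈ Finset.range (m + 1), f x ^ k * ((1 - (-1) ^ k) * (m.choose k : ℝ)) := by
      intro x
      rw [add_comm 1 (f x), sub_eq_add_neg 1 (f x), add_comm 1 (-f x), add_pow, add_pow,
        ← Finset.sum_sub_distrib]
      refine Finset.sum_congr rfl fun k _ => ?_
      rw [neg_pow]; ring
    rw [← sub_nonneg, ← Finset.sum_sub_distrib]
    simp_rw [e]
    rw [Finset.sum_comm]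
    refine Finset.sum_nonneg fun k _ => ?_
    rw [← Finset.sum_mul]
    refine mul_nonneg (hf k) (mul_nonneg ?_ (by positivity))
    rcases neg_one_pow_eq_or ℝ k with h | h <;> rw [h] <;> norm_num
  have hDp : (0 : ℝ) < D.card := by exact_mod_cast hD.card_pos
  have jen : ∀ u : G → ℝ, (1 + ε) * D.card ≤ ∑ x ∈ D, u x →
      (D.card : ℝ) * (1 + ε) ^ m ≤ ∑ x, u x ^ m := by
    intro u hu
    have h2 := Real.pow_arith_mean_le_arith_mean_pow_of_even D (fun _ => (D.card : ℝ)⁻¹) u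
      (fun _ _ => by positivity) (by simp; field_simp) hm
    rw [← Finset.mul_sum, ← Finset.mul_sum] at h2
    have h3 : (1 + ε) ^ m ≤ ((D.card : ℝ)⁻¹ * ∑ x ∈ D, u x) ^ m := by
      gcongr
      rw [inv_mul_eq_div, le_div_iff₀ hDp]; exact hu
    have h4 := h3.trans h2
    rw [inv_mul_eq_div, le_div_iff₀ hDp] at h4
    calc _ ≤ ∑ x ∈ D, u x ^ m := by linarith
      _ ≤ _ := Finset.sum_le_sum_of_subset_of_nonneg (Finset.subset_univ _)
        fun x _ _ => hm.pow_nonneg _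
  have hp1 : 0 ≤ ∑ x, (1 + f x) ^ m := Finset.sum_nonneg fun x _ => hm.pow_nonneg _
  have hp : 0 ≤ (D.card : ℝ) * (1 + ε) ^ m := by positivity
  rcases lt_abs.1 h with h | h
  · have := jen (fun x => 1 + f x) (by rw [Finset.sum_add_distrib]; simp; linarith)
    linarith
  · have := jen (fun x => 1 - f x) (by rw [Finset.sum_sub_distrib]; simp; linarith)
    linarith

noncomputable def kmInd {G : Type*} (A : Finset G) (x : G) : ℝ := if x ∈ A then 1 else 0

theorem kmInd_sum {G : Type*} [Fintype G] (A : Finset G) : ∑ x, kmInd A x = A.card := by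
  simp [kmInd]

theorem kmInd_nonneg {G : Type*} (A : Finset G) (x : G) : 0 ≤ kmInd A x := by
  unfold kmInd; split_ifs <;> norm_num

theorem kmInd_le_one {G : Type*} (A : Finset G) (x : G) : kmInd A x ≤ 1 := by
  unfold kmInd; split_ifs <;> norm_num

/-- number of representations as a difference -/
noncomputable def kmR {G : Type*} [AddCommGroup G] [Fintype G] (A : Finset G) (x : G) : ℝ :=
  ∑ z, kmInd A (x + z) * kmInd A z

section sift
variable {G : Type*} [AddCommGroup G] [Fintype G]

theorem kmR_nonneg (A : Finset G) (x : G) : 0 ≤ kmR A x :=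
  Finset.sum_nonneg fun _ _ => mul_nonneg (kmInd_nonneg _ _) (kmInd_nonneg _ _)

theorem kmR_bal (A : Finset G) (x : G) :
    ∑ z, (kmInd A (x + z) - A.card / Fintype.card G) * (kmInd A z - A.card / Fintype.card G) =
      kmR A x - (A.card : ℝ) ^ 2 / Fintype.card G := by
  have hN : (Fintype.card G : ℝ) ≠ 0 := by exact_mod_cast Fintype.card_ne_zero
  have h1 : ∑ z, kmInd A (x + z) = A.card := by
    rw [← kmInd_sum]; exact Equiv.sum_comp (Equiv.addLeft x) (kmInd A)
  simp only [sub_mul, mul_sub, Finset.sum_sub_distrib, ← Finset.sum_mul, ← Finset.mul_sum, h1,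
    kmInd_sum, kmR]
  simp
  field_simp
  ring

theorem km_sift (A D : Finset G) (hA : A.Nonempty) (hD : D.Nonempty) (ε η : ℝ) (hε : 0 < ε)
    (hη : 0 < η) (hη1 : η ≤ 1) (m : ℕ) (hm : Even m)
    (hm2 : 4 * (1 + ε / 2) ^ m < η * (D.card / Fintype.card G) * (1 + ε) ^ m)
    (h : ε * D.card * ((A.card : ℝ) ^ 2 / Fintype.card G) <
      |∑ x ∈ D, (kmR A x - (A.card : ℝ) ^ 2 / Fintype.card G)|) :
    ∃ B : Finset G, B.Nonempty ∧ ((A.card : ℝ) / Fintype.card G) ^ m * Fintype.card G ≤ B.card ∧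
      ∑ x ∈ B, ∑ y ∈ B,
        (if (1 + ε / 2) * ((A.card : ℝ) ^ 2 / Fintype.card G) < kmR A (x - y) then (0 : ℝ) else 1)
        ≤ η * (B.card : ℝ) ^ 2 := by
  have hN : (0 : ℝ) < Fintype.card G := by exact_mod_cast Fintype.card_pos
  have hAp : (0 : ℝ) < A.card := by exact_mod_cast hA.card_pos
  set N : ℝ := (Fintype.card G : ℝ) with hNdef
  set K : ℝ := (A.card : ℝ) ^ 2 / N with hK
  have hKp : 0 < K := by positivity
  set α : ℝ := A.card / N with hα
  have hαp : 0 < α := by positivity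
  set H : G → ℝ := fun x => if (1 + ε / 2) * K < kmR A x then (0 : ℝ) else 1 with hH
  let B : (Fin m → G) → Finset G := fun s => Finset.univ.filter fun x => ∀ i, x + s i ∈ A
  have hBi : ∀ s x, ∏ i, kmInd A (x + s i) = if x ∈ B s then 1 else 0 := by
    intro s x
    simp only [kmInd, B, Finset.mem_filter, Finset.mem_univ, true_and]
    split_ifs with hx
    · exact Finset.prod_eq_one fun i _ => by simp [hx i]
    · push Not at hx
      obtain ⟨i, hi⟩ := hx
      exact Finset.prod_eq_zero (Finset.mem_univ i) (by simp [hi])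
  have hid : ∀ h : G → ℝ, ∑ s : Fin m → G, ∑ x ∈ B s, ∑ y ∈ B s, h (x - y) =
      N * ∑ x, h x * kmR A x ^ m := by
    intro h
    have := km_corr (kmInd A) h m
    simp only [hBi] at this
    rw [← hNdef] at this
    unfold kmR
    rw [← this]
    refine Finset.sum_congr rfl fun s _ => ?_
    simp [Finset.sum_ite_mem]
  -- lower bound
  have hf0 : ∀ k : ℕ, 0 ≤ ∑ x, (kmR A x / K - 1) ^ k := by
    intro k
    have h1 := km_corr_nonneg (fun z => kmInd A z - A.card / Fintype.card G) k
    simp only [kmR_bal] at h1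
    have : ∀ x, (kmR A x / K - 1) ^ k = (kmR A x - K) ^ k * (K ^ k)⁻¹ := by
      intro x
      rw [show kmR A x / K - 1 = (kmR A x - K) / K by field_simp, div_pow]; rfl
    simp_rw [this]
    rw [← Finset.sum_mul]
    exact mul_nonneg h1 (by positivity)
  have hub := km_unbalance (fun x => kmR A x / K - 1) hf0 D hD ε hε (by
    have : ∑ x ∈ D, (kmR A x / K - 1) = (∑ x ∈ D, (kmR A x - K)) / K := by
      rw [Finset.sum_div]
      refine Finset.sum_congr rfl fun x _ => ?_
      field_simp
    simp only [this]
    rw [abs_div, abs_of_pos hKp, lt_div_iff₀ hKp]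
    exact h) m hm
  have hlow : N * (K ^ m * (D.card * (1 + ε) ^ m / 2)) ≤ ∑ s, ((B s).card : ℝ) ^ 2 := by
    have h1 := hid (fun _ => 1)
    simp only [Finset.sum_const, nsmul_eq_mul, mul_one, one_mul, ← pow_two] at h1
    rw [h1]
    gcongr
    calc _ ≤ K ^ m * ∑ x, (1 + (kmR A x / K - 1)) ^ m := by gcongr
      _ = _ := by
        rw [Finset.mul_sum]
        refine Finset.sum_congr rfl fun x _ => ?_
        rw [← mul_pow]; congr 1; field_simp; ring
  have hup : ∑ s, ∑ x ∈ B s, ∑ y ∈ B s, H (x - y) ≤ N * (N * ((1 + ε / 2) * K) ^ m) := by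
    rw [hid]
    gcongr
    calc ∑ x, H x * kmR A x ^ m ≤ ∑ x : G, ((1 + ε / 2) * K) ^ m := by
          refine Finset.sum_le_sum fun x _ => ?_
          simp only [hH]
          split_ifs with hx
          · simp; positivity
          · rw [one_mul]
            exact pow_le_pow_left₀ (kmR_nonneg _ _) (not_lt.1 hx) _
      _ = _ := by simp [hNdef]
  by_contra hcon
  push Not at hcon
  have hs : ∀ s, η * ((B s).card : ℝ) ^ 2 ≤
      (∑ x ∈ B s, ∑ y ∈ B s, H (x - y)) + η * (α ^ m * N) ^ 2 := by
    intro s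
    have hHn : 0 ≤ ∑ x ∈ B s, ∑ y ∈ B s, H (x - y) :=
      Finset.sum_nonneg fun x _ => Finset.sum_nonneg fun y _ => by
        simp only [hH]; split_ifs <;> norm_num
    by_cases hc : α ^ m * N ≤ (B s).card
    · have hne : (B s).Nonempty := by
        rw [← Finset.card_pos]
        have : (0 : ℝ) < (B s).card := lt_of_lt_of_le (by positivity) hc
        exact_mod_cast this
      have := hcon (B s) hne hc
      have h3 : 0 ≤ η * (α ^ m * N) ^ 2 := by positivity
      linarith
    · have : ((B s).card : ℝ) ^ 2 ≤ (α ^ m * N) ^ 2 := by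
        gcongr; exact (not_le.1 hc).le
      nlinarith
  have hsum := Finset.sum_le_sum fun s (_ : s ∈ (Finset.univ : Finset (Fin m → G))) => hs s
  rw [← Finset.mul_sum, Finset.sum_add_distrib] at hsum
  simp only [Finset.sum_const, Finset.card_univ, Fintype.card_pi, Finset.prod_const,
    Fintype.card_fin, nsmul_eq_mul, Nat.cast_pow, ← hNdef] at hsum
  have hKm : K ^ m = α ^ m * α ^ m * N ^ m := by
    rw [← mul_pow, ← mul_pow]; congr 1; simp only [hK, hα]; field_simp
  have hfin : N ^ 2 * K ^ m * (η * (D.card / N) * (1 + ε) ^ m) ≤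
      N ^ 2 * K ^ m * (4 * (1 + ε / 2) ^ m) := by
    have e1 : N ^ 2 * K ^ m * (η * (D.card / N) * (1 + ε) ^ m) =
      2 * (η * (N * (K ^ m * (D.card * (1 + ε) ^ m / 2)))) := by field_simp
    have e2 : N ^ m * (η * (α ^ m * N) ^ 2) = η * (N ^ 2 * K ^ m) := by rw [hKm]; ring
    have h1 : η * (N * (K ^ m * (D.card * (1 + ε) ^ m / 2))) ≤
        η * ∑ s, ((B s).card : ℝ) ^ 2 := by gcongr
    rw [e2] at hsum
    have h5 : 1 ≤ (1 + ε / 2) ^ m := one_le_pow₀ (by linarith)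
    have h6 : η * (N ^ 2 * K ^ m) ≤ (1 + ε / 2) ^ m * (N ^ 2 * K ^ m) := by
      gcongr; linarith
    rw [mul_pow] at hup
    rw [e1]
    nlinarith
  have := lt_of_mul_lt_mul_left (lt_of_le_of_lt hfin (mul_lt_mul_of_pos_left hm2 (by positivity : 0 < N ^ 2 * K ^ m)))
    (by positivity)
  exact lt_irrefl _ this

end sift

section cs
variable {G : Type*} [AddCommGroup G] [Fintype G]

theorem km_hoeff1 (B : Finset G) (X : G → ℝ) (hX : ∀ b ∈ B, |X b| ≤ 1)
    (h0 : ∑ b ∈ B, X b = 0) (κ : ℝ) (hκ : 0 ≤ κ) (k : ℕ) :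
    (((Fintype.piFinset fun _ : Fin k => B).filter fun y => κ * k < ∑ i, X (y i)).card : ℝ) ≤
      (B.card : ℝ) ^ k * Real.exp (-(k * κ ^ 2 / 2)) := by
  have h1 : ∑ y ∈ Fintype.piFinset fun _ : Fin k => B, Real.exp (κ * ∑ i, X (y i)) ≤
      (B.card : ℝ) ^ k * Real.exp (k * κ ^ 2 / 2) := by
    calc _ = ∑ y ∈ Fintype.piFinset fun _ : Fin k => B, ∏ i, Real.exp (κ * X (y i)) := by
          refine Finset.sum_congr rfl fun y _ => ?_
          rw [Finset.mul_sum, Real.exp_sum]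
      _ = (∑ b ∈ B, Real.exp (κ * X b)) ^ k := by
          rw [← Fin.prod_const k, Finset.prod_univ_sum]
      _ ≤ (B.card * Real.exp (κ ^ 2 / 2)) ^ k := by
          gcongr
          exact km_avg_exp B X hX h0 κ
      _ = _ := by rw [mul_pow, ← Real.exp_nat_mul]; ring_nf
  have h2 : (((Fintype.piFinset fun _ : Fin k => B).filter fun y => κ * k < ∑ i, X (y i)).card : ℝ)
      * Real.exp (k * κ ^ 2) ≤ (B.card : ℝ) ^ k * Real.exp (k * κ ^ 2 / 2) := by
    refine le_trans ?_ h1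
    rw [← nsmul_eq_mul]
    refine le_trans ?_ (Finset.sum_le_sum_of_subset_of_nonneg (Finset.filter_subset
      (fun y : Fin k → G => κ * k < ∑ i, X (y i)) _) fun _ _ _ => (Real.exp_pos _).le)
    refine Finset.card_nsmul_le_sum _ _ _ fun y hy => ?_
    rw [Finset.mem_filter] at hy
    apply Real.exp_le_exp.2
    nlinarith [hy.2]
  rw [← mul_le_mul_iff_left₀ (Real.exp_pos (k * κ ^ 2)), mul_assoc, ← Real.exp_add]
  rw [show -(k * κ ^ 2 / 2) + k * κ ^ 2 = k * κ ^ 2 / 2 by ring]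
  exact h2

theorem km_hoeff (B : Finset G) (X : G → ℝ) (hX : ∀ b ∈ B, |X b| ≤ 1)
    (h0 : ∑ b ∈ B, X b = 0) (κ : ℝ) (hκ : 0 ≤ κ) (k : ℕ) :
    (((Fintype.piFinset fun _ : Fin k => B).filter fun y => κ * k < |∑ i, X (y i)|).card : ℝ) ≤
      2 * ((B.card : ℝ) ^ k * Real.exp (-(k * κ ^ 2 / 2))) := by
  have h1 := km_hoeff1 B X hX h0 κ hκ k
  have h2 := km_hoeff1 B (fun x => - X x) (by simpa using hX) (by simp [h0]) κ hκ k
  have h3 : ((Fintype.piFinset fun _ : Fin k => B).filter fun y => κ * k < |∑ i, X (y i)|) ⊆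
      ((Fintype.piFinset fun _ : Fin k => B).filter fun y => κ * k < ∑ i, X (y i)) ∪
      ((Fintype.piFinset fun _ : Fin k => B).filter fun y => κ * k < ∑ i, - X (y i)) := by
    intro y hy
    simp only [Finset.mem_union, Finset.mem_filter, Finset.sum_neg_distrib] at hy ⊢
    rcases lt_abs.1 hy.2 with h | h
    · exact Or.inl ⟨hy.1, h⟩
    · exact Or.inr ⟨hy.1, h⟩
  have h4 := (Finset.card_le_card h3).trans (Finset.card_union_le _ _)
  have h5 : (((Fintype.piFinset fun _ : Fin k => B).filter
    fun y => κ * k < |∑ i, X (y i)|).card : ℝ) ≤ _ := Nat.cast_le.2 h4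
  push_cast at h5
  linarith

noncomputable def kmPsi (B S : Finset G) (w : G) : ℝ :=
  (∑ b ∈ B, ∑ b' ∈ B, kmInd S (b - b' + w)) / (B.card : ℝ) ^ 2

theorem km_croot_sisask (B S : Finset G) (hB : B.Nonempty) (κ : ℝ) (hκ : 0 < κ) (k : ℕ)
    (hk : 0 < k)
    (hk2 : 4 * Real.exp (-(k * κ ^ 2 / 2)) ≤ κ * (B.card / Fintype.card G)) :
    ∃ T : Finset G, T.Nonempty ∧
      ((B.card : ℝ) / Fintype.card G) ^ k / 2 * Fintype.card G ≤ T.card ∧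
      ∀ w, ∀ t ∈ T, ∀ t' ∈ T, |kmPsi B S (w + (t - t')) - kmPsi B S w| ≤ 4 * κ := by
  have hN : (0 : ℝ) < Fintype.card G := by exact_mod_cast Fintype.card_pos
  have hBp : (0 : ℝ) < B.card := by exact_mod_cast hB.card_pos
  set N : ℝ := (Fintype.card G : ℝ) with hNdef
  have hkp : (0 : ℝ) < k := by exact_mod_cast hk
  set φ : G → ℝ := fun x => (∑ b ∈ B, kmInd S (x - b)) / B.card with hφ
  have hφ0 : ∀ x, 0 ≤ φ x := fun x => div_nonneg
    (Finset.sum_nonneg fun _ _ => kmInd_nonneg _ _) hBp.le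
  have hφ1 : ∀ x, φ x ≤ 1 := fun x => by
    simp only [hφ]
    rw [div_le_one hBp]
    calc _ ≤ ∑ b ∈ B, (1 : ℝ) := Finset.sum_le_sum fun _ _ => kmInd_le_one _ _
      _ = _ := by simp
  have hpsi : ∀ w, kmPsi B S w = (∑ b ∈ B, φ (b + w)) / B.card := by
    intro w
    simp only [kmPsi, hφ]
    rw [← Finset.sum_div, div_div, ← pow_two]
    congr 1
    refine Finset.sum_congr rfl fun b _ => Finset.sum_congr rfl fun b' _ => ?_
    congr 1; abel
  set P := Fintype.piFinset fun _ : Fin k => B with hP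
  have hPc : (P.card : ℝ) = (B.card : ℝ) ^ k := by simp [hP]
  let bad : (Fin k → G) → Finset G := fun y =>
    Finset.univ.filter fun x => κ * k < |∑ i, (kmInd S (x - y i) - φ x)|
  have hbad : ∑ y ∈ P, ((bad y).card : ℝ) ≤
      N * (2 * ((B.card : ℝ) ^ k * Real.exp (-(k * κ ^ 2 / 2)))) := by
    have e : ∑ y ∈ P, ((bad y).card : ℝ) =
        ∑ x : G, ((P.filter fun y => κ * k < |∑ i, (kmInd S (x - y i) - φ x)|).card : ℝ) := by
      simp only [bad, Finset.card_filter, Nat.cast_sum]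
      rw [Finset.sum_comm]
    rw [e]
    calc _ ≤ ∑ x : G, (2 * ((B.card : ℝ) ^ k * Real.exp (-(k * κ ^ 2 / 2)))) := by
          refine Finset.sum_le_sum fun x _ => ?_
          refine km_hoeff B (fun b => kmInd S (x - b) - φ x) ?_ ?_ κ hκ.le k
          · intro b _
            rw [abs_le]
            constructor <;> linarith [hφ0 x, hφ1 x, kmInd_nonneg S (x - b), kmInd_le_one S (x - b)]
          · rw [Finset.sum_sub_distrib]
            simp only [hφ, Finset.sum_const, nsmul_eq_mul]
            field_simp
            ring
      _ = _ := by simp [hNdef]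
  set L := P.filter fun y => ((bad y).card : ℝ) ≤ κ * B.card with hL
  have hLc : (B.card : ℝ) ^ k / 2 ≤ L.card := by
    have h1 : (((P.filter fun y => ¬ ((bad y).card : ℝ) ≤ κ * B.card).card : ℝ)) * (κ * B.card) ≤
        ∑ y ∈ P, ((bad y).card : ℝ) := by
      rw [← nsmul_eq_mul]
      refine le_trans ?_ (Finset.sum_le_sum_of_subset_of_nonneg (Finset.filter_subset
        (fun y => ¬ ((bad y).card : ℝ) ≤ κ * B.card) _) fun _ _ _ => by positivity)
      refine Finset.card_nsmul_le_sum _ _ _ fun y hy => ?_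
      rw [Finset.mem_filter, not_le] at hy
      exact hy.2.le
    have h2 : ((L.card : ℝ)) +
        ((P.filter fun y => ¬ ((bad y).card : ℝ) ≤ κ * B.card).card : ℝ) = P.card := by
      exact_mod_cast Finset.card_filter_add_card_filter_not (s := P)
        (fun y => ((bad y).card : ℝ) ≤ κ * B.card)
    have h3 : N * (2 * ((B.card : ℝ) ^ k * Real.exp (-(k * κ ^ 2 / 2)))) ≤
        (B.card : ℝ) ^ k / 2 * (κ * B.card) := by
      have : N * (2 * ((B.card : ℝ) ^ k * Real.exp (-(k * κ ^ 2 / 2)))) =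
        (N * (B.card : ℝ) ^ k / 2) * (4 * Real.exp (-(k * κ ^ 2 / 2))) := by ring
      rw [this]
      calc _ ≤ (N * (B.card : ℝ) ^ k / 2) * (κ * (B.card / N)) := by gcongr
        _ = _ := by field_simp
    have h4 := le_of_mul_le_mul_right (h1.trans (hbad.trans h3)) (by positivity)
    rw [hPc] at h2
    linarith
  have hex : ∃ y : Fin k → G, (L.card : ℝ) * N ≤
      N ^ k * ((Finset.univ.filter fun t : G => (fun i => y i - t) ∈ L).card : ℝ) := by
    by_contra hcon
    push Not at hcon
    have h1 := Finset.sum_lt_sum_of_nonempty (s := (Finset.univ : Finset (Fin k → G)))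
      Finset.univ_nonempty fun y _ => hcon y
    rw [← Finset.mul_sum] at h1
    have h2 : ∑ y : Fin k → G,
        ((Finset.univ.filter fun t : G => (fun i => y i - t) ∈ L).card : ℝ) = N * L.card := by
      simp only [Finset.card_filter, Nat.cast_sum]
      rw [Finset.sum_comm]
      have : ∀ t : G, ∑ y : Fin k → G, ((if (fun i => y i - t) ∈ L then 1 else 0 : ℕ) : ℝ) =
          L.card := by
        intro t
        have := Equiv.sum_comp (Equiv.subRight (fun _ : Fin k => t))
          (fun y => ((if y ∈ L then 1 else 0 : ℕ) : ℝ))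
        calc _ = ∑ y : Fin k → G, ((if y ∈ L then 1 else 0 : ℕ) : ℝ) := this
          _ = _ := by simp
      simp_rw [this]
      simp [hNdef]
    rw [h2] at h1
    simp only [Finset.sum_const, Finset.card_univ, Fintype.card_pi, Finset.prod_const,
      Fintype.card_fin, nsmul_eq_mul, Nat.cast_pow, ← hNdef] at h1
    linarith
  obtain ⟨y, hy⟩ := hex
  set T := Finset.univ.filter fun t : G => (fun i => y i - t) ∈ L with hT
  have hTc : ((B.card : ℝ) / N) ^ k / 2 * N ≤ T.card := by
    have : (B.card : ℝ) ^ k / 2 * N ≤ N ^ k * T.card :=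
      le_trans (by gcongr) hy
    rw [div_pow]
    rw [div_div, div_mul_eq_mul_div, div_le_iff₀ (by positivity)]
    linarith
  refine ⟨T, ?_, hTc, ?_⟩
  · rw [← Finset.card_pos]
    have : (0 : ℝ) < T.card := lt_of_lt_of_le (by positivity) hTc
    exact_mod_cast this
  set a : G → ℝ := fun x => (∑ i, kmInd S (x - y i)) / k with ha
  have key : ∀ w, ∀ t ∈ T, |(∑ b ∈ B, a (b + (w + t))) / B.card - kmPsi B S w| ≤ 2 * κ := by
    intro w t ht
    have htL : (fun i => y i - t) ∈ L := (Finset.mem_filter.1 ht).2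
    have htb : ((bad fun i => y i - t).card : ℝ) ≤ κ * B.card := (Finset.mem_filter.1 htL).2
    rw [hpsi, ← sub_div, ← Finset.sum_sub_distrib, abs_div, abs_of_pos hBp, div_le_iff₀ hBp]
    have hpt : ∀ b, |a (b + (w + t)) - φ (b + w)| ≤ κ + kmInd (bad fun i => y i - t) (b + w) := by
      intro b
      have e : a (b + (w + t)) - φ (b + w) =
          (∑ i, (kmInd S (b + w - (y i - t)) - φ (b + w))) / k := by
        simp only [ha, Finset.sum_sub_distrib, Finset.sum_const, Finset.card_univ,
          Fintype.card_fin, nsmul_eq_mul]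
        have : ∀ i, b + (w + t) - y i = b + w - (y i - t) := fun i => by abel
        simp_rw [this]
        field_simp
      by_cases hb : b + w ∈ bad fun i => y i - t
      · have h0 : 0 ≤ a (b + (w + t)) := by
          simp only [ha]
          exact div_nonneg (Finset.sum_nonneg fun _ _ => kmInd_nonneg _ _) hkp.le
        have h1 : a (b + (w + t)) ≤ 1 := by
          simp only [ha]
          rw [div_le_one hkp]
          calc _ ≤ ∑ i : Fin k, (1 : ℝ) := Finset.sum_le_sum fun _ _ => kmInd_le_one _ _
            _ = _ := by simp
        have h2 : kmInd (bad fun i => y i - t) (b + w) = 1 := by simp [kmInd, hb]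
        rw [h2, abs_le]
        constructor <;> linarith [hφ0 (b + w), hφ1 (b + w)]
      · have h2 : kmInd (bad fun i => y i - t) (b + w) = 0 := by simp [kmInd, hb]
        rw [h2, e, abs_div, abs_of_pos hkp, div_le_iff₀ hkp]
        simp only [bad, Finset.mem_filter, Finset.mem_univ, true_and, not_lt] at hb
        linarith
    calc _ ≤ ∑ b ∈ B, |a (b + (w + t)) - φ (b + w)| := Finset.abs_sum_le_sum_abs _ _
      _ ≤ ∑ b ∈ B, (κ + kmInd (bad fun i => y i - t) (b + w)) :=
          Finset.sum_le_sum fun b _ => hpt b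
      _ = κ * B.card + ∑ b ∈ B, kmInd (bad fun i => y i - t) (b + w) := by
          rw [Finset.sum_add_distrib]; simp [mul_comm]
      _ ≤ κ * B.card + ∑ b, kmInd (bad fun i => y i - t) (b + w) := by
          gcongr
          · exact fun _ _ _ => kmInd_nonneg _ _
          · exact Finset.subset_univ _
      _ = κ * B.card + (bad fun i => y i - t).card := by
          rw [← kmInd_sum (bad fun i => y i - t)]
          congr 1
          exact Equiv.sum_comp (Equiv.addRight w) (kmInd (bad fun i => y i - t))
      _ ≤ _ := by linarith
  intro w t ht t' ht'
  have h1 := key w t ht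
  have h2 := key (w + (t - t')) t' ht'
  rw [show w + (t - t') + t' = w + t by abel] at h2
  rw [abs_le] at *
  constructor <;> linarith

end cs

section fourier
variable {F G : Type*} [Field F] [Fintype F] [AddCommGroup G] [Fintype G] [Module F G]

theorem km_orth [Fintype (Module.Dual F G)] (e : AddChar F ℂ) (he : e ≠ 1) (x : G) :
    ∑ l : Module.Dual F G, e (l x) = if x = 0 then (Fintype.card G : ℂ) else 0 := by
  split_ifs with hx
  · have h1 : Fintype.card (Module.Dual F G) = Fintype.card G := by
      rw [Module.card_eq_pow_finrank (K := F) (V := G),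
        Module.card_eq_pow_finrank (K := F) (V := Module.Dual F G), Subspace.dual_finrank_eq]
    simp [hx, h1]
  · let ev : Module.Dual F G →+ F := (Module.Dual.eval F G x).toAddMonoidHom
    have h1 : e.compAddMonoidHom ev ≠ 1 := by
      obtain ⟨a, ha⟩ := AddChar.ne_one_iff.1 he
      have : ∃ l : Module.Dual F G, l x ≠ 0 := by
        by_contra hc
        push Not at hc
        exact hx ((Module.forall_dual_apply_eq_zero_iff F x).1 hc)
      obtain ⟨l, hl⟩ := this
      refine AddChar.ne_one_iff.2 ⟨(a / l x) • l, ?_⟩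
      simpa [ev, hl] using ha
    exact AddChar.sum_eq_zero_of_ne_one h1

theorem km_surj {ι : Type*} [Fintype ι] (l : ι → Module.Dual F G) (hl : LinearIndependent F l) :
    Function.Surjective (LinearMap.pi l : G →ₗ[F] (ι → F)) := by
  rw [← LinearMap.dualMap_injective_iff, ← LinearMap.ker_eq_bot, LinearMap.ker_eq_bot']
  intro g hg
  have h1 : ∑ i, g (Pi.single i 1) • l i = 0 := by
    ext x
    have := LinearMap.congr_fun hg x
    simp only [LinearMap.dualMap_apply, LinearMap.zero_apply] at this
    rw [LinearMap.pi_apply_eq_sum_univ g] at this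
    have e : ∀ i : ι, (fun j => if i = j then (1 : F) else 0) = Pi.single i 1 := by
      intro i; ext j; simp [Pi.single_apply, eq_comm]
    simp only [e] at this
    simpa [mul_comm] using this
  have h2 := Fintype.linearIndependent_iff.1 hl _ h1
  refine LinearMap.pi_ext' fun i => ?_
  ext
  simpa using h2 i

theorem km_uniform {ι : Type*} [Fintype ι] (l : ι → Module.Dual F G)
    (hl : LinearIndependent F l) (h : (ι → F) → ℝ) :
    (Fintype.card F : ℝ) ^ Fintype.card ι * ∑ x, h (fun i => l i x) =
      Fintype.card G * ∑ y, h y := by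
  have h1 : ∀ y : ι → F, ∑ x, h (fun i => l i x) = ∑ x, h ((fun i => l i x) + y) := by
    intro y
    obtain ⟨z, rfl⟩ := km_surj l hl y
    rw [← Equiv.sum_comp (Equiv.addRight z)]
    refine Finset.sum_congr rfl fun x _ => ?_
    congr 1
    ext i
    simp
  calc _ = ∑ y : ι → F, ∑ x, h (fun i => l i x) := by simp
    _ = ∑ y : ι → F, ∑ x, h ((fun i => l i x) + y) := Finset.sum_congr rfl fun y _ => h1 y
    _ = ∑ x : G, ∑ y : ι → F, h ((fun i => l i x) + y) := Finset.sum_comm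
    _ = ∑ x : G, ∑ y : ι → F, h y := by
        refine Finset.sum_congr rfl fun x _ => ?_
        exact Equiv.sum_comp (Equiv.addLeft (fun i => l i x)) h
    _ = _ := by simp

theorem km_chang (e : AddChar F ℂ) (he : e ≠ 1) (T : Finset G) (hT : T.Nonempty)
    {ι : Type*} [Fintype ι] (l : ι → Module.Dual F G) (hl : LinearIndependent F l)
    (hs : ∀ i, (T.card : ℝ) / 2 ≤ ‖∑ t ∈ T, e (l i t)‖) :
    (Fintype.card ι : ℝ) ≤ 8 * Real.log (Fintype.card G / T.card) := by
  have hN : (0 : ℝ) < Fintype.card G := by exact_mod_cast Fintype.card_pos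
  have hq : (0 : ℝ) < Fintype.card F := by exact_mod_cast Fintype.card_pos
  have hTp : (0 : ℝ) < T.card := by exact_mod_cast hT.card_pos
  set d : ℝ := (Fintype.card ι : ℝ) with hd
  let z : ι → ℂ := fun i => ∑ t ∈ T, e (l i t)
  have hz : ∀ i, 0 < ‖z i‖ := fun i => lt_of_lt_of_le (by positivity) (hs i)
  let c : ι → ℂ := fun i => (starRingEnd ℂ) (z i) / ‖z i‖
  have hc : ∀ i, ‖c i‖ = 1 := fun i => by
    simp only [c, norm_div, RCLike.norm_conj, Complex.norm_real, norm_norm]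
    exact div_self (hz i).ne'
  have hcz : ∀ i, (c i * z i).re = ‖z i‖ := fun i => by
    have : c i * z i = (‖z i‖ : ℂ) := by
      simp only [c]
      rw [div_mul_eq_mul_div, mul_comm, Complex.mul_conj']
      have : (‖z i‖ : ℂ) ≠ 0 := by exact_mod_cast (hz i).ne'
      field_simp
    rw [this, Complex.ofReal_re]
  let X : ι → F → ℝ := fun i a => (c i * e a).re
  have hX1 : ∀ i a, |X i a| ≤ 1 := fun i a => by
    refine (Complex.abs_re_le_norm _).trans ?_
    rw [norm_mul, hc, AddChar.norm_apply, one_mul]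
  have hX0 : ∀ i, ∑ a, X i a = 0 := fun i => by
    simp only [X]
    rw [← Complex.re_sum, ← Finset.mul_sum, AddChar.sum_eq_zero_of_ne_one he]; simp
  have hXT : ∀ i, (T.card : ℝ) / 2 ≤ ∑ t ∈ T, X i (l i t) := fun i => by
    simp only [X]
    rw [← Complex.re_sum, ← Finset.mul_sum]
    exact (hs i).trans (hcz i).ge
  have hup : ∑ x, Real.exp (1 / 2 * ∑ i, X i (l i x)) ≤ Fintype.card G * Real.exp (d / 8) := by
    have h1 := km_uniform l hl (fun y => Real.exp (1 / 2 * ∑ i, X i (y i)))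
    have h2 : ∑ y : ι → F, Real.exp (1 / 2 * ∑ i, X i (y i)) ≤
        (Fintype.card F : ℝ) ^ Fintype.card ι * Real.exp (d / 8) := by
      calc _ = ∑ y : ι → F, ∏ i, Real.exp (1 / 2 * X i (y i)) := by
            refine Finset.sum_congr rfl fun y _ => ?_
            rw [Finset.mul_sum, Real.exp_sum]
        _ = ∏ i, ∑ a : F, Real.exp (1 / 2 * X i a) := by
            rw [Finset.prod_univ_sum]; simp
        _ ≤ ∏ i : ι, (Fintype.card F * Real.exp ((1 / 2) ^ 2 / 2)) := by
            refine Finset.prod_le_prod (fun i _ => Finset.sum_nonneg fun _ _ => (Real.exp_pos _).le)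
              fun i _ => ?_
            simpa using km_avg_exp Finset.univ (X i) (fun a _ => hX1 i a) (hX0 i) (1 / 2)
        _ = _ := by
            rw [Finset.prod_const, Finset.card_univ, mul_pow, ← Real.exp_nat_mul]
            congr 2; rw [hd]; ring
    have h3 : (Fintype.card F : ℝ) ^ Fintype.card ι *
        ∑ x, Real.exp (1 / 2 * ∑ i, X i (l i x)) ≤ (Fintype.card F : ℝ) ^ Fintype.card ι *
        (Fintype.card G * Real.exp (d / 8)) := by
      rw [h1]
      calc _ ≤ (Fintype.card G : ℝ) * ((Fintype.card F : ℝ) ^ Fintype.card ι * Real.exp (d / 8)) :=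
            by gcongr
        _ = _ := by ring
    exact le_of_mul_le_mul_left h3 (by positivity)
  have hlow : (T.card : ℝ) * Real.exp (d / 4) ≤ ∑ x, Real.exp (1 / 2 * ∑ i, X i (l i x)) := by
    refine le_trans ?_ (Finset.sum_le_sum_of_subset_of_nonneg (Finset.subset_univ T)
      fun _ _ _ => (Real.exp_pos _).le)
    have h1 : ∀ x, Real.exp (d / 4) * (1 + (1 / 2 * ∑ i, X i (l i x) - d / 4)) ≤
        Real.exp (1 / 2 * ∑ i, X i (l i x)) := by
      intro x
      have := Real.add_one_le_exp (1 / 2 * ∑ i, X i (l i x) - d / 4)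
      calc _ ≤ Real.exp (d / 4) * Real.exp (1 / 2 * ∑ i, X i (l i x) - d / 4) := by
            gcongr; linarith
        _ = _ := by rw [← Real.exp_add]; congr 1; ring
    refine le_trans ?_ (Finset.sum_le_sum fun x _ => h1 x)
    rw [← Finset.mul_sum, mul_comm]
    gcongr
    rw [Finset.sum_add_distrib, Finset.sum_sub_distrib, ← Finset.mul_sum, Finset.sum_comm]
    have h2 : ∑ i : ι, (T.card : ℝ) / 2 ≤ ∑ i, ∑ t ∈ T, X i (l i t) :=
      Finset.sum_le_sum fun i _ => hXT i
    simp only [Finset.sum_const, Finset.card_univ, nsmul_eq_mul, ← hd] at h2 ⊢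
    linarith
  have h := hlow.trans hup
  have h2 : Real.exp (d / 8) ≤ Fintype.card G / T.card := by
    rw [le_div_iff₀ hTp]
    have e1 : Real.exp (d / 4) = Real.exp (d / 8) * Real.exp (d / 8) := by
      rw [← Real.exp_add]; congr 1; ring
    rw [e1] at h
    refine le_of_mul_le_mul_right (a := Real.exp (d / 8)) ?_ (Real.exp_pos _)
    linarith
  have := (Real.le_log_iff_exp_le (by positivity)).2 h2
  linarith

theorem km_fourier [Fintype (Module.Dual F G)] (e : AddChar F ℂ) (he : e ≠ 1) (B S : Finset G)
    (hB : B.Nonempty) :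
    ∃ w : Module.Dual F G → ℂ, ∑ l, ‖w l‖ ≤ Fintype.card G / B.card ∧
      ∀ u, (kmPsi B S u : ℂ) = ∑ l, w l * e (l u) := by
  have hN : (0 : ℝ) < Fintype.card G := by exact_mod_cast Fintype.card_pos
  have hBp : (0 : ℝ) < B.card := by exact_mod_cast hB.card_pos
  have hN' : (Fintype.card G : ℂ) ≠ 0 := by exact_mod_cast hN.ne'
  have hB' : (B.card : ℂ) ≠ 0 := by exact_mod_cast hBp.ne'
  refine ⟨fun l => (∑ s ∈ S, e (-(l s))) / Fintype.card G *
    ((∑ b ∈ B, e (l b)) * (∑ b ∈ B, e (-(l b)))) / (B.card : ℂ) ^ 2, ?_, ?_⟩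
  · have hpar : ∑ l : Module.Dual F G, ‖∑ b ∈ B, e (l b)‖ ^ 2 =
        (Fintype.card G : ℝ) * B.card := by
      have : ((∑ l : Module.Dual F G, ‖∑ b ∈ B, e (l b)‖ ^ 2 : ℝ) : ℂ) =
          (Fintype.card G : ℂ) * B.card := by
        push_cast
        calc _ = ∑ l : Module.Dual F G, ∑ b ∈ B, ∑ b' ∈ B, e (l (b - b')) := by
              refine Finset.sum_congr rfl fun l _ => ?_
              rw [← Complex.mul_conj', map_sum, Finset.sum_mul_sum]
              refine Finset.sum_congr rfl fun b _ => Finset.sum_congr rfl fun b' _ => ?_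
              rw [← AddChar.map_neg_eq_conj, ← AddChar.map_add_eq_mul, ← map_neg, ← map_add,
                sub_eq_add_neg]
          _ = ∑ b ∈ B, ∑ b' ∈ B, ∑ l : Module.Dual F G, e (l (b - b')) := by
              rw [Finset.sum_comm]
              refine Finset.sum_congr rfl fun b _ => ?_
              rw [Finset.sum_comm]
          _ = _ := by
              simp_rw [km_orth e he, sub_eq_zero]
              simp [mul_comm]
      exact_mod_cast this
    have hle : ∀ l : Module.Dual F G, ‖(∑ s ∈ S, e (-(l s))) / Fintype.card G *
        ((∑ b ∈ B, e (l b)) * (∑ b ∈ B, e (-(l b)))) / (B.card : ℂ) ^ 2‖ ≤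
        ‖∑ b ∈ B, e (l b)‖ ^ 2 / (B.card : ℝ) ^ 2 := by
      intro l
      have h1 : ‖(∑ s ∈ S, e (-(l s))) / (Fintype.card G : ℂ)‖ ≤ 1 := by
        rw [norm_div, Complex.norm_natCast, div_le_one hN]
        calc _ ≤ ∑ s ∈ S, ‖e (-(l s))‖ := norm_sum_le _ _
          _ = S.card := by simp
          _ ≤ _ := by exact_mod_cast Finset.card_le_univ S
      have h2 : ‖∑ b ∈ B, e (-(l b))‖ = ‖∑ b ∈ B, e (l b)‖ := by
        simp_rw [AddChar.map_neg_eq_conj]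
        rw [← map_sum, RCLike.norm_conj]
      rw [norm_div, norm_mul, norm_mul _ (∑ b ∈ B, e (-(l b))), h2, norm_pow,
        Complex.norm_natCast, ← pow_two]
      gcongr
      exact mul_le_of_le_one_left (by positivity) h1
    calc _ ≤ ∑ l : Module.Dual F G, ‖∑ b ∈ B, e (l b)‖ ^ 2 / (B.card : ℝ) ^ 2 :=
          Finset.sum_le_sum fun l _ => hle l
      _ = _ := by
          rw [← Finset.sum_div, hpar]
          field_simp
  · intro u
    have hind : ∀ x, (kmInd S x : ℂ) =
        (∑ l : Module.Dual F G, ∑ s ∈ S, e (l (x - s))) / Fintype.card G := by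
      intro x
      rw [Finset.sum_comm]
      simp_rw [km_orth e he, sub_eq_zero]
      simp only [Finset.sum_ite_eq, kmInd]
      split_ifs <;> simp [hN']
    simp only [kmPsi]
    push_cast
    simp_rw [hind]
    calc _ = (∑ b ∈ B, ∑ b' ∈ B, ∑ l : Module.Dual F G, ∑ s ∈ S, e (l (b - b' + u - s))) /
          Fintype.card G / (B.card : ℂ) ^ 2 := by
          simp_rw [← Finset.sum_div]
      _ = (∑ l : Module.Dual F G, ∑ b ∈ B, ∑ b' ∈ B, ∑ s ∈ S, e (l (b - b' + u - s))) /
          Fintype.card G / (B.card : ℂ) ^ 2 := by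
          congr 2
          rw [Finset.sum_comm (s := Finset.univ)]
          refine Finset.sum_congr rfl fun b _ => ?_
          rw [Finset.sum_comm]
      _ = _ := by
          rw [Finset.sum_div, Finset.sum_div]
          refine Finset.sum_congr rfl fun l _ => ?_
          have : ∑ b ∈ B, ∑ b' ∈ B, ∑ s ∈ S, e (l (b - b' + u - s)) =
              (∑ b ∈ B, e (l b)) * ((∑ b ∈ B, e (-(l b))) * (∑ s ∈ S, e (-(l s)))) * e (l u) := by
            rw [Finset.sum_mul_sum, Finset.sum_mul, Finset.sum_mul]
            refine Finset.sum_congr rfl fun b _ => ?_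
            rw [Finset.mul_sum, Finset.sum_mul]
            refine Finset.sum_congr rfl fun b' _ => ?_
            rw [Finset.mul_sum, Finset.sum_mul]
            refine Finset.sum_congr rfl fun s _ => ?_
            rw [← AddChar.map_add_eq_mul, ← AddChar.map_add_eq_mul, ← AddChar.map_add_eq_mul]
            congr 1
            simp only [map_add, map_sub]
            ring
          rw [this]
          ring

end fourier

section iter
variable {F G : Type*} [Field F] [Fintype F] [AddCommGroup G] [Fintype G] [Module F G]

noncomputable def kmP {G : Type*} [AddCommGroup G] (T : Finset G) (g : G → ℝ) (x : G) : ℝ :=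
  (∑ t ∈ T, ∑ t' ∈ T, g (x + (t - t'))) / (T.card : ℝ) ^ 2

theorem kmP_close {G : Type*} [AddCommGroup G] (T : Finset G) (hT : T.Nonempty) (g : G → ℝ)
    (x : G) (a c : ℝ) (h : ∀ t ∈ T, ∀ t' ∈ T, |g (x + (t - t')) - a| ≤ c) :
    |kmP T g x - a| ≤ c := by
  have hTp : (0 : ℝ) < T.card := by exact_mod_cast hT.card_pos
  have e : kmP T g x - a = (∑ t ∈ T, ∑ t' ∈ T, (g (x + (t - t')) - a)) / (T.card : ℝ) ^ 2 := by
    simp only [kmP, Finset.sum_sub_distrib, Finset.sum_const, nsmul_eq_mul]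
    field_simp
  rw [e, abs_div, abs_of_pos (show (0 : ℝ) < (T.card : ℝ) ^ 2 by positivity),
    div_le_iff₀ (by positivity)]
  calc _ ≤ ∑ t ∈ T, ∑ t' ∈ T, |g (x + (t - t')) - a| :=
        (Finset.abs_sum_le_sum_abs _ _).trans
          (Finset.sum_le_sum fun t _ => Finset.abs_sum_le_sum_abs _ _)
    _ ≤ ∑ t ∈ T, ∑ t' ∈ T, c := Finset.sum_le_sum fun t ht => Finset.sum_le_sum fun t' ht' =>
        h t ht t' ht'
    _ = _ := by simp; ring

theorem kmP_iter {G : Type*} [AddCommGroup G] (T : Finset G) (hT : T.Nonempty) (g : G → ℝ) (c : ℝ)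
    (h : ∀ w, ∀ t ∈ T, ∀ t' ∈ T, |g (w + (t - t')) - g w| ≤ c) (j : ℕ) :
    ∀ x, |(kmP T)^[j] g x - g x| ≤ j * c := by
  induction j with
  | zero => intro x; simp
  | succ j ih =>
    intro x
    rw [Function.iterate_succ_apply']
    refine kmP_close T hT _ x _ _ fun t ht t' ht' => ?_
    have h1 := ih (x + (t - t'))
    have h2 := h x t ht t' ht'
    push_cast
    rw [abs_le] at *
    constructor <;> linarith

theorem km_period (B S T : Finset G) (hB : B.Nonempty) (hT : T.Nonempty) (c : ℝ) (j : ℕ)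
    (h : ∀ w, ∀ t ∈ T, ∀ t' ∈ T, |kmPsi B S (w + (t - t')) - kmPsi B S w| ≤ c) :
    ∃ V : Submodule F G, (Module.finrank F G : ℝ) - Module.finrank F V ≤
        8 * Real.log (Fintype.card G / T.card) ∧
      ∀ v ∈ V, kmPsi B S 0 - 2 * (j * c) - 2 * ((1 / 4) ^ j * (Fintype.card G / B.card)) ≤
        kmPsi B S v := by
  have hTp : (0 : ℝ) < T.card := by exact_mod_cast hT.card_pos
  have hT' : (T.card : ℂ) ≠ 0 := by exact_mod_cast hTp.ne'
  have : Finite (Module.Dual F G) := DFunLike.finite _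
  let _ : Fintype (Module.Dual F G) := Fintype.ofFinite _
  obtain ⟨e, he⟩ : ∃ e : AddChar F ℂ, e ≠ 1 := by
    obtain ⟨e, he⟩ := (AddChar.exists_apply_ne_zero (a := (1 : F))).2 one_ne_zero
    exact ⟨e, AddChar.ne_one_iff.2 ⟨1, he⟩⟩
  obtain ⟨w, hw, hpsi⟩ := km_fourier (F := F) e he B S hB
  let spec : Set (Module.Dual F G) := {l | (T.card : ℝ) / 2 ≤ ‖∑ t ∈ T, e (l t)‖}
  obtain ⟨b, hb, hbs, hbl⟩ := exists_linearIndependent F spec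
  refine ⟨(Submodule.span F spec).dualCoannihilator, ?_, ?_⟩
  · have h1 := Subspace.finrank_add_finrank_dualCoannihilator_eq (Submodule.span F spec)
    have : Fintype b := Fintype.ofFinite _
    have h2 : Module.finrank F (Submodule.span F spec) = Fintype.card b := by
      rw [← hbs, finrank_span_set_eq_card hbl, Set.toFinset_card]
    have h3 := km_chang e he T hT (fun i : b => (i : Module.Dual F G)) hbl fun i => hb i.2
    rw [← h1, h2]
    push_cast
    linarith
  · intro v hv
    rw [Submodule.mem_dualCoannihilator] at hv
    let lam : Module.Dual F G → ℂ := fun l =>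
      (∑ t ∈ T, e (l t)) * (∑ t ∈ T, e (-(l t))) / (T.card : ℂ) ^ 2
    have hlam : ∀ l, ‖lam l‖ = ‖∑ t ∈ T, e (l t)‖ ^ 2 / (T.card : ℝ) ^ 2 := by
      intro l
      have h2 : ‖∑ b ∈ T, e (-(l b))‖ = ‖∑ b ∈ T, e (l b)‖ := by
        simp_rw [AddChar.map_neg_eq_conj]
        rw [← map_sum, RCLike.norm_conj]
      simp only [lam]
      rw [norm_div, norm_mul, h2, norm_pow, Complex.norm_natCast, ← pow_two]
    have hit : ∀ (j : ℕ) (x : G), ((kmP T)^[j] (kmPsi B S) x : ℂ) =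
        ∑ l, w l * lam l ^ j * e (l x) := by
      intro j
      induction j with
      | zero => intro x; simp [hpsi]
      | succ j ih =>
        intro x
        rw [Function.iterate_succ_apply']
        simp only [kmP]
        push_cast
        simp_rw [ih]
        calc _ = (∑ l : Module.Dual F G, ∑ t ∈ T, ∑ t' ∈ T,
              w l * lam l ^ j * e (l (x + (t - t')))) / (T.card : ℂ) ^ 2 := by
              congr 1
              rw [Finset.sum_comm (s := Finset.univ)]
              refine Finset.sum_congr rfl fun b _ => ?_
              rw [Finset.sum_comm]
          _ = _ := by
              rw [Finset.sum_div]
              refine Finset.sum_congr rfl fun l _ => ?_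
              have : ∑ t ∈ T, ∑ t' ∈ T, w l * lam l ^ j * e (l (x + (t - t'))) =
                  w l * lam l ^ j * ((∑ t ∈ T, e (l t)) * (∑ t ∈ T, e (-(l t)))) * e (l x) := by
                rw [Finset.sum_mul_sum, Finset.mul_sum, Finset.sum_mul]
                refine Finset.sum_congr rfl fun t _ => ?_
                rw [Finset.mul_sum, Finset.sum_mul]
                refine Finset.sum_congr rfl fun t' _ => ?_
                rw [← AddChar.map_add_eq_mul, mul_assoc (w l * lam l ^ j) (e _) (e _),
                  ← AddChar.map_add_eq_mul]
                congr 2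
                simp only [map_add, map_sub]
                ring
              rw [this, pow_succ]
              simp only [lam]
              ring
    have h0 := kmP_iter T hT _ c h j 0
    have h1 := kmP_iter T hT _ c h j v
    have h2 : |(kmP T)^[j] (kmPsi B S) v - (kmP T)^[j] (kmPsi B S) 0| ≤
        2 * ((1 / 4) ^ j * (Fintype.card G / B.card)) := by
      rw [← Real.norm_eq_abs, ← Complex.norm_real]
      push_cast
      rw [hit, hit, ← Finset.sum_sub_distrib]
      refine (norm_sum_le _ _).trans ?_
      calc _ ≤ ∑ l, ‖w l‖ * (2 * (1 / 4) ^ j) := by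
            refine Finset.sum_le_sum fun l _ => ?_
            rw [← mul_sub, norm_mul, norm_mul, mul_assoc]
            refine mul_le_mul_of_nonneg_left ?_ (norm_nonneg _)
            by_cases hl : l ∈ spec
            · have : l v = 0 := hv l (Submodule.subset_span hl)
              simp [this]
            · have h3 : ‖∑ t ∈ T, e (l t)‖ < (T.card : ℝ) / 2 := not_le.1 hl
              have h4 : ‖lam l‖ ≤ 1 / 4 := by
                rw [hlam, div_le_iff₀ (by positivity)]
                calc _ ≤ ((T.card : ℝ) / 2) ^ 2 := by gcongr
                  _ = _ := by ring
              have h5 : ‖e (l v) - e (l 0)‖ ≤ 2 := by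
                refine (norm_sub_le _ _).trans ?_
                simp; norm_num
              rw [norm_pow, mul_comm]
              gcongr
        _ = (∑ l, ‖w l‖) * (2 * (1 / 4) ^ j) := by rw [Finset.sum_mul]
        _ ≤ (Fintype.card G / B.card) * (2 * (1 / 4) ^ j) := by gcongr
        _ = _ := by ring
    rw [abs_le] at *
    linarith

end iter

section params

theorem km_half_le_log {β : ℝ} (h0 : 0 < β) (h1 : β ≤ 1) : 1 / 2 ≤ Real.log (2 / β) := by
  have : Real.log 2 ≤ Real.log (2 / β) := by
    apply Real.log_le_log (by norm_num)
    rw [le_div_iff₀ h0]; linarith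
  linarith [Real.log_two_gt_d9]

theorem km_params1 (η : ℝ) (hη : 0 < η) (hη1 : η ≤ 1) : ∃ C : ℝ, 0 < C ∧ ∀ β : ℝ, 0 < β → β ≤ 1 →
    ∃ (j k : ℕ) (κ : ℝ), 0 < k ∧ 0 < κ ∧ 4 * Real.exp (-(k * κ ^ 2 / 2)) ≤ κ * β ∧
      2 * (j * (4 * κ)) ≤ η ∧ 2 * ((1 / 4) ^ j * (1 / β)) ≤ η ∧
      8 * Real.log (2 / β ^ k) ≤ C * Real.log (2 / β) ^ 4 := by
  set c0 := Real.log (1 / η) with hc0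
  have hc0p : 0 ≤ c0 := Real.log_nonneg (by rw [le_div_iff₀ hη]; linarith)
  set a := 3 + 2 * c0 with ha
  set b := 33 + 2 * c0 + a with hb
  set d := 128 * a ^ 2 * b / η ^ 2 + 8 with hd
  have hap : 0 < a := by positivity
  have hbp : 0 < b := by positivity
  have hdp : 0 < d := by positivity
  refine ⟨8 * (8 + d), by positivity, fun β h0 h1 => ?_⟩
  have hΛ := km_half_le_log h0 h1
  set Λ := Real.log (2 / β) with hΛd
  set j := ⌈Λ + c0⌉₊ with hj
  have hj0 : Λ + c0 ≤ j := Nat.le_ceil _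
  have hj1 : (j : ℝ) ≤ a * Λ := by
    have := (Nat.ceil_lt_add_one (show 0 ≤ Λ + c0 by linarith)).le
    rw [← hj] at this
    nlinarith
  have hjp : (0 : ℝ) < j := by linarith
  have hjone : (1 : ℝ) ≤ j := by
    have : 0 < j := by exact_mod_cast hjp
    exact_mod_cast this
  set κ := η / (8 * j) with hκ
  have hκp : 0 < κ := by positivity
  set Y := Real.log (4 / (κ * β)) with hY
  have hκ1 : κ ≤ 1 := by
    rw [hκ, div_le_one (by positivity)]; linarith
  have hYp : 0 < Y := by
    apply Real.log_pos
    rw [lt_div_iff₀ (by positivity)]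
    nlinarith
  have hYb : Y ≤ b * Λ := by
    have e : 4 / (κ * β) = 2 / β * ((1 / η) * (16 * j)) := by
      rw [hκ]; field_simp; norm_num
    rw [hY, e, Real.log_mul (by positivity) (by positivity), Real.log_mul (by positivity)
      (by positivity), Real.log_mul (by positivity) (by positivity)]
    have h2 := Real.log_le_self (show (0:ℝ) ≤ 16 by norm_num)
    have h3 := Real.log_le_self hjp.le
    rw [← hc0, ← hΛd]
    nlinarith
  set k := ⌈2 / κ ^ 2 * Y⌉₊ with hk
  have hk0 : 2 / κ ^ 2 * Y ≤ k := Nat.le_ceil _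
  have hkp : 0 < k := Nat.ceil_pos.2 (by positivity)
  have hk1 : (k : ℝ) ≤ d * Λ ^ 3 := by
    have h2 := (Nat.ceil_lt_add_one (show 0 ≤ 2 / κ ^ 2 * Y by positivity)).le
    rw [← hk] at h2
    have e : 2 / κ ^ 2 * Y = 128 * (j : ℝ) ^ 2 * Y / η ^ 2 := by
      rw [hκ]; field_simp; norm_num
    rw [e] at h2
    have h3 : 128 * (j : ℝ) ^ 2 * Y / η ^ 2 ≤ 128 * (a * Λ) ^ 2 * (b * Λ) / η ^ 2 := by gcongr
    have h4 : (1 / 2 : ℝ) ^ 3 ≤ Λ ^ 3 := by gcongr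
    have e2 : d * Λ ^ 3 = 128 * (a * Λ) ^ 2 * (b * Λ) / η ^ 2 + 8 * Λ ^ 3 := by rw [hd]; ring
    rw [e2]
    linarith
  refine ⟨j, k, κ, hkp, hκp, ?_, ?_, ?_, ?_⟩
  · have h2 : Y ≤ k * κ ^ 2 / 2 := by
      rw [div_mul_eq_mul_div, div_le_iff₀ (by positivity)] at hk0
      linarith
    have h3 : Real.exp (-(k * κ ^ 2 / 2)) ≤ Real.exp (-Y) := Real.exp_le_exp.2 (by linarith)
    have h4 : Real.exp (-Y) = κ * β / 4 := by
      rw [Real.exp_neg, hY, Real.exp_log (by positivity), inv_div]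
    linarith
  · rw [hκ]; apply le_of_eq; field_simp; norm_num
  · have h2 : ((1 / 4 : ℝ)) ^ j ≤ Real.exp (-(Λ + c0)) := by
      calc ((1 / 4 : ℝ)) ^ j ≤ (Real.exp (-1)) ^ j := by
            gcongr
            rw [Real.exp_neg, one_div]
            gcongr
            linarith [Real.exp_one_lt_d9]
        _ = Real.exp (-j) := by rw [← Real.exp_nat_mul]; ring_nf
        _ ≤ _ := Real.exp_le_exp.2 (by linarith)
    have h3 : Real.exp (-(Λ + c0)) = β / 2 * η := by
      rw [neg_add, Real.exp_add, Real.exp_neg, Real.exp_neg, hΛd, hc0,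
        Real.exp_log (by positivity), Real.exp_log (by positivity)]
      field_simp
    rw [h3] at h2
    calc _ ≤ 2 * (β / 2 * η * (1 / β)) := by gcongr
      _ = η := by field_simp
  · have h2 : Real.log (2 / β ^ k) ≤ Λ + k * Λ := by
      have e1 : Real.log (2 / β ^ k) = Real.log 2 + k * (- Real.log β) := by
        rw [Real.log_div (by norm_num) (by positivity), Real.log_pow]; ring
      have e2 : Λ = Real.log 2 + (- Real.log β) := by
        rw [hΛd, Real.log_div (by norm_num) (by positivity)]; ring
      have h5 : Real.log β ≤ 0 := Real.log_nonpos h0.le h1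
      have h6 : 0 < Real.log 2 := Real.log_pos (by norm_num)
      have h7 : k * (- Real.log β) ≤ k * Λ := by gcongr; linarith
      rw [e1]; linarith
    have h3 : (k : ℝ) * Λ ≤ d * Λ ^ 3 * Λ := by gcongr
    have h4 : Λ * (1 / 2 : ℝ) ^ 3 ≤ Λ * Λ ^ 3 := by gcongr
    nlinarith

theorem km_params2 (ε η : ℝ) (hε : 0 < ε) (hε1 : ε ≤ 1) (hη : 0 < η) (hη1 : η ≤ 1) :
    ∃ C : ℝ, 0 < C ∧ ∀ δ : ℝ, 0 < δ → δ ≤ 1 →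
    ∃ m : ℕ, Even m ∧ 4 * (1 + ε / 2) ^ m < η * δ * (1 + ε) ^ m ∧ (m : ℝ) ≤ C * Real.log (2 / δ) := by
  have hl : 0 < Real.log (4 / η) := Real.log_pos (by rw [lt_div_iff₀ hη]; linarith)
  refine ⟨6 / ε * (1 + 2 * Real.log (4 / η)) + 4, by positivity, fun δ h0 h1 => ?_⟩
  have hΛ := km_half_le_log h0 h1
  set Λ := Real.log (2 / δ) with hΛd
  have e1 : Real.log (8 / (η * δ)) = Λ + Real.log (4 / η) := by
    rw [hΛd, ← Real.log_mul (by positivity) (by positivity)]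
    congr 1; field_simp; norm_num
  set M := ⌈3 / ε * Real.log (8 / (η * δ))⌉₊ with hM
  have hM0 : 3 / ε * Real.log (8 / (η * δ)) ≤ M := Nat.le_ceil _
  refine ⟨2 * M, even_two_mul M, ?_, ?_⟩
  · have h2 : (1 + ε / 2) * Real.exp (ε / 6) ≤ 1 + ε := by
      have h3 : Real.exp (ε / 6) * (1 - ε / 6) ≤ 1 := by
        have := Real.add_one_le_exp (-(ε / 6))
        calc _ ≤ Real.exp (ε / 6) * Real.exp (-(ε / 6)) := by gcongr; linarith
          _ = 1 := by rw [← Real.exp_add]; simp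
      have h4 : 1 + ε / 2 ≤ (1 + ε) * (1 - ε / 6) := by nlinarith
      calc _ ≤ (1 + ε) * (1 - ε / 6) * Real.exp (ε / 6) := by gcongr
        _ = (1 + ε) * (Real.exp (ε / 6) * (1 - ε / 6)) := by ring
        _ ≤ (1 + ε) * 1 := by gcongr
        _ = _ := by ring
    have h3 : (1 + ε / 2) ^ (2 * M) * Real.exp (ε / 6) ^ (2 * M) ≤ (1 + ε) ^ (2 * M) := by
      rw [← mul_pow]; gcongr
    have h4 : 8 / (η * δ) ≤ Real.exp (ε / 6) ^ (2 * M) := by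
      rw [← Real.exp_nat_mul, ← Real.log_le_iff_le_exp (by positivity)]
      push_cast
      rw [div_mul_eq_mul_div, div_le_iff₀ hε] at hM0
      linarith
    have h5 : 0 < (1 + ε / 2) ^ (2 * M) := by positivity
    calc 4 * (1 + ε / 2) ^ (2 * M) < 8 * (1 + ε / 2) ^ (2 * M) := by linarith
      _ = η * δ * ((1 + ε / 2) ^ (2 * M) * (8 / (η * δ))) := by field_simp
      _ ≤ η * δ * ((1 + ε / 2) ^ (2 * M) * Real.exp (ε / 6) ^ (2 * M)) := by gcongr
      _ ≤ _ := by gcongr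
  · have h2 := (Nat.ceil_lt_add_one (show 0 ≤ 3 / ε * Real.log (8 / (η * δ)) by
      rw [e1]; positivity)).le
    rw [← hM, e1] at h2
    push_cast
    have h3 : 6 / ε * Real.log (4 / η) * 1 ≤ 6 / ε * Real.log (4 / η) * (2 * Λ) := by
      gcongr; linarith
    have e3 : (3 / ε * (Λ + Real.log (4 / η))) = (6 / ε * Λ + 6 / ε * Real.log (4 / η)) / 2 := by
      ring
    rw [e3] at h2
    nlinarith

end params

section main

theorem km_increment {F G : Type*} [Field F] [AddCommGroup G] [Fintype G] [Module F G]
    (A B S : Finset G) (hA : A.Nonempty) (hB : B.Nonempty) (V : Submodule F G) (ε : ℝ)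
    (hε : 0 < ε) (hε1 : ε ≤ 1)
    (hS : ∀ x ∈ S, (1 + ε / 2) * ((A.card : ℝ) ^ 2 / Fintype.card G) < kmR A x)
    (hV : ∀ v ∈ V, 1 - ε / 8 ≤ kmPsi B S v) :
    ∃ x, (1 + 1 / 4 * ε) * ((A.card : ℝ) / Fintype.card G) * Nat.card V ≤
      ∑ y, kmInd A (x - y) * (if y ∈ V then (1 : ℝ) else 0) := by
  have hN : (0 : ℝ) < Fintype.card G := by exact_mod_cast Fintype.card_pos
  have hAp : (0 : ℝ) < A.card := by exact_mod_cast hA.card_pos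
  have hBp : (0 : ℝ) < B.card := by exact_mod_cast hB.card_pos
  set iV : G → ℝ := fun y => if y ∈ V then (1 : ℝ) else 0 with hiV
  have hiV0 : ∀ y, 0 ≤ iV y := fun y => by simp only [hiV]; split_ifs <;> norm_num
  have hVc : ∑ y, iV y = Nat.card V := by
    simp only [hiV, Finset.sum_boole]
    congr 1
    rw [Nat.card_eq_fintype_card, ← Fintype.card_subtype]
  have hVp : (0 : ℝ) < Nat.card V := by exact_mod_cast Nat.card_pos
  by_contra hcon
  push Not at hcon
  set M := (1 + 1 / 4 * ε) * ((A.card : ℝ) / Fintype.card G) * Nat.card V with hM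
  set K := (A.card : ℝ) ^ 2 / Fintype.card G with hK
  have hKp : 0 < K := by positivity
  have h1 : ∀ c, ∑ y, iV y * kmR A (c - y) ≤ A.card * M := by
    intro c
    calc _ = ∑ z, kmInd A z * ∑ y, kmInd A (c + z - y) * iV y := by
          simp only [kmR, Finset.mul_sum]
          rw [Finset.sum_comm]
          refine Finset.sum_congr rfl fun z _ => Finset.sum_congr rfl fun y _ => ?_
          rw [show c - y + z = c + z - y by abel]; ring
      _ ≤ ∑ z, kmInd A z * M := by
          refine Finset.sum_le_sum fun z _ => ?_
          exact mul_le_mul_of_nonneg_left (hcon _).le (kmInd_nonneg _ _)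
      _ = _ := by rw [← Finset.sum_mul, kmInd_sum]
  have h2 : ∀ x, (1 + ε / 2) * K * kmInd S x ≤ kmR A x := by
    intro x
    by_cases hx : x ∈ S
    · simpa [kmInd, hx] using (hS x hx).le
    · simpa [kmInd, hx] using kmR_nonneg A x
  have h3 : ∑ y, iV y * (1 - ε / 8) ≤ ∑ y, iV y * kmPsi B S (-y) := by
    refine Finset.sum_le_sum fun y _ => ?_
    by_cases hy : y ∈ V
    · exact mul_le_mul_of_nonneg_left (hV _ (V.neg_mem hy)) (hiV0 _)
    · simp [hiV, hy]
  have h4 : (1 + ε / 2) * K * ∑ y, iV y * kmPsi B S (-y) ≤ A.card * M := by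
    have : (1 + ε / 2) * K * ∑ y, iV y * kmPsi B S (-y) =
        (∑ b ∈ B, ∑ b' ∈ B, ∑ y, iV y * ((1 + ε / 2) * K * kmInd S (b - b' - y))) /
          (B.card : ℝ) ^ 2 := by
      simp only [kmPsi]
      have e : ∀ b, ∑ b' ∈ B, ∑ y, iV y * ((1 + ε / 2) * K * kmInd S (b - b' - y)) =
          ∑ y, ∑ b' ∈ B, iV y * ((1 + ε / 2) * K * kmInd S (b - b' - y)) :=
        fun b => Finset.sum_comm
      simp_rw [e]
      rw [Finset.sum_comm, Finset.mul_sum, Finset.sum_div]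
      refine Finset.sum_congr rfl fun y _ => ?_
      simp_rw [← Finset.mul_sum, ← sub_eq_add_neg]
      ring
    rw [this, div_le_iff₀ (by positivity)]
    calc _ ≤ ∑ b ∈ B, ∑ b' ∈ B, (A.card * M) := by
          refine Finset.sum_le_sum fun b _ => Finset.sum_le_sum fun b' _ => ?_
          refine le_trans (Finset.sum_le_sum fun y _ => ?_) (h1 (b - b'))
          exact mul_le_mul_of_nonneg_left (h2 _) (hiV0 _)
      _ = _ := by simp; ring
  rw [← Finset.sum_mul, hVc] at h3
  have h5 : (1 + ε / 2) * K * (Nat.card V * (1 - ε / 8)) ≤ A.card * M :=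
    le_trans (by gcongr) h4
  have e5 : A.card * M = K * Nat.card V * (1 + 1 / 4 * ε) := by rw [hM, hK]; ring
  have h6 : K * Nat.card V * ((1 + ε / 2) * (1 - ε / 8)) ≤ K * Nat.card V * (1 + 1 / 4 * ε) := by
    rw [← e5]; linarith
  have h7 := le_of_mul_le_mul_left h6 (by positivity)
  nlinarith

theorem km_main (ε : ℝ) (hε : 0 < ε) (hε1 : ε ≤ 1) : ∃ C : ℝ, 0 < C ∧
    ∀ {F G : Type} [Field F] [Fintype F] [AddCommGroup G] [Fintype G] [Module F G]
      (A D : Finset G), A.Nonempty → D.Nonempty →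
      ε * D.card * ((A.card : ℝ) ^ 2 / Fintype.card G) <
        |∑ x ∈ D, (kmR A x - (A.card : ℝ) ^ 2 / Fintype.card G)| →
      ∃ V : Submodule F G, (Module.finrank F G : ℝ) - Module.finrank F V ≤
          C * Real.log (2 / (A.card / Fintype.card G)) ^ 4 *
            Real.log (2 / (D.card / Fintype.card G)) ^ 4 ∧
        ∃ x, (1 + 1 / 4 * ε) * ((A.card : ℝ) / Fintype.card G) * Nat.card V ≤
          ∑ y, kmInd A (x - y) * (if y ∈ V then (1 : ℝ) else 0) := by
  obtain ⟨C1, hC1, H1⟩ := km_params1 (ε / 24) (by positivity) (by linarith)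
  obtain ⟨C2, hC2, H2⟩ := km_params2 ε (ε / 24) hε hε1 (by positivity) (by linarith)
  refine ⟨C1 * (2 + C2) ^ 4, by positivity, ?_⟩
  intro F G _ _ _ _ _ A D hA hD h
  have hN : (0 : ℝ) < Fintype.card G := by exact_mod_cast Fintype.card_pos
  have hAp : (0 : ℝ) < A.card := by exact_mod_cast hA.card_pos
  have hDp : (0 : ℝ) < D.card := by exact_mod_cast hD.card_pos
  have dens : ∀ X : Finset G, (X.card : ℝ) / Fintype.card G ≤ 1 := fun X => by
    rw [div_le_one hN]; exact_mod_cast Finset.card_le_univ X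
  obtain ⟨m, hme, hm, hmC⟩ := H2 (D.card / Fintype.card G) (by positivity) (dens D)
  obtain ⟨B, hB, hBc, hBS⟩ := km_sift A D hA hD ε (ε / 24) hε (by positivity) (by linarith) m hme
    hm h
  have hBp : (0 : ℝ) < B.card := by exact_mod_cast hB.card_pos
  set N : ℝ := (Fintype.card G : ℝ) with hNdef
  set α := (A.card : ℝ) / N with hα
  set δ := (D.card : ℝ) / N with hδ
  set β := (B.card : ℝ) / N with hβ
  have hαp : 0 < α := by positivity
  have hδp : 0 < δ := by positivity
  have hβp : 0 < β := by positivity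
  have hβα : α ^ m ≤ β := by rw [hβ, le_div_iff₀ hN]; exact hBc
  obtain ⟨j, k, κ, hk, hκ, h1, h2, h3, h4⟩ := H1 β hβp (dens B)
  set S : Finset G := Finset.univ.filter
    fun x => (1 + ε / 2) * ((A.card : ℝ) ^ 2 / N) < kmR A x with hS
  obtain ⟨T, hT, hTc, hTp⟩ := km_croot_sisask B S hB κ hκ k hk h1
  obtain ⟨V, hVd, hV⟩ := km_period (F := F) B S T hB hT (4 * κ) j hTp
  have hTp : (0 : ℝ) < T.card := by exact_mod_cast hT.card_pos
  rw [← hNdef] at hTc hVd hV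
  refine ⟨V, ?_, ?_⟩
  · refine hVd.trans ?_
    have h5 : Real.log (N / T.card) ≤ Real.log (2 / β ^ k) := by
      apply Real.log_le_log (by positivity)
      rw [div_le_div_iff₀ hTp (by positivity)]
      linarith
    have hLα := km_half_le_log hαp (dens A)
    have hLδ := km_half_le_log hδp (dens D)
    have hLβ := km_half_le_log hβp (dens B)
    have h6 : Real.log (2 / β) ≤ (2 + C2) * Real.log (2 / α) * Real.log (2 / δ) := by
      have h7 : Real.log (2 / β) ≤ Real.log 2 + m * (-Real.log α) := by
        have : Real.log (2 / β) ≤ Real.log (2 / α ^ m) := by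
          apply Real.log_le_log (by positivity); gcongr
        rw [Real.log_div (x := 2) (y := α ^ m) (by norm_num) (by positivity), Real.log_pow] at this
        linarith
      have e : Real.log (2 / α) = Real.log 2 + (-Real.log α) := by
        rw [Real.log_div (by norm_num) (by positivity)]; ring
      have h8 : Real.log α ≤ 0 := Real.log_nonpos hαp.le (dens A)
      have h9 : 0 < Real.log 2 := Real.log_pos (by norm_num)
      have h10 : m * (-Real.log α) ≤ (C2 * Real.log (2 / δ)) * Real.log (2 / α) := by
        gcongr
        · linarith
        · linarith
      have h11 : Real.log (2 / α) * (1 / 2) ≤ Real.log (2 / α) * Real.log (2 / δ) := by gcongr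
      have h12 : Real.log 2 ≤ Real.log (2 / α) := by linarith
      nlinarith
    have h13 : Real.log (2 / β) ^ 4 ≤ ((2 + C2) * Real.log (2 / α) * Real.log (2 / δ)) ^ 4 := by
      gcongr
    calc 8 * Real.log (N / T.card) ≤ C1 * Real.log (2 / β) ^ 4 := by linarith
      _ ≤ C1 * ((2 + C2) * Real.log (2 / α) * Real.log (2 / δ)) ^ 4 := by gcongr
      _ = _ := by ring
  · refine km_increment A B S hA hB V ε hε hε1 (fun x hx => (Finset.mem_filter.1 hx).2) ?_
    intro v hv
    have h5 := hV v hv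
    have h6 : 1 - ε / 24 ≤ kmPsi B S 0 := by
      have e : ∀ x y : G, kmInd S (x - y + 0) = 1 -
          (if (1 + ε / 2) * ((A.card : ℝ) ^ 2 / N) < kmR A (x - y) then (0 : ℝ) else 1) := by
        intro x y
        simp only [kmInd, hS, Finset.mem_filter, Finset.mem_univ, true_and, add_zero]
        split_ifs <;> norm_num
      simp only [kmPsi, e]
      rw [le_div_iff₀ (by positivity)]
      simp only [Finset.sum_sub_distrib, Finset.sum_const, nsmul_eq_mul, mul_one]
      have := hBS
      linarith
    have h7 : N / B.card = 1 / β := by rw [hβ, one_div_div]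
    rw [h7] at h5
    linarith

end main

section transfer

theorem km_restrict {F G : Type*} [Field F] [AddCommGroup G] [Fintype G] [Module F G]
    (V : Submodule F G) (f : G → ℝ) (h : ∀ x, x ∉ V → f x = 0) :
    ∑ x, f x = ∑ v : V, f v := by
  have h1 : ∑ x, f x = ∑ x ∈ Finset.univ.filter (fun x => x ∈ V), f x := by
    symm
    apply Finset.sum_filter_of_ne
    intro x _ hx
    by_contra hc
    exact hx (h x hc)
  rw [h1]
  exact Finset.sum_subtype _ (by simp) f

theorem km_card {F G : Type*} [Field F] [AddCommGroup G] [Fintype G] [Module F G]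
    (V : Submodule F G) (A : Set G) (hA : A ⊆ (V : Set G)) :
    (Finset.univ.filter (fun v : V => (v : G) ∈ A)).card = Nat.card A := by
  rw [← Fintype.card_subtype, ← Nat.card_eq_fintype_card]
  exact Nat.card_congr
    { toFun := fun v => ⟨v.1.1, v.2⟩
      invFun := fun a => ⟨⟨a.1, hA a.2⟩, a.2⟩
      left_inv := fun _ => rfl
      right_inv := fun _ => rfl }

theorem km_double {F G : Type*} [Field F] [AddCommGroup G] [Fintype G] [Module F G]
    (V : Submodule F G) (A D : Set G) (hA : A ⊆ (V : Set G)) (hD : D ⊆ (V : Set G)) :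
    ∑ x : G, ∑ y : G, (if x - y ∈ -A then (1 : ℝ) else 0) * (if y ∈ A then 1 else 0) *
      (if x ∈ D then 1 else 0) =
    ∑ x ∈ Finset.univ.filter (fun v : V => (v : G) ∈ D),
      kmR (Finset.univ.filter (fun v : V => (v : G) ∈ A)) x := by
  rw [km_restrict V _ (fun x hx => ?_)]
  · rw [Finset.sum_filter]
    refine Finset.sum_congr rfl fun x _ => ?_
    by_cases hx : (x : G) ∈ D
    · simp only [hx, if_true, mul_one]
      rw [km_restrict V _ (fun y hy => ?_)]
      · rw [kmR]
        symm
        apply Fintype.sum_equiv (Equiv.addLeft x)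
        intro z
        simp only [kmInd, Finset.mem_filter, Finset.mem_univ, true_and, Equiv.coe_addLeft,
          Submodule.coe_add, Set.mem_neg, neg_sub, add_sub_cancel_left]
        by_cases h1 : (z : G) ∈ A <;> by_cases h2 : (x : G) + z ∈ A <;> simp [h1, h2]
      · rw [if_neg (fun h => hy (hA h)), mul_zero]
    · simp [hx]
  · simp [show x ∉ D from fun h => hx (hD h)]

end transfer

/-- Kelley–Meka sparsity-expansion dichotomy in `F_q^n` (Proposition `prop.sum`). -/
theorem sparsity_expansion_dichotomy : ∃ c : ℝ, 0 < c ∧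
    ∀ ε : ℝ, ε ∈ Set.Ioc (0 : ℝ) 1 → ∃ Cε : ℝ, 0 < Cε ∧
      ∀ (F : Type) [Field F] [Fintype F] (n : ℕ)
        (V : Submodule F (Fin n → F)) (A D : Set (Fin n → F)),
        A.Nonempty → D.Nonempty → A ⊆ (V : Set (Fin n → F)) → D ⊆ (V : Set (Fin n → F)) →
        ∀ α δ : ℝ,
          α = (Nat.card A : ℝ) / Nat.card V → δ = (Nat.card D : ℝ) / Nat.card V →
          |((Fintype.card (Fin n → F) : ℝ)⁻¹ ^ 2 *
              ∑ x : Fin n → F, ∑ y : Fin n → F,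
                (if x - y ∈ -A then (1 : ℝ) else 0) * (if y ∈ A then 1 else 0) *
                  (if x ∈ D then 1 else 0)) -
            α ^ 2 * δ * ((Nat.card V : ℝ) / Fintype.card (Fin n → F)) ^ 2| ≤
              ε * α ^ 2 * δ * ((Nat.card V : ℝ) / Fintype.card (Fin n → F)) ^ 2 ∨
          ∃ V' : Submodule F (Fin n → F), V' ≤ V ∧
            ((Module.finrank F V : ℝ) - Module.finrank F V') ≤
              Cε * (Real.log (2 * α⁻¹)) ^ 4 * (Real.log (2 * δ⁻¹)) ^ 4 ∧
            ∃ x : Fin n → F, (1 + c * ε) * α ≤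
              ∑ y : Fin n → F, (if x - y ∈ A then (1 : ℝ) else 0) *
                (if y ∈ V' then (Nat.card V' : ℝ)⁻¹ else 0) := by
  
  refine ⟨1 / 4, by norm_num, fun ε hε => ?_⟩
  obtain ⟨C, hC, H⟩ := km_main ε hε.1 hε.2
  refine ⟨C, hC, ?_⟩
  intro F _ _ n V A D hA hD hAV hDV α δ hα hδ
  have hcA := km_card V A hAV
  have hcD := km_card V D hDV
  have hsum := km_double V A D hAV hDV
  set A' : Finset V := Finset.univ.filter (fun v : V => (v : Fin n → F) ∈ A) with hA'
  set D' : Finset V := Finset.univ.filter (fun v : V => (v : Fin n → F) ∈ D) with hD'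
  have hA'n : A'.Nonempty := by
    obtain ⟨a, ha⟩ := hA
    exact ⟨⟨a, hAV ha⟩, by simp [hA', ha]⟩
  have hD'n : D'.Nonempty := by
    obtain ⟨a, ha⟩ := hD
    exact ⟨⟨a, hDV ha⟩, by simp [hD', ha]⟩
  have hcV : Nat.card V = Fintype.card V := Nat.card_eq_fintype_card
  have hVp : (0 : ℝ) < Fintype.card V := by exact_mod_cast Fintype.card_pos
  have hGp : (0 : ℝ) < Fintype.card (Fin n → F) := by exact_mod_cast Fintype.card_pos
  rw [← hcA, hcV] at hα
  rw [← hcD, hcV] at hδ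
  rw [hcV, hsum]
  by_cases h : ε * D'.card * ((A'.card : ℝ) ^ 2 / Fintype.card V) <
        |∑ x ∈ D', (kmR A' x - (A'.card : ℝ) ^ 2 / Fintype.card V)|
  · right
    obtain ⟨V0, hdim, x, hx⟩ := H (F := F) A' D' hA'n hD'n h
    refine ⟨V0.map V.subtype, Submodule.map_subtype_le V V0, ?_, x, ?_⟩
    · rw [Submodule.finrank_map_subtype_eq, ← div_eq_mul_inv, ← div_eq_mul_inv, hα, hδ]
      exact hdim
    · have hc : Nat.card (V0.map V.subtype) = Nat.card V0 :=
        (Nat.card_congr (V0.equivMapOfInjective V.subtype V.injective_subtype).toEquiv).symm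
      have hp : (0 : ℝ) < Nat.card V0 := by exact_mod_cast Nat.card_pos
      rw [hc, km_restrict V _ (fun y hy => ?_)]
      · rw [hα, ← mul_le_mul_iff_left₀ hp]
        refine hx.trans (le_of_eq ?_)
        rw [Finset.sum_mul]
        refine Finset.sum_congr rfl fun y _ => ?_
        have e1 : ((y : Fin n → F) ∈ V0.map V.subtype) ↔ y ∈ V0 := by simp
        simp only [kmInd, hA', Finset.mem_filter, Finset.mem_univ, true_and, Submodule.coe_sub, e1]
        by_cases hy : y ∈ V0
        · simp only [hy, if_true]
          field_simp
        · simp [hy]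
      · rw [if_neg (fun h => hy (Submodule.map_subtype_le V V0 h)), mul_zero]
  · left
    push Not at h
    rw [Finset.sum_sub_distrib, Finset.sum_const, nsmul_eq_mul] at h
    have e1 : α ^ 2 * δ * ((Fintype.card V : ℝ) / Fintype.card (Fin n → F)) ^ 2 =
        (Fintype.card (Fin n → F) : ℝ)⁻¹ ^ 2 *
          (D'.card * ((A'.card : ℝ) ^ 2 / Fintype.card V)) := by
      rw [hα, hδ]; field_simp
    have e2 : ε * α ^ 2 * δ * ((Fintype.card V : ℝ) / Fintype.card (Fin n → F)) ^ 2 =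
        (Fintype.card (Fin n → F) : ℝ)⁻¹ ^ 2 *
          (ε * D'.card * ((A'.card : ℝ) ^ 2 / Fintype.card V)) := by
      rw [hα, hδ]; field_simp
    rw [e1, e2, ← mul_sub, abs_mul, abs_of_pos (by positivity)]
    gcongr
end

section
/- Let q be a prime power, a, b ∈ F_q nonzero, and let G = F_q^n. Then for every r-colouring C of G there is a colour class A ∈ C and at least exp(−O_q(r·log⁹(2r)))·|G|² triples (x,y,z) ∈ A³ with a·x − a·y = b·z. -/
open scoped Classical

lemma corr_pow {V : Type} [AddCommGroup V] [Fintype V] (h w : V → ℝ) (k : ℕ) :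
    (Fintype.card V : ℝ) * ∑ x, w x * (∑ z, h z * h (z + x)) ^ k =
    ∑ u : Fin k → V, ∑ x, ∑ y, w (y - x) * ((∏ j, h (u j + x)) * ∏ j, h (u j + y)) := by
  have h1 : ∀ x : V, ∑ y, ∑ u : Fin k → V,
      w (y - x) * ((∏ j, h (u j + x)) * ∏ j, h (u j + y)) =
      ∑ y, w y * (∑ z, h z * h (z + y)) ^ k := by
    intro x
    rw [← Equiv.sum_comp (Equiv.addRight x)]
    refine Finset.sum_congr rfl fun y _ => ?_
    rw [← Finset.mul_sum]
    simp only [Equiv.coe_addRight, add_sub_cancel_right]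
    congr 1
    rw [← Equiv.sum_comp (Equiv.addRight x) (fun z => h z * h (z + y)), Fintype.sum_pow]
    refine Finset.sum_congr rfl fun u _ => ?_
    rw [← Finset.prod_mul_distrib]
    refine Finset.prod_congr rfl fun j _ => ?_
    simp only [Equiv.coe_addRight]
    congr 2
    abel
  rw [Finset.sum_comm]
  have : ∀ x : V, ∑ u : Fin k → V, ∑ y,
      w (y - x) * ((∏ j, h (u j + x)) * ∏ j, h (u j + y)) =
      ∑ y, w y * (∑ z, h z * h (z + y)) ^ k := by
    intro x
    rw [Finset.sum_comm, h1]
  simp only [this]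
  simp

lemma corr_pow_nonneg {V : Type} [AddCommGroup V] [Fintype V] (h : V → ℝ) (k : ℕ) :
    0 ≤ ∑ x, (∑ z, h z * h (z + x)) ^ k := by
  have hc := corr_pow h (fun _ => 1) k
  have hV : (0 : ℝ) < Fintype.card V := by
    have : 0 < Fintype.card V := Fintype.card_pos_iff.2 ⟨0⟩
    exact_mod_cast this
  simp only [one_mul] at hc
  have h2 : 0 ≤ ∑ u : Fin k → V, ∑ x, ∑ y, ((∏ j, h (u j + x)) * ∏ j, h (u j + y)) := by
    refine Finset.sum_nonneg fun u _ => ?_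
    rw [← Finset.sum_mul_sum]
    exact mul_self_nonneg _
  rw [← hc] at h2
  exact nonneg_of_mul_nonneg_right h2 hV

lemma reflect {V : Type} [Fintype V] (G : V → ℝ) (hG : ∀ k : ℕ, 0 ≤ ∑ x, G x ^ k)
    (m : ℝ) (hm : 0 ≤ m) (p : ℕ) : ∑ x, (m - G x) ^ p ≤ ∑ x, (m + G x) ^ p := by
  have e1 : ∑ x, (m + G x) ^ p =
      ∑ k ∈ Finset.range (p + 1), m ^ (p - k) * (p.choose k) * ∑ x, G x ^ k := by
    simp_rw [add_comm m, add_pow, Finset.mul_sum]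
    rw [Finset.sum_comm]
    refine Finset.sum_congr rfl fun k _ => Finset.sum_congr rfl fun x _ => by ring
  have e2 : ∑ x, (m - G x) ^ p =
      ∑ k ∈ Finset.range (p + 1), m ^ (p - k) * (p.choose k) * ((-1) ^ k * ∑ x, G x ^ k) := by
    simp_rw [sub_eq_add_neg, add_comm m, add_pow, Finset.mul_sum]
    rw [Finset.sum_comm]
    refine Finset.sum_congr rfl fun k _ => Finset.sum_congr rfl fun x _ => ?_
    rw [neg_pow]; ring
  rw [e1, e2]
  refine Finset.sum_le_sum fun k _ => ?_
  apply mul_le_mul_of_nonneg_left _ (by positivity)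
  rcases neg_one_pow_eq_or ℝ k with h | h <;> rw [h] <;> linarith [hG k]

lemma mgf_le {ι : Type} (s : Finset ι) (X : ι → ℝ) (hX : ∀ i ∈ s, |X i| ≤ 1)
    (h0 : ∑ i ∈ s, X i = 0) (t : ℝ) (ht : |t| ≤ 1) :
    ∑ i ∈ s, Real.exp (t * X i) ≤ s.card * Real.exp (t ^ 2) := by
  have h1 : ∀ i ∈ s, Real.exp (t * X i) ≤ t * X i + (1 + t ^ 2) := by
    intro i hi
    have ha : |t * X i| ≤ 1 := by
      rw [abs_mul]; exact mul_le_one₀ ht (abs_nonneg _) (hX i hi)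
    have h2 := (abs_le.1 (Real.abs_exp_sub_one_sub_id_le ha)).2
    have h3 : (t * X i) ^ 2 ≤ t ^ 2 := by
      rw [mul_pow]
      have : X i ^ 2 ≤ 1 := by rw [← sq_abs]; exact pow_le_one₀ (abs_nonneg _) (hX i hi)
      nlinarith [sq_nonneg t]
    linarith
  refine (Finset.sum_le_sum h1).trans ?_
  rw [Finset.sum_add_distrib, ← Finset.mul_sum, h0]
  simp only [mul_zero, zero_add, Finset.sum_const, nsmul_eq_mul]
  gcongr
  linarith [Real.add_one_le_exp (t ^ 2)]

lemma tail_le {ι : Type} (s : Finset ι) (X : ι → ℝ) (hX : ∀ i ∈ s, |X i| ≤ 1)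
    (h0 : ∑ i ∈ s, X i = 0) (ε : ℝ) (hε : 0 ≤ ε) (hε1 : ε ≤ 1) (l : ℕ) :
    (((Fintype.piFinset (fun _ : Fin l => s)).filter
      (fun u => ε * l < ∑ j, X (u j))).card : ℝ) ≤
      (s.card : ℝ) ^ l * Real.exp (-(ε ^ 2 * l / 4)) := by
  have hm := mgf_le s X hX h0 (ε / 2) (by rw [abs_le]; constructor <;> linarith)
  have h1 : ∑ u ∈ Fintype.piFinset (fun _ : Fin l => s), Real.exp (∑ j, ε / 2 * X (u j)) ≤
      (s.card * Real.exp ((ε / 2) ^ 2)) ^ l := by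
    simp_rw [Real.exp_sum]
    rw [← Finset.prod_univ_sum (fun _ : Fin l => s) (fun _ i => Real.exp (ε / 2 * X i))]
    simp only [Finset.prod_const, Finset.card_univ, Fintype.card_fin]
    exact pow_le_pow_left₀ (Finset.sum_nonneg fun _ _ => (Real.exp_pos _).le) hm l
  have h2 : (((Fintype.piFinset (fun _ : Fin l => s)).filter
      (fun u => ε * l < ∑ j, X (u j))).card : ℝ) * Real.exp (ε / 2 * (ε * l)) ≤
      ∑ u ∈ Fintype.piFinset (fun _ : Fin l => s), Real.exp (∑ j, ε / 2 * X (u j)) := by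
    rw [← nsmul_eq_mul, ← Finset.sum_const]
    refine (Finset.sum_le_sum fun u hu => ?_).trans
      (Finset.sum_le_sum_of_subset_of_nonneg (Finset.filter_subset _ _)
        fun _ _ _ => (Real.exp_pos _).le)
    rw [← Finset.mul_sum]
    have := (Finset.mem_filter.1 hu).2
    gcongr
  have h3 := h2.trans h1
  rw [← le_div_iff₀ (Real.exp_pos _), div_eq_mul_inv, ← Real.exp_neg, mul_pow, ← Real.exp_nat_mul,
    mul_assoc, ← Real.exp_add] at h3
  have e : -(ε ^ 2 * l / 4) = (l : ℝ) * (ε / 2) ^ 2 + -(ε / 2 * (ε * l)) := by ring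
  rw [e]
  exact h3

noncomputable def ind {V : Type} (A : Finset V) (x : V) : ℝ := if x ∈ A then 1 else 0

noncomputable def corr {V : Type} [AddCommGroup V] [Fintype V] (A : Finset V) (x : V) : ℝ :=
  ∑ z, ind A z * ind A (z + x)

lemma ind_nonneg {V : Type} (A : Finset V) (x : V) : 0 ≤ ind A x := by
  unfold ind; split_ifs <;> norm_num

lemma ind_le_one {V : Type} (A : Finset V) (x : V) : ind A x ≤ 1 := by
  unfold ind; split_ifs <;> norm_num

lemma sum_ind {V : Type} [Fintype V] (A : Finset V) : ∑ x, ind A x = A.card := by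
  simp [ind]

lemma sum_ind_shift {V : Type} [AddCommGroup V] [Fintype V] (A : Finset V) (t : V) :
    ∑ x, ind A (x + t) = A.card := by
  rw [← sum_ind A]
  exact Equiv.sum_comp (Equiv.addRight t) (ind A)

lemma sum_ind_shift' {V : Type} [AddCommGroup V] [Fintype V] (A : Finset V) (t : V) :
    ∑ x, ind A (t + x) = A.card := by
  rw [← sum_ind A]
  exact Equiv.sum_comp (Equiv.addLeft t) (ind A)

lemma corr_nonneg {V : Type} [AddCommGroup V] [Fintype V] (A : Finset V) (x : V) :
    0 ≤ corr A x :=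
  Finset.sum_nonneg fun _ _ => mul_nonneg (ind_nonneg _ _) (ind_nonneg _ _)

lemma corr_moment {V : Type} [AddCommGroup V] [Fintype V] (A S : Finset V) (p : ℕ)
    (hp : Even p) (hA : A.Nonempty)
    (hfew : ∑ s ∈ S, corr A s ≤ 1 / 2 * ((A.card : ℝ) ^ 2 / Fintype.card V) * S.card) :
    (S.card : ℝ) / 3 * (5 / 4 * ((A.card : ℝ) ^ 2 / Fintype.card V)) ^ p ≤
      ∑ x, corr A x ^ p := by
  have hV : (0 : ℝ) < Fintype.card V := by
    have : 0 < Fintype.card V := Fintype.card_pos_iff.2 ⟨0⟩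
    exact_mod_cast this
  have hAc : (0 : ℝ) < A.card := by exact_mod_cast hA.card_pos
  set N : ℝ := ((Fintype.card V : ℕ) : ℝ) with hN
  set m : ℝ := (A.card : ℝ) ^ 2 / N with hm
  have hm0 : 0 < m := by positivity
  have hG : ∀ x, corr A x - m = ∑ z, (ind A z - A.card / N) * (ind A (z + x) - A.card / N) := by
    intro x
    simp only [sub_mul, mul_sub, Finset.sum_sub_distrib, ← Finset.sum_mul, ← Finset.mul_sum,
      sum_ind, sum_ind_shift]
    simp only [Finset.sum_const, Finset.card_univ, nsmul_eq_mul, ← hN]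
    unfold corr
    rw [hm]
    field_simp
    ring
  have key := reflect (fun x => corr A x - m) (fun k => by
    simp_rw [hG]
    exact corr_pow_nonneg (fun z => ind A z - A.card / N) k) m hm0.le p
  simp only [add_sub_cancel] at key
  refine le_trans ?_ key
  set S' := S.filter (fun s => corr A s ≤ 3 / 4 * m) with hS'
  have hcard : (S.card : ℝ) / 3 ≤ S'.card := by
    have h1 : ∑ s ∈ S, corr A s ≥ ∑ s ∈ S, (3 / 4 * m * (1 - ind S' s)) := by
      refine Finset.sum_le_sum fun s hs => ?_
      by_cases h : s ∈ S'
      · simp [ind, h, corr_nonneg]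
      · have : ¬ corr A s ≤ 3 / 4 * m := fun h' => h (Finset.mem_filter.2 ⟨hs, h'⟩)
        simp [ind, h]
        linarith
    rw [← Finset.mul_sum, Finset.sum_sub_distrib] at h1
    have h2 : ∑ s ∈ S, ind S' s = S'.card := by
      simp only [ind, Finset.sum_ite_mem]
      rw [Finset.inter_eq_right.2 (Finset.filter_subset _ _)]
      rw [Finset.sum_const, nsmul_eq_mul, mul_one]
    rw [h2] at h1
    simp only [Finset.sum_const, nsmul_eq_mul, mul_one] at h1
    have h3 : m * (3 / 4 * (S.card - S'.card)) ≤ m * (1 / 2 * S.card) := by linarith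
    have := le_of_mul_le_mul_left h3 hm0
    linarith
  calc (S.card : ℝ) / 3 * (5 / 4 * m) ^ p ≤ S'.card * (5 / 4 * m) ^ p := by gcongr
    _ = ∑ s ∈ S', (5 / 4 * m) ^ p := by simp
    _ ≤ ∑ s ∈ S', (m - (corr A s - m)) ^ p := by
        refine Finset.sum_le_sum fun s hs => ?_
        have := (Finset.mem_filter.1 hs).2
        exact pow_le_pow_left₀ (by positivity) (by linarith) p
    _ ≤ _ := Finset.sum_le_sum_of_subset_of_nonneg (Finset.subset_univ _)
        fun _ _ _ => hp.pow_nonneg _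

lemma sift {V : Type} [AddCommGroup V] [Fintype V] (A S : Finset V) (p : ℕ) (L : ℝ)
    (hp : Even p) (hpL : 99 * Real.exp L < (10 / 9 : ℝ) ^ p)
    (hA : A.Nonempty) (hS : (Fintype.card V : ℝ) ≤ Real.exp L * S.card)
    (hfew : ∑ s ∈ S, corr A s ≤ 1 / 2 * ((A.card : ℝ) ^ 2 / Fintype.card V) * S.card) :
    ∃ A' : Finset V, ((A.card : ℝ) / Fintype.card V) ^ p * Fintype.card V ≤ A'.card ∧
      ∑ x ∈ A', ∑ y ∈ A',
        ind (Finset.univ.filter fun x => corr A x < 9 / 8 * ((A.card : ℝ) ^ 2 / Fintype.card V))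
          (y - x) ≤ 1 / 32 * (A'.card : ℝ) ^ 2 := by
  have hmom := corr_moment A S p hp hA hfew
  have hV : (0 : ℝ) < Fintype.card V := by
    have : 0 < Fintype.card V := Fintype.card_pos_iff.2 ⟨0⟩
    exact_mod_cast this
  have hAc : (0 : ℝ) < A.card := by exact_mod_cast hA.card_pos
  set N : ℝ := ((Fintype.card V : ℕ) : ℝ) with hN
  set m : ℝ := (A.card : ℝ) ^ 2 / N with hm
  have hm0 : 0 < m := by positivity
  set B : Finset V := Finset.univ.filter fun x => corr A x < 9 / 8 * m with hB
  set Z : (Fin p → V) → Finset V := fun u => Finset.univ.filter fun x => ∀ j, u j + x ∈ A with hZ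
  have hprod : ∀ u x, ∏ j, ind A (u j + x) = ind (Z u) x := by
    intro u x
    simp only [ind, hZ, Finset.mem_filter, Finset.mem_univ, true_and]
    rw [Finset.prod_ite_zero]
    simp
  -- first moment
  have f1 : ∑ u, ((Z u).card : ℝ) = N * (A.card : ℝ) ^ p := by
    have : ∀ u, ((Z u).card : ℝ) = ∑ x, ∏ j, ind A (u j + x) := by
      intro u; simp_rw [hprod, sum_ind]
    simp_rw [this]
    rw [Finset.sum_comm]
    have h2 : ∀ x, ∑ u : Fin p → V, ∏ j, ind A (u j + x) = (A.card : ℝ) ^ p := by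
      intro x
      rw [← Fintype.sum_pow (fun z => ind A (z + x)), sum_ind_shift]
    rw [Finset.sum_congr rfl fun x _ => h2 x]
    simp [hN]
  -- second moment
  have f2 : ∑ u, ((Z u).card : ℝ) ^ 2 = N * ∑ x, corr A x ^ p := by
    have := corr_pow (ind A) (fun _ => 1) p
    simp only [one_mul, hprod] at this
    unfold corr
    rw [hN, this]
    refine Finset.sum_congr rfl fun u _ => ?_
    rw [← Finset.sum_mul_sum, sum_ind, sq]
  have ind_sum : ∀ (C : Finset V) (f : V → ℝ), ∑ x ∈ C, f x = ∑ x, ind C x * f x := by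
    intro C f
    simp [ind]
  have f3 : ∑ u, (∑ x ∈ Z u, ∑ y ∈ Z u, ind B (y - x)) = N * ∑ x, ind B x * corr A x ^ p := by
    have := corr_pow (ind A) (ind B) p
    simp only [hprod] at this
    unfold corr
    rw [hN, this]
    refine Finset.sum_congr rfl fun u _ => ?_
    rw [ind_sum]
    refine Finset.sum_congr rfl fun x _ => ?_
    rw [ind_sum, Finset.mul_sum]
    refine Finset.sum_congr rfl fun y _ => ?_
    ring
  have f3' : ∑ x, ind B x * corr A x ^ p ≤ N * (9 / 8 * m) ^ p := by
    calc ∑ x, ind B x * corr A x ^ p ≤ ∑ x : V, (9 / 8 * m) ^ p := by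
          refine Finset.sum_le_sum fun x _ => ?_
          by_cases h : x ∈ B
          · have h' := (Finset.mem_filter.1 h).2
            simp only [ind, h, if_true, one_mul]
            exact pow_le_pow_left₀ (corr_nonneg _ _) h'.le p
          · simp only [ind, h, if_false, zero_mul]
            exact pow_nonneg (by linarith) p
      _ = _ := by simp [hN]
  set t : ℝ := ((A.card : ℝ) / N) ^ p * N with ht
  have ht0 : 0 ≤ t := mul_nonneg (pow_nonneg (div_nonneg hAc.le hV.le) p) hV.le
  clear_value N Z B t
  by_contra hcon
  push Not at hcon
  have g : ∀ u, ((Z u).card : ℝ) ^ 2 ≤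
      t * (Z u).card + 32 * ∑ x ∈ Z u, ∑ y ∈ Z u, ind B (y - x) := by
    intro u
    have h0 : 0 ≤ ∑ x ∈ Z u, ∑ y ∈ Z u, ind B (y - x) :=
      Finset.sum_nonneg fun _ _ => Finset.sum_nonneg fun _ _ => ind_nonneg _ _
    have hc0 : (0 : ℝ) ≤ (Z u).card := Nat.cast_nonneg _
    rcases le_or_gt t ((Z u).card) with h | h
    · have := hcon (Z u) h
      nlinarith
    · nlinarith
  have g2 := Finset.sum_le_sum (s := Finset.univ) fun u _ => g u
  rw [Finset.sum_add_distrib, ← Finset.mul_sum, ← Finset.mul_sum, f1, f2, f3] at g2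
  have e1 : t * (N * (A.card : ℝ) ^ p) = N * (N * m ^ p) := by
    rw [ht, hm, div_pow, div_pow]; field_simp; ring
  rw [e1] at g2
  clear_value m
  have g3 : N * (∑ x, corr A x ^ p) ≤ N * (N * m ^ p + 32 * (N * (9 / 8 * m) ^ p)) := by
    nlinarith
  have g4 := hmom.trans (le_of_mul_le_mul_left g3 hV)
  rw [mul_pow, mul_pow] at g4
  have hmp : 0 < m ^ p := pow_pos hm0 p
  have g5 : m ^ p * (S.card / 3 * (5 / 4) ^ p) ≤ m ^ p * (N * (1 + 32 * (9 / 8) ^ p)) := by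
    linarith
  have g6 := le_of_mul_le_mul_left g5 hmp
  have e54 : (5 / 4 : ℝ) ^ p = (10 / 9) ^ p * (9 / 8) ^ p := by
    rw [← mul_pow]; norm_num
  have h98 : (1 : ℝ) ≤ (9 / 8) ^ p := one_le_pow₀ (by norm_num)
  have hSc : (0 : ℝ) < S.card := by
    by_contra hh
    have : (S.card : ℝ) = 0 := le_antisymm (not_lt.1 hh) (Nat.cast_nonneg _)
    rw [this] at hS; linarith
  have g7 : (S.card : ℝ) / 3 * (99 * Real.exp L * (9 / 8) ^ p) < S.card / 3 * (5 / 4) ^ p := by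
    rw [e54]; exact mul_lt_mul_of_pos_left (mul_lt_mul_of_pos_right hpL (by linarith)) (by linarith)
  have g8 : N * (1 + 32 * (9 / 8) ^ p) ≤ N * (33 * (9 / 8) ^ p) := by
    gcongr; linarith
  have g9 : N * (33 * (9 / 8) ^ p) ≤ (Real.exp L * S.card) * (33 * (9 / 8) ^ p) := by gcongr
  linarith

lemma sum_ind_subset {V : Type} (P S' : Finset V) (h : S' ⊆ P) :
    ∑ s ∈ P, ind S' s = S'.card := by
  simp only [ind, Finset.sum_ite_mem]
  rw [Finset.inter_eq_right.2 h]
  rw [Finset.sum_const, nsmul_eq_mul, mul_one]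

noncomputable def cv {V : Type} [AddCommGroup V] (A B : Finset V) (y : V) : ℝ :=
  (∑ x ∈ A, ind B (y - x)) / A.card

lemma cv_nonneg {V : Type} [AddCommGroup V] (A B : Finset V) (y : V) : 0 ≤ cv A B y :=
  div_nonneg (Finset.sum_nonneg fun _ _ => ind_nonneg _ _) (Nat.cast_nonneg _)

lemma cv_le_one {V : Type} [AddCommGroup V] (A B : Finset V) (y : V) : cv A B y ≤ 1 := by
  unfold cv
  apply div_le_one_of_le₀ _ (Nat.cast_nonneg _)
  calc ∑ x ∈ A, ind B (y - x) ≤ ∑ x ∈ A, (1 : ℝ) := Finset.sum_le_sum fun _ _ => ind_le_one _ _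
    _ = _ := by simp

lemma croot_sisask {V : Type} [AddCommGroup V] [Fintype V] (A B : Finset V) (hA : A.Nonempty)
    (ε : ℝ) (hε : 0 ≤ ε) (hε1 : ε ≤ 1) (l : ℕ) (hl : 0 < l) :
    ∃ (T : Finset V) (h : V → ℝ),
      (A.card : ℝ) ^ l * Fintype.card V ≤ 2 * (Fintype.card V : ℝ) ^ l * T.card ∧
      (∀ y, 0 ≤ h y ∧ h y ≤ 1) ∧
      ∀ t ∈ T, ((Finset.univ.filter fun y => ε < |cv A B (y + t) - h y|).card : ℝ) ≤
        4 * Real.exp (-(ε ^ 2 * l / 4)) * Fintype.card V := by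
  have hV : (0 : ℝ) < Fintype.card V := by
    have : 0 < Fintype.card V := Fintype.card_pos_iff.2 ⟨0⟩
    exact_mod_cast this
  have hAc : (0 : ℝ) < A.card := by exact_mod_cast hA.card_pos
  have hl' : (0 : ℝ) < l := by exact_mod_cast hl
  set δ := Real.exp (-(ε ^ 2 * l / 4)) with hδ
  have hδ0 : 0 < δ := Real.exp_pos _
  let avg : (Fin l → V) → V → ℝ := fun u y => (∑ j, ind B (y - u j)) / l
  let P := Fintype.piFinset (fun _ : Fin l => A)
  have hPcard : (P.card : ℝ) = (A.card : ℝ) ^ l := by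
    simp [P, Fintype.card_piFinset]
  have hy : ∀ y, ((P.filter fun u => ε < |cv A B y - avg u y|).card : ℝ) ≤
      2 * ((A.card : ℝ) ^ l * δ) := by
    intro y
    have hX1 : ∀ a ∈ A, |ind B (y - a) - cv A B y| ≤ 1 := by
      intro a _
      rw [abs_le]
      constructor <;>
      linarith [ind_nonneg B (y - a), ind_le_one B (y - a), cv_nonneg A B y, cv_le_one A B y]
    have hX0 : ∑ a ∈ A, (ind B (y - a) - cv A B y) = 0 := by
      rw [Finset.sum_sub_distrib]
      simp only [Finset.sum_const, nsmul_eq_mul, cv]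
      field_simp
      ring
    have t1 := tail_le A (fun a => ind B (y - a) - cv A B y) hX1 hX0 ε hε hε1 l
    have t2 := tail_le A (fun a => -(ind B (y - a) - cv A B y))
      (fun a ha => by rw [abs_neg]; exact hX1 a ha)
      (by rw [Finset.sum_neg_distrib, hX0, neg_zero]) ε hε hε1 l
    have hsub : (P.filter fun u => ε < |cv A B y - avg u y|) ⊆
        (P.filter fun u => ε * l < ∑ j, (ind B (y - u j) - cv A B y)) ∪
        (P.filter fun u => ε * l < ∑ j, -(ind B (y - u j) - cv A B y)) := by
      intro u hu
      rw [Finset.mem_filter] at hu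
      rw [Finset.mem_union, Finset.mem_filter, Finset.mem_filter]
      have e1 : ∑ j, (ind B (y - u j) - cv A B y) = (avg u y - cv A B y) * l := by
        rw [Finset.sum_sub_distrib]
        simp only [Finset.sum_const, Finset.card_univ, Fintype.card_fin, nsmul_eq_mul, avg]
        field_simp
      rw [Finset.sum_neg_distrib, e1]
      rcases lt_abs.1 hu.2 with h | h
      · right
        refine ⟨hu.1, ?_⟩
        rw [← neg_mul]
        exact mul_lt_mul_of_pos_right (by linarith) hl'
      · left
        refine ⟨hu.1, ?_⟩
        exact mul_lt_mul_of_pos_right (by linarith) hl'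
    have hc : ((P.filter fun u => ε < |cv A B y - avg u y|).card : ℝ) ≤
        ((P.filter fun u => ε * l < ∑ j, (ind B (y - u j) - cv A B y)).card : ℝ) +
        ((P.filter fun u => ε * l < ∑ j, -(ind B (y - u j) - cv A B y)).card : ℝ) := by
      exact_mod_cast (Finset.card_le_card hsub).trans (Finset.card_union_le _ _)
    linarith
  let bad : (Fin l → V) → Finset V := fun u => Finset.univ.filter fun y => ε < |cv A B y - avg u y|
  have hsum : ∑ u ∈ P, ((bad u).card : ℝ) ≤ Fintype.card V * (2 * ((A.card : ℝ) ^ l * δ)) := by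
    have e : ∑ u ∈ P, ((bad u).card : ℝ) =
        ∑ y : V, ((P.filter fun u => ε < |cv A B y - avg u y|).card : ℝ) := by
      simp only [bad, Finset.card_filter, Nat.cast_sum]
      rw [Finset.sum_comm]
    rw [e]
    refine (Finset.sum_le_sum fun y _ => hy y).trans ?_
    simp
  let Good := P.filter fun u => ((bad u).card : ℝ) ≤ 4 * δ * Fintype.card V
  have hgood : (A.card : ℝ) ^ l ≤ 2 * Good.card := by
    have h1 : ∑ u ∈ P, (4 * δ * Fintype.card V) * (1 - ind Good u) ≤ ∑ u ∈ P, ((bad u).card : ℝ) := by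
      refine Finset.sum_le_sum fun u hu => ?_
      by_cases h : u ∈ Good
      · simp [ind, h]
      · have : ¬ ((bad u).card : ℝ) ≤ 4 * δ * Fintype.card V := fun h' =>
          h (Finset.mem_filter.2 ⟨hu, h'⟩)
        simp only [ind, h, if_false, sub_zero, mul_one]
        linarith
    rw [← Finset.mul_sum, Finset.sum_sub_distrib] at h1
    have h2 : ∑ s ∈ P, ind Good s = Good.card := sum_ind_subset P Good (Finset.filter_subset _ _)
    rw [h2, Finset.sum_const, nsmul_eq_mul, mul_one, hPcard] at h1
    have h3 := h1.trans hsum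
    have h4 : (2 * δ * Fintype.card V) * (2 * ((A.card : ℝ) ^ l - Good.card)) ≤
      (2 * δ * Fintype.card V) * (A.card : ℝ) ^ l := by linarith
    have := le_of_mul_le_mul_left h4 (by positivity)
    linarith
  let TT : (Fin l → V) → Finset V := fun w => Finset.univ.filter fun t => (fun j => w j + t) ∈ Good
  have hTT : ∑ w, ((TT w).card : ℝ) = Fintype.card V * Good.card := by
    simp only [TT, Finset.card_filter, Nat.cast_sum]
    rw [Finset.sum_comm]
    have : ∀ t : V, ∑ w : Fin l → V, (((if (fun j => w j + t) ∈ Good then 1 else 0 : ℕ)) : ℝ) =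
        Good.card := by
      intro t
      rw [← sum_ind Good, ← Equiv.sum_comp (Equiv.addRight (fun _ : Fin l => t)) (ind Good)]
      refine Finset.sum_congr rfl fun w _ => ?_
      have : (Equiv.addRight (fun _ : Fin l => t)) w = fun j => w j + t := rfl
      rw [this]
      simp [ind]
    rw [Finset.sum_congr rfl fun t _ => this t]
    simp
  obtain ⟨w, hw⟩ : ∃ w, (Fintype.card V : ℝ) * Good.card ≤ (Fintype.card V : ℝ) ^ l * (TT w).card := by
    by_contra hcon
    push Not at hcon
    have h1 : ∑ w : Fin l → V, (Fintype.card V : ℝ) ^ l * (TT w).card <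
        ∑ w : Fin l → V, (Fintype.card V : ℝ) * Good.card :=
      Finset.sum_lt_sum_of_nonempty ⟨fun _ => 0, Finset.mem_univ _⟩ fun w _ => hcon w
    rw [← Finset.mul_sum, hTT] at h1
    simp at h1
  refine ⟨TT w, avg w, ?_, ?_, ?_⟩
  · nlinarith
  · intro y
    refine ⟨div_nonneg (Finset.sum_nonneg fun _ _ => ind_nonneg _ _) hl'.le, ?_⟩
    apply div_le_one_of_le₀ _ hl'.le
    calc ∑ j, ind B (y - w j) ≤ ∑ j : Fin l, (1 : ℝ) :=
          Finset.sum_le_sum fun _ _ => ind_le_one _ _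
      _ = _ := by simp
  · intro t ht
    have hg := (Finset.mem_filter.1 (Finset.mem_filter.1 ht).2).2
    refine le_trans ?_ hg
    have : ((Finset.univ.filter fun y => ε < |cv A B (y + t) - avg w y|).map
        (Equiv.addRight t).toEmbedding) ⊆ bad (fun j => w j + t) := by
      intro x hx
      rw [Finset.mem_map] at hx
      obtain ⟨y, hy, rfl⟩ := hx
      have hy' := (Finset.mem_filter.1 hy).2
      simp only [bad, Finset.mem_filter, Finset.mem_univ, true_and, Equiv.toEmbedding_apply,
        Equiv.coe_addRight, avg, add_sub_add_right_eq_sub]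
      exact hy'
    have h2 := Finset.card_le_card this
    rw [Finset.card_map] at h2
    exact_mod_cast h2

lemma sum_bad {V : Type} (Y E : Finset V) (f : V → ℝ) (ε : ℝ) (hε : 0 ≤ ε)
    (h1 : ∀ y, f y ≤ 1) (h2 : ∀ y, y ∉ E → f y ≤ ε) :
    ∑ y ∈ Y, f y ≤ ε * Y.card + E.card := by
  calc ∑ y ∈ Y, f y ≤ ∑ y ∈ Y, (ε + ind E y) := by
        refine Finset.sum_le_sum fun y _ => ?_
        by_cases h : y ∈ E
        · simp only [ind, h, if_true]; linarith [h1 y]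
        · simp only [ind, h, if_false]; linarith [h2 y h]
    _ = ε * Y.card + (Y ∩ E).card := by
        rw [Finset.sum_add_distrib]
        simp [ind, mul_comm]
    _ ≤ _ := by
        gcongr
        exact Finset.inter_subset_right

lemma almost_periods {V : Type} [AddCommGroup V] [Fintype V] (A B : Finset V) (hA : A.Nonempty)
    (k : ℕ) (hk : 7 ≤ k) (hAk : (Fintype.card V : ℝ) ≤ 2 ^ k * A.card) :
    ∃ T : Finset V, (Fintype.card V : ℝ) ≤ 2 ^ (2 ^ 20 * k ^ 4 + 1) * T.card ∧
      ∀ t ∈ T, ∀ t' ∈ T, ∀ w, ∑ y ∈ A, |cv A B (y + w + (t - t')) - cv A B (y + w)| ≤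
        A.card / (64 * k) := by
  have hV : (0 : ℝ) < Fintype.card V := by
    have : 0 < Fintype.card V := Fintype.card_pos_iff.2 ⟨0⟩
    exact_mod_cast this
  have hAc : (0 : ℝ) < A.card := by exact_mod_cast hA.card_pos
  have hk' : (7 : ℝ) ≤ k := by exact_mod_cast hk
  have hk0 : (0 : ℝ) < k := by linarith
  obtain ⟨ε, hεd⟩ : ∃ ε : ℝ, ε = 1 / (256 * k) := ⟨_, rfl⟩
  have hε0 : 0 < ε := by rw [hεd]; positivity
  have hε1 : ε ≤ 1 := by
    rw [hεd, div_le_one (by positivity)]; linarith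
  obtain ⟨T, h, hT, hh, hbad⟩ := croot_sisask A B hA ε hε0.le hε1 (2 ^ 20 * k ^ 3) (by positivity)
  have hexp : 4 * Real.exp (-(ε ^ 2 * ((2 ^ 20 * k ^ 3 : ℕ) : ℝ) / 4)) * Fintype.card V ≤
      ε * A.card := by
    have e1 : ε ^ 2 * ((2 ^ 20 * k ^ 3 : ℕ) : ℝ) / 4 = 4 * k := by
      rw [hεd]; push_cast; field_simp; norm_num
    rw [e1]
    have h2 : (2 : ℝ) ^ k ≤ Real.exp k := by
      have := Real.add_one_le_exp (1 : ℝ)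
      calc (2 : ℝ) ^ k ≤ (Real.exp 1) ^ k := by gcongr; linarith
        _ = _ := by rw [← Real.exp_nat_mul]; simp
    have h3 : (k : ℝ) ≤ Real.exp k := by linarith [Real.add_one_le_exp (k : ℝ)]
    have h4 : (1024 : ℝ) ≤ Real.exp k := by
      calc (1024 : ℝ) ≤ (2.7182818283 : ℝ) ^ 7 := by norm_num
        _ ≤ (Real.exp 1) ^ 7 := by
            gcongr; exact Real.exp_one_gt_d9.le
        _ = Real.exp 7 := by rw [← Real.exp_nat_mul]; simp
        _ ≤ _ := Real.exp_le_exp.2 hk'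
    have h5 : 1024 * k * 2 ^ k * Real.exp (-(4 * k)) ≤ 1 := by
      calc 1024 * k * 2 ^ k * Real.exp (-(4 * k)) ≤
          Real.exp k * Real.exp k * Real.exp k * Real.exp (-(4 * k)) := by gcongr
        _ = Real.exp (-k) := by rw [← Real.exp_add, ← Real.exp_add, ← Real.exp_add]; ring_nf
        _ ≤ 1 := by rw [Real.exp_le_one_iff]; linarith
    calc 4 * Real.exp (-(4 * k)) * Fintype.card V
        ≤ 4 * Real.exp (-(4 * k)) * (2 ^ k * A.card) := by gcongr
      _ = (1024 * k * 2 ^ k * Real.exp (-(4 * k))) * (A.card * ε) := by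
          rw [hεd]; field_simp; ring
      _ ≤ 1 * (A.card * ε) := by gcongr
      _ = _ := by ring
  refine ⟨T, ?_, ?_⟩
  · have h1 : (Fintype.card V : ℝ) ^ (2 ^ 20 * k ^ 3) ≤
        2 ^ (2 ^ 20 * k ^ 4) * (A.card : ℝ) ^ (2 ^ 20 * k ^ 3) := by
      calc (Fintype.card V : ℝ) ^ (2 ^ 20 * k ^ 3) ≤ (2 ^ k * A.card) ^ (2 ^ 20 * k ^ 3) := by gcongr
        _ = _ := by rw [mul_pow, ← pow_mul]; ring_nf
    have h2 : (A.card : ℝ) ^ (2 ^ 20 * k ^ 3) * Fintype.card V ≤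
        (A.card : ℝ) ^ (2 ^ 20 * k ^ 3) * (2 ^ (2 ^ 20 * k ^ 4 + 1) * T.card) := by
      refine hT.trans ?_
      calc 2 * (Fintype.card V : ℝ) ^ (2 ^ 20 * k ^ 3) * T.card
          ≤ 2 * (2 ^ (2 ^ 20 * k ^ 4) * (A.card : ℝ) ^ (2 ^ 20 * k ^ 3)) * T.card := by gcongr
        _ = _ := by ring
    exact le_of_mul_le_mul_left h2 (by positivity)
  · have one : ∀ t ∈ T, ∀ Y : Finset V, Y.card = A.card →
        ∑ y ∈ Y, |cv A B (y + t) - h y| ≤ 2 * ε * A.card := by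
      intro t ht Y hY
      refine (sum_bad Y _ _ ε hε0.le (fun y => ?_) (fun y hy => ?_)).trans
        (b := ε * Y.card + (Finset.univ.filter fun y => ε < |cv A B (y + t) - h y|).card) ?_
      · rw [abs_le]
        constructor <;> linarith [hh y, cv_nonneg A B (y + t), cv_le_one A B (y + t)]
      · simpa using hy
      · rw [hY]
        linarith [hbad t ht]
    intro t ht t' ht' w
    have s1 := one t ht (A.map (Equiv.addRight (w - t')).toEmbedding) (Finset.card_map _)
    have s2 := one t' ht' (A.map (Equiv.addRight (w - t')).toEmbedding) (Finset.card_map _)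
    rw [Finset.sum_map] at s1 s2
    simp only [Equiv.toEmbedding_apply, Equiv.coe_addRight] at s1 s2
    have e : (A.card : ℝ) / (64 * k) = 2 * ε * A.card + 2 * ε * A.card := by
      rw [hεd]; field_simp; norm_num
    rw [e]
    refine le_trans ?_ (add_le_add s1 s2)
    rw [← Finset.sum_add_distrib]
    refine Finset.sum_le_sum fun y _ => ?_
    have e1 : y + (w - t') + t = y + w + (t - t') := by abel
    have e2 : y + (w - t') + t' = y + w := by abel
    rw [e1, e2, abs_sub_comm (cv A B (y + w)) (h _)]
    exact abs_sub_le _ _ _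

lemma exists_char (F : Type) [Field F] [Fintype F] : ∃ χ : AddChar F ℂ, χ ≠ 1 := by
  obtain ⟨ψ, hψ⟩ := (AddChar.exists_apply_ne_zero (α := F) (a := 1)).2 one_ne_zero
  exact ⟨ψ, fun h => hψ (by rw [h]; rfl)⟩

lemma sum_surj {V U : Type} [AddCommGroup V] [Fintype V] [AddCommGroup U] [Fintype U]
    (f : V →+ U) (hf : Function.Surjective f) (g : U → ℝ) :
    (Fintype.card U : ℝ) * ∑ x, g (f x) = Fintype.card V * ∑ y, g y := by
  have h1 : ∀ y : U, ∑ x, g (y + f x) = ∑ x, g (f x) := by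
    intro y
    obtain ⟨x0, rfl⟩ := hf y
    simp_rw [← map_add]
    exact Equiv.sum_comp (Equiv.addLeft x0) (fun x => g (f x))
  have h2 : ∀ x : V, ∑ y, g (y + f x) = ∑ y, g y := by
    intro x
    exact Equiv.sum_comp (Equiv.addRight (f x)) g
  have h3 : ∑ y : U, ∑ x : V, g (y + f x) = ∑ x : V, ∑ y : U, g (y + f x) := Finset.sum_comm
  simp only [h1, h2] at h3
  simpa using h3

lemma surj_of_indep {F V ι : Type} [Field F] [AddCommGroup V] [Module F V] [Fintype ι]
    (φ : ι → Module.Dual F V) (h : LinearIndependent F φ) :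
    Function.Surjective (LinearMap.pi φ) := by
  rw [← LinearMap.dualMap_injective_iff, ← LinearMap.ker_eq_bot, LinearMap.ker_eq_bot']
  intro ξ hξ
  have h1 := Fintype.linearIndependent_iff.1 h (fun i => ξ (Pi.single i 1)) (by
    ext x
    have h2 : ξ (LinearMap.pi φ x) = 0 := by
      have := congrArg (fun η => η x) hξ
      simpa using this
    rw [LinearMap.zero_apply, ← h2, LinearMap.pi_apply_eq_sum_univ ξ]
    simp only [LinearMap.sum_apply, LinearMap.smul_apply, LinearMap.pi_apply, smul_eq_mul]
    refine Finset.sum_congr rfl fun i _ => ?_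
    rw [mul_comm]
    congr 2
    ext j
    simp [Pi.single_apply, eq_comm])
  apply LinearMap.pi_ext'
  intro i
  ext
  simpa using h1 i

lemma chang {F V : Type} [Field F] [Fintype F] [AddCommGroup V] [Module F V] [Fintype V]
    (χ : AddChar F ℂ) (hχ : χ ≠ 1) (T : Finset V) (m : ℕ)
    (hTm : (Fintype.card V : ℝ) ≤ 2 ^ m * T.card)
    (Δ : Set (Module.Dual F V)) (hΔ : ∀ φ ∈ Δ, (T.card : ℝ) ≤ 2 * ‖∑ t ∈ T, χ (φ t)‖) :
    Module.finrank F (Submodule.span F Δ) ≤ 16 * m := by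
  have hV : (0 : ℝ) < Fintype.card V := by
    have : 0 < Fintype.card V := Fintype.card_pos_iff.2 ⟨0⟩
    exact_mod_cast this
  have : Finite (Module.Dual F V) := DFunLike.finite _
  obtain ⟨b, hb, hspan, hlin⟩ := exists_linearIndependent F Δ
  have : Fintype b := Fintype.ofFinite _
  rw [← hspan, finrank_span_set_eq_card hlin, Set.toFinset_card]
  obtain ⟨d, hd⟩ : ∃ d, d = Fintype.card b := ⟨_, rfl⟩
  have hw : ∀ φ : b, ∃ w : ℂ, ‖w‖ = 1 ∧
      (w * ∑ t ∈ T, χ (φ.1 t)).re = ‖∑ t ∈ T, χ (φ.1 t)‖ := by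
    intro φ
    obtain ⟨z, hz⟩ : ∃ z, z = ∑ t ∈ T, χ (φ.1 t) := ⟨_, rfl⟩
    rw [← hz]
    by_cases h0 : z = 0
    · exact ⟨1, by simp, by simp [h0]⟩
    · have hn : (‖z‖ : ℂ) ≠ 0 := by exact_mod_cast norm_ne_zero_iff.2 h0
      refine ⟨(starRingEnd ℂ) z / ‖z‖, ?_, ?_⟩
      · rw [norm_div, RCLike.norm_conj]
        simp [h0]
      · have : (starRingEnd ℂ) z / ‖z‖ * z = (‖z‖ : ℂ) := by
          rw [div_mul_eq_mul_div, mul_comm, Complex.mul_conj, Complex.normSq_eq_norm_sq]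
          push_cast
          field_simp
        rw [this]; simp
  choose w hw1 hw2 using hw
  -- upper bound
  have hq : (0 : ℝ) < Fintype.card F := by
    have : 0 < Fintype.card F := Fintype.card_pos_iff.2 ⟨0⟩
    exact_mod_cast this
  have up := sum_surj (LinearMap.pi (fun i : b => (i : Module.Dual F V))).toAddMonoidHom
    (surj_of_indep _ hlin) (fun y : b → F => Real.exp (∑ i, 1 / 4 * (w i * χ (y i)).re))
  have up2 : ∑ y : b → F, Real.exp (∑ i, 1 / 4 * (w i * χ (y i)).re) ≤
      (Fintype.card F * Real.exp ((1 / 4) ^ 2)) ^ d := by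
    simp_rw [Real.exp_sum]
    rw [← Fintype.prod_sum (fun (i : b) (a : F) => Real.exp (1 / 4 * (w i * χ a).re)), hd,
      ← Finset.card_univ (α := b), ← Finset.prod_const]
    refine Finset.prod_le_prod (fun i _ => Finset.sum_nonneg fun _ _ => (Real.exp_pos _).le) ?_
    intro i _
    refine mgf_le Finset.univ (fun a => (w i * χ a).re) ?_ ?_ (1 / 4) (by norm_num [abs_le])
    · intro a _
      refine (Complex.abs_re_le_norm _).trans ?_
      rw [norm_mul, hw1, AddChar.norm_apply, one_mul]
    · rw [← Complex.re_sum, ← Finset.mul_sum, AddChar.sum_eq_zero_of_ne_one hχ]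
      simp
  have up3 : ∑ x : V, Real.exp (∑ i : b, 1 / 4 * (w i * χ (i.1 x)).re) ≤
      Fintype.card V * Real.exp (d / 16) := by
    have e1 : (Fintype.card (b → F) : ℝ) = (Fintype.card F : ℝ) ^ d := by
      rw [Fintype.card_fun, hd]; push_cast; rfl
    rw [e1] at up
    have e2 : (Fintype.card F * Real.exp ((1 / 4) ^ 2)) ^ d =
        (Fintype.card F : ℝ) ^ d * Real.exp (d / 16) := by
      rw [mul_pow, ← Real.exp_nat_mul]; congr 2; ring
    rw [e2] at up2
    have : (Fintype.card F : ℝ) ^ d * ∑ x : V, Real.exp (∑ i : b, 1 / 4 * (w i * χ (i.1 x)).re) ≤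
      (Fintype.card F : ℝ) ^ d * (Fintype.card V * Real.exp (d / 16)) := by
      refine le_trans (le_of_eq up) ?_
      calc _ ≤ (Fintype.card V : ℝ) * ((Fintype.card F : ℝ) ^ d * Real.exp (d / 16)) :=
            mul_le_mul_of_nonneg_left up2 hV.le
        _ = _ := by ring
    exact le_of_mul_le_mul_left this (by positivity)
  -- lower bound
  have low : (T.card : ℝ) * Real.exp (d / 8) ≤
      ∑ x ∈ T, Real.exp (∑ i : b, 1 / 4 * (w i * χ (i.1 x)).re) := by
    have h1 : ∀ x ∈ T, Real.exp (d / 8) *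
        (1 + (∑ i : b, 1 / 4 * (w i * χ (i.1 x)).re - d / 8)) ≤
        Real.exp (∑ i : b, 1 / 4 * (w i * χ (i.1 x)).re) := by
      intro x _
      have h2 := Real.add_one_le_exp (∑ i : b, 1 / 4 * (w i * χ (i.1 x)).re - d / 8)
      have h3 : Real.exp (∑ i : b, 1 / 4 * (w i * χ (i.1 x)).re) = Real.exp (d / 8) *
        Real.exp (∑ i : b, 1 / 4 * (w i * χ (i.1 x)).re - d / 8) := by
        rw [← Real.exp_add]; congr 1; ring
      rw [h3]
      exact mul_le_mul_of_nonneg_left (by linarith) (Real.exp_pos _).le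
    refine le_trans ?_ (Finset.sum_le_sum h1)
    rw [← Finset.mul_sum, mul_comm]
    refine mul_le_mul_of_nonneg_left ?_ (Real.exp_pos _).le
    rw [Finset.sum_add_distrib, Finset.sum_sub_distrib, Finset.sum_comm]
    have h4 : ∀ i : b, (T.card : ℝ) / 8 ≤ ∑ x ∈ T, 1 / 4 * (w i * χ (i.1 x)).re := by
      intro i
      rw [← Finset.mul_sum, ← Complex.re_sum, ← Finset.mul_sum, hw2]
      linarith [hΔ i.1 (hb i.2)]
    have h5 := Finset.sum_le_sum (s := Finset.univ) fun i _ => h4 i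
    simp only [Finset.sum_const, Finset.card_univ, nsmul_eq_mul, ← hd, mul_one] at h5 ⊢
    linarith
  have h6 : ∑ x ∈ T, Real.exp (∑ i : b, 1 / 4 * (w i * χ (i.1 x)).re) ≤
      ∑ x : V, Real.exp (∑ i : b, 1 / 4 * (w i * χ (i.1 x)).re) :=
    Finset.sum_le_sum_of_subset_of_nonneg (Finset.subset_univ _) fun _ _ _ => (Real.exp_pos _).le
  have h7 := (low.trans h6).trans up3
  have hT0 : (0 : ℝ) < T.card := by
    by_contra hh
    have : (T.card : ℝ) = 0 := le_antisymm (not_lt.1 hh) (Nat.cast_nonneg _)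
    rw [this] at hTm; linarith
  have h8 : (T.card * Real.exp (d / 16)) * Real.exp (d / 16) ≤
      (T.card * 2 ^ m) * Real.exp (d / 16) := by
    rw [mul_assoc, ← Real.exp_add]
    have : (d : ℝ) / 16 + d / 16 = d / 8 := by ring
    rw [this]
    refine h7.trans ?_
    refine mul_le_mul_of_nonneg_right (by linarith) (Real.exp_pos _).le
  have h9 := le_of_mul_le_mul_left (le_of_mul_le_mul_right h8 (Real.exp_pos _)) hT0
  have h10 : (2 : ℝ) ^ m ≤ Real.exp m := by
    have := Real.add_one_le_exp (1 : ℝ)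
    calc (2 : ℝ) ^ m ≤ (Real.exp 1) ^ m := by gcongr; linarith
      _ = _ := by rw [← Real.exp_nat_mul]; simp
  have h11 := Real.exp_le_exp.1 (h9.trans h10)
  rw [← hd]
  have : (d : ℝ) ≤ ((16 * m : ℕ) : ℝ) := by push_cast; linarith
  exact_mod_cast this

lemma dual_card {F V : Type} [Field F] [Fintype F] [AddCommGroup V] [Module F V] [Fintype V]
    [Fintype (Module.Dual F V)] : Fintype.card (Module.Dual F V) = Fintype.card V := by
  rw [Module.card_eq_pow_finrank (K := F), Module.card_eq_pow_finrank (K := F) (V := V),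
    Subspace.dual_finrank_eq]

lemma dual_orth {F V : Type} [Field F] [Fintype F] [AddCommGroup V] [Module F V] [Fintype V]
    [Fintype (Module.Dual F V)] (χ : AddChar F ℂ) (hχ : χ ≠ 1) (x : V) :
    ∑ φ : Module.Dual F V, χ (φ x) = if x = 0 then (Fintype.card V : ℂ) else 0 := by
  split_ifs with h
  · simp [h, dual_card]
  · obtain ⟨φ0, h0⟩ : ∃ φ : Module.Dual F V, φ x ≠ 0 := by
      by_contra hcon
      push Not at hcon
      exact h ((Module.forall_dual_apply_eq_zero_iff F x).1 hcon)
    obtain ⟨c, hc⟩ : ∃ c, χ c ≠ 1 := by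
      by_contra hcon
      push Not at hcon
      exact hχ (by ext c; simp [hcon c])
    have h1 : ((c / φ0 x) • φ0) x = c := by simp [h0]
    have h2 : ∑ φ : Module.Dual F V, χ (φ x) = χ c * ∑ φ : Module.Dual F V, χ (φ x) := by
      conv_lhs => rw [← Equiv.sum_comp (Equiv.addLeft ((c / φ0 x) • φ0))]
      rw [Finset.mul_sum]
      refine Finset.sum_congr rfl fun φ _ => ?_
      rw [Equiv.coe_addLeft, LinearMap.add_apply, h1, AddChar.map_add_eq_mul]
    have h3 : (χ c - 1) * ∑ φ : Module.Dual F V, χ (φ x) = 0 := by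
      rw [sub_mul, one_mul, ← h2, sub_self]
    exact (mul_eq_zero.1 h3).resolve_left (sub_ne_zero.2 hc)

lemma parseval {F V : Type} [Field F] [Fintype F] [AddCommGroup V] [Module F V] [Fintype V]
    [Fintype (Module.Dual F V)] (χ : AddChar F ℂ) (hχ : χ ≠ 1) (B : Finset V) :
    ∑ φ : Module.Dual F V, ‖∑ b ∈ B, χ (φ b)‖ ^ 2 = Fintype.card V * B.card := by
  have : ∑ φ : Module.Dual F V, ((‖∑ b ∈ B, χ (φ b)‖ : ℂ)) ^ 2 = Fintype.card V * B.card := by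
    simp_rw [← Complex.mul_conj', map_sum, ← AddChar.map_neg_eq_conj, Finset.sum_mul_sum,
      ← AddChar.map_add_eq_mul, ← map_neg, ← map_add]
    rw [Finset.sum_comm]
    simp_rw [Finset.sum_comm (s := Finset.univ), dual_orth χ hχ]
    have : ∀ b ∈ B, ∑ c ∈ B, (if b + -c = 0 then (Fintype.card V : ℂ) else 0) =
        Fintype.card V := by
      intro b hb
      simp_rw [← sub_eq_add_neg, sub_eq_zero]
      simp [hb]
    rw [Finset.sum_congr rfl this]
    simp [mul_comm]
  exact_mod_cast this

lemma inversion {F V : Type} [Field F] [Fintype F] [AddCommGroup V] [Module F V] [Fintype V]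
    [Fintype (Module.Dual F V)] (χ : AddChar F ℂ) (hχ : χ ≠ 1) (B : Finset V) (x : V) :
    (Fintype.card V : ℂ) * (ind B x : ℝ) =
      ∑ φ : Module.Dual F V, (∑ b ∈ B, χ (φ b)) * χ (φ (-x)) := by
  simp_rw [Finset.sum_mul, ← AddChar.map_add_eq_mul, ← map_add]
  rw [Finset.sum_comm]
  simp_rw [dual_orth χ hχ, ← sub_eq_add_neg, sub_eq_zero]
  simp only [ind]
  split_ifs with h <;> simp [h]

lemma period_sum {V : Type} [AddCommGroup V] (A : Finset V) (f : V → ℝ) (c : ℝ)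
    {ι : Type} (J : Finset ι) (s : ι → V)
    (hs : ∀ j ∈ J, ∀ w, ∑ y ∈ A, |f (y + w + s j) - f (y + w)| ≤ c) :
    ∀ w, ∑ y ∈ A, |f (y + w + ∑ j ∈ J, s j) - f (y + w)| ≤ J.card * c := by
  induction J using Finset.induction_on with
  | empty => intro w; simp
  | insert a J ha ih =>
    intro w
    have h1 := ih (fun j hj => hs j (Finset.mem_insert_of_mem hj)) w
    have h2 := hs a (Finset.mem_insert_self _ _) (w + ∑ j ∈ J, s j)
    rw [Finset.sum_insert ha, Finset.card_insert_of_notMem ha]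
    push_cast
    have h3 : ∑ y ∈ A, |f (y + w + (s a + ∑ j ∈ J, s j)) - f (y + w)| ≤
        ∑ y ∈ A, (|f (y + (w + ∑ j ∈ J, s j) + s a) - f (y + (w + ∑ j ∈ J, s j))| +
          |f (y + w + ∑ j ∈ J, s j) - f (y + w)|) := by
      refine Finset.sum_le_sum fun y _ => ?_
      have e1 : y + w + (s a + ∑ j ∈ J, s j) = y + (w + ∑ j ∈ J, s j) + s a := by abel
      have e2 : y + (w + ∑ j ∈ J, s j) = y + w + ∑ j ∈ J, s j := by abel
      rw [e1, e2]
      exact abs_sub_le _ _ _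
    rw [Finset.sum_add_distrib] at h3
    linarith

lemma fourier_cv {F V : Type} [Field F] [Fintype F] [AddCommGroup V] [Module F V] [Fintype V]
    [Fintype (Module.Dual F V)] (χ : AddChar F ℂ) (hχ : χ ≠ 1) (A B : Finset V)
    (hA : A.Nonempty) (y : V) :
    (Fintype.card V : ℂ) * A.card * (cv A B y : ℝ) =
      ∑ φ : Module.Dual F V, (∑ b ∈ B, χ (φ b)) * (∑ a ∈ A, χ (φ a)) * χ (φ (-y)) := by
  have hAc : (A.card : ℂ) ≠ 0 := by exact_mod_cast hA.card_pos.ne'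
  have h1 : (Fintype.card V : ℂ) * A.card * (cv A B y : ℝ) =
      ∑ a ∈ A, (Fintype.card V : ℂ) * (ind B (y - a) : ℝ) := by
    rw [← Finset.mul_sum]
    unfold cv
    push_cast
    field_simp
  rw [h1]
  simp_rw [inversion χ hχ]
  rw [Finset.sum_comm]
  refine Finset.sum_congr rfl fun φ _ => ?_
  rw [← Finset.mul_sum, mul_assoc]
  congr 1
  rw [Finset.sum_mul]
  refine Finset.sum_congr rfl fun a _ => ?_
  rw [← AddChar.map_add_eq_mul, ← map_add φ]
  congr 2
  abel

lemma char_sum {F : Type} [Field F] (χ : AddChar F ℂ) {ι : Type} (s : Finset ι) (f : ι → F) :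
    χ (∑ j ∈ s, f j) = ∏ j ∈ s, χ (f j) := by
  induction s using Finset.induction_on with
  | empty => simp
  | insert a s ha ih => rw [Finset.sum_insert ha, Finset.prod_insert ha, AddChar.map_add_eq_mul, ih]

lemma smooth_inv {F V : Type} [Field F] [Fintype F] [AddCommGroup V] [Module F V] [Fintype V]
    (χ : AddChar F ℂ) (hχ : χ ≠ 1) (A B T : Finset V) (hA : A.Nonempty)
    (k : ℕ) (v : V)
    (hv : ∀ φ : Module.Dual F V, (T.card : ℝ) ≤ 2 * ‖∑ t ∈ T, χ (φ t)‖ → φ v = 0) (y : V) :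
    A.card * |∑ u ∈ Fintype.piFinset (fun _ : Fin k => T ×ˢ T),
        cv A B (y + v + ∑ j, ((u j).1 - (u j).2)) -
      ∑ u ∈ Fintype.piFinset (fun _ : Fin k => T ×ˢ T),
        cv A B (y + ∑ j, ((u j).1 - (u j).2))| ≤
      2 * ((T.card : ℝ) ^ 2 / 4) ^ k * Fintype.card V := by
  have : Finite (Module.Dual F V) := DFunLike.finite _
  have : Fintype (Module.Dual F V) := Fintype.ofFinite _
  have hV : (0 : ℝ) < Fintype.card V := by
    have : 0 < Fintype.card V := Fintype.card_pos_iff.2 ⟨0⟩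
    exact_mod_cast this
  set P := Fintype.piFinset (fun _ : Fin k => T ×ˢ T) with hP
  obtain ⟨Q, hQ⟩ : ∃ Q : Module.Dual F V → ℂ,
    Q = fun φ => ∑ p ∈ T ×ˢ T, χ (φ (-(p.1 - p.2))) := ⟨_, rfl⟩
  have hQn : ∀ φ, ‖Q φ‖ = ‖∑ t ∈ T, χ (φ t)‖ ^ 2 := by
    intro φ
    have : Q φ = (starRingEnd ℂ) (∑ t ∈ T, χ (φ t)) * (∑ t ∈ T, χ (φ t)) := by
      simp only [hQ]
      rw [Finset.sum_product, map_sum, Finset.sum_mul_sum]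
      refine Finset.sum_congr rfl fun a _ => Finset.sum_congr rfl fun b _ => ?_
      rw [← AddChar.map_neg_eq_conj, ← AddChar.map_add_eq_mul, ← map_neg φ, ← map_add φ]
      congr 2
      abel
    rw [this, norm_mul, RCLike.norm_conj, sq]
  have hH : ∀ z : V, (Fintype.card V : ℂ) * A.card *
      ((∑ u ∈ P, cv A B (z + ∑ j, ((u j).1 - (u j).2)) : ℝ) : ℂ) =
      ∑ φ : Module.Dual F V, (∑ b ∈ B, χ (φ b)) * (∑ a ∈ A, χ (φ a)) * Q φ ^ k * χ (φ (-z)) := by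
    intro z
    rw [Complex.ofReal_sum, Finset.mul_sum]
    simp_rw [fourier_cv χ hχ A B hA]
    rw [Finset.sum_comm]
    refine Finset.sum_congr rfl fun φ _ => ?_
    have e : Q φ ^ k = ∑ u ∈ P, ∏ j, χ (φ (-((u j).1 - (u j).2))) := by
      simp only [hQ, hP]
      rw [← Finset.prod_univ_sum (fun _ : Fin k => T ×ˢ T)
        (fun _ p => χ (φ (-(p.1 - p.2))))]
      simp
    rw [e, ← Finset.mul_sum, mul_assoc (_ * _) (∑ u ∈ P, _) _]
    congr 1
    rw [Finset.sum_mul]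
    refine Finset.sum_congr rfl fun u _ => ?_
    rw [neg_add, map_add, AddChar.map_add_eq_mul, mul_comm, ← Finset.sum_neg_distrib, map_sum,
      char_sum]
  have hdiff : (Fintype.card V : ℂ) * A.card *
      (((∑ u ∈ P, cv A B (y + v + ∑ j, ((u j).1 - (u j).2)) -
        ∑ u ∈ P, cv A B (y + ∑ j, ((u j).1 - (u j).2)) : ℝ)) : ℂ) =
      ∑ φ : Module.Dual F V, (∑ b ∈ B, χ (φ b)) * (∑ a ∈ A, χ (φ a)) * Q φ ^ k *
        (χ (φ (-(y + v))) - χ (φ (-y))) := by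
    rw [Complex.ofReal_sub, mul_sub, hH, hH, ← Finset.sum_sub_distrib]
    refine Finset.sum_congr rfl fun φ _ => by ring
  have hn := congrArg norm hdiff
  rw [norm_mul, norm_mul, Complex.norm_real, Real.norm_eq_abs, Complex.norm_natCast,
    Complex.norm_natCast] at hn
  have hterm : ∀ φ : Module.Dual F V, ‖(∑ b ∈ B, χ (φ b)) * (∑ a ∈ A, χ (φ a)) * Q φ ^ k *
        (χ (φ (-(y + v))) - χ (φ (-y)))‖ ≤
      (‖∑ b ∈ B, χ (φ b)‖ ^ 2 + ‖∑ a ∈ A, χ (φ a)‖ ^ 2) * ((T.card : ℝ) ^ 2 / 4) ^ k := by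
    intro φ
    have hR : 0 ≤ (‖∑ b ∈ B, χ (φ b)‖ ^ 2 + ‖∑ a ∈ A, χ (φ a)‖ ^ 2) *
      ((T.card : ℝ) ^ 2 / 4) ^ k := by positivity
    by_cases h : (T.card : ℝ) ≤ 2 * ‖∑ t ∈ T, χ (φ t)‖
    · have h0 := hv φ h
      have : χ (φ (-(y + v))) - χ (φ (-y)) = 0 := by
        rw [neg_add, map_add, map_neg φ v, h0]; simp
      rw [this, mul_zero, norm_zero]
      exact hR
    · push Not at h
      have h1 : ‖Q φ‖ ≤ (T.card : ℝ) ^ 2 / 4 := by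
        rw [hQn]
        nlinarith [norm_nonneg (∑ t ∈ T, χ (φ t))]
      have h2 : ‖χ (φ (-(y + v))) - χ (φ (-y))‖ ≤ 2 := by
        refine (norm_sub_le _ _).trans ?_
        rw [AddChar.norm_apply, AddChar.norm_apply]; norm_num
      rw [norm_mul, norm_mul, norm_mul, norm_pow]
      have h3 : ‖Q φ‖ ^ k ≤ ((T.card : ℝ) ^ 2 / 4) ^ k := pow_le_pow_left₀ (norm_nonneg _) h1 k
      calc ‖∑ b ∈ B, χ (φ b)‖ * ‖∑ a ∈ A, χ (φ a)‖ * ‖Q φ‖ ^ k *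
            ‖χ (φ (-(y + v))) - χ (φ (-y))‖
          ≤ ‖∑ b ∈ B, χ (φ b)‖ * ‖∑ a ∈ A, χ (φ a)‖ * ((T.card : ℝ) ^ 2 / 4) ^ k * 2 := by
            gcongr
        _ = (2 * ‖∑ b ∈ B, χ (φ b)‖ * ‖∑ a ∈ A, χ (φ a)‖) * ((T.card : ℝ) ^ 2 / 4) ^ k := by ring
        _ ≤ _ := by
            gcongr
            exact two_mul_le_add_sq _ _
  have hsum := (norm_sum_le Finset.univ _).trans (Finset.sum_le_sum fun φ _ => hterm φ)
  rw [← hn, ← Finset.sum_mul, Finset.sum_add_distrib, parseval χ hχ, parseval χ hχ] at hsum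
  have hB : (B.card : ℝ) ≤ Fintype.card V := by exact_mod_cast Finset.card_le_univ B
  have hA' : (A.card : ℝ) ≤ Fintype.card V := by exact_mod_cast Finset.card_le_univ A
  have hp : 0 ≤ ((T.card : ℝ) ^ 2 / 4) ^ k := by positivity
  refine le_of_mul_le_mul_left (a := (Fintype.card V : ℝ)) ?_ hV
  rw [← mul_assoc]
  refine hsum.trans ?_
  rw [← mul_add, mul_assoc]
  refine mul_le_mul_of_nonneg_left ?_ hV.le
  calc ((B.card : ℝ) + A.card) * ((T.card : ℝ) ^ 2 / 4) ^ k
      ≤ (Fintype.card V + Fintype.card V) * ((T.card : ℝ) ^ 2 / 4) ^ k := by gcongr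
    _ = _ := by ring

lemma bogolyubov {F V : Type} [Field F] [Fintype F] [AddCommGroup V] [Module F V] [Fintype V]
    (A B : Finset V) (hA : A.Nonempty) (k : ℕ) (hk : 7 ≤ k)
    (hAk : (Fintype.card V : ℝ) ≤ 2 ^ k * A.card)
    (hAB : ∑ x ∈ A, ∑ y ∈ A, ind B (y - x) ≤ 1 / 32 * (A.card : ℝ) ^ 2) :
    ∃ W : Submodule F V, Module.finrank F V ≤ Module.finrank F W + 16 * (2 ^ 20 * k ^ 4 + 1) ∧
      ∃ x : V, ∑ w : W, ind B (x + w) ≤ 1 / 16 * (Fintype.card W : ℝ) := by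
  have hV : (0 : ℝ) < Fintype.card V := by
    have : 0 < Fintype.card V := Fintype.card_pos_iff.2 ⟨0⟩
    exact_mod_cast this
  have hAc : (0 : ℝ) < A.card := by exact_mod_cast hA.card_pos
  have hk0 : (0 : ℝ) < k := by exact_mod_cast (by omega : 0 < k)
  obtain ⟨χ, hχ⟩ := exists_char F
  obtain ⟨T, hT, hper⟩ := almost_periods A B hA k hk hAk
  have hT0 : (0 : ℝ) < T.card := by
    by_contra hh
    have : (T.card : ℝ) = 0 := le_antisymm (not_lt.1 hh) (Nat.cast_nonneg _)
    rw [this] at hT; linarith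
  let Δ : Set (Module.Dual F V) := {φ | (T.card : ℝ) ≤ 2 * ‖∑ t ∈ T, χ (φ t)‖}
  have hch := chang χ hχ T _ hT Δ (fun φ hφ => hφ)
  have hdim := Subspace.finrank_add_finrank_dualCoannihilator_eq (Submodule.span F Δ)
  refine ⟨(Submodule.span F Δ).dualCoannihilator, by omega, ?_⟩
  set W := (Submodule.span F Δ).dualCoannihilator with hW
  have hWv : ∀ v ∈ W, ∀ φ : Module.Dual F V,
      (T.card : ℝ) ≤ 2 * ‖∑ t ∈ T, χ (φ t)‖ → φ v = 0 := by
    intro v hv φ hφ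
    exact (Submodule.mem_dualCoannihilator _).1 hv φ (Submodule.subset_span hφ)
  set P := Fintype.piFinset (fun _ : Fin k => T ×ˢ T) with hP
  have hPc : (P.card : ℝ) = ((T.card : ℝ) ^ 2) ^ k := by
    rw [hP, Fintype.card_piFinset]
    simp [sq]
  have hP0 : (0 : ℝ) < P.card := by rw [hPc]; positivity
  let H : V → ℝ := fun y => ∑ u ∈ P, cv A B (y + ∑ j, ((u j).1 - (u j).2))
  -- a good point
  obtain ⟨y0, hy0, hy0H⟩ : ∃ y ∈ A, H y ≤ 3 / 64 * P.card := by
    by_contra hcon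
    push Not at hcon
    have h1 : ∑ y ∈ A, 3 / 64 * (P.card : ℝ) < ∑ y ∈ A, H y :=
      Finset.sum_lt_sum_of_nonempty hA hcon
    have h2 : ∑ y ∈ A, H y ≤ ∑ u ∈ P, (3 / 64 * (A.card : ℝ)) := by
      rw [Finset.sum_comm]
      refine Finset.sum_le_sum fun u hu => ?_
      have hu' := Fintype.mem_piFinset.1 hu
      have h3 := period_sum A (cv A B) (A.card / (64 * k)) Finset.univ
        (fun j => (u j).1 - (u j).2) (fun j _ w => hper _ (Finset.mem_product.1 (hu' j)).1 _
          (Finset.mem_product.1 (hu' j)).2 w) 0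
      simp only [add_zero, Finset.card_univ, Fintype.card_fin] at h3
      have e3 : (k : ℝ) * (A.card / (64 * k)) = A.card / 64 := by field_simp
      rw [e3] at h3
      have h4 : ∑ y ∈ A, cv A B y ≤ 1 / 32 * A.card := by
        have : ∑ y ∈ A, cv A B y = (∑ x ∈ A, ∑ y ∈ A, ind B (y - x)) / A.card := by
          unfold cv
          rw [← Finset.sum_div, Finset.sum_comm]
        rw [this, div_le_iff₀ hAc]
        linarith
      have h5 : ∑ y ∈ A, cv A B (y + ∑ j, ((u j).1 - (u j).2)) ≤
          ∑ y ∈ A, (|cv A B (y + ∑ j, ((u j).1 - (u j).2)) - cv A B y| + cv A B y) := by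
        refine Finset.sum_le_sum fun y _ => ?_
        linarith [le_abs_self (cv A B (y + ∑ j, ((u j).1 - (u j).2)) - cv A B y)]
      rw [Finset.sum_add_distrib] at h5
      linarith
    rw [Finset.sum_const, nsmul_eq_mul] at h1 h2
    linarith
  have hinv : ∀ v ∈ W, H (y0 + v) ≤ 1 / 16 * P.card := by
    intro v hv
    have h1 := smooth_inv χ hχ A B T hA k v (hWv v hv) y0
    have h2 : (A.card : ℝ) * |H (y0 + v) - H y0| ≤ A.card * (P.card / 64) := by
      refine h1.trans ?_
      have h3 : (2 : ℝ) ^ k * (1 / 4) ^ k ≤ 1 / 128 := by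
        rw [← mul_pow]
        calc ((2 : ℝ) * (1 / 4)) ^ k ≤ ((2 : ℝ) * (1 / 4)) ^ 7 :=
              pow_le_pow_of_le_one (by norm_num) (by norm_num) hk
          _ = _ := by norm_num
      have h4 : ((T.card : ℝ) ^ 2 / 4) ^ k = P.card * (1 / 4) ^ k := by
        rw [hPc, ← mul_pow]; congr 1; ring
      rw [h4]
      calc 2 * (P.card * (1 / 4 : ℝ) ^ k) * Fintype.card V
          ≤ 2 * (P.card * (1 / 4 : ℝ) ^ k) * (2 ^ k * A.card) := by gcongr
        _ = 2 * P.card * A.card * (2 ^ k * (1 / 4) ^ k) := by ring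
        _ ≤ 2 * P.card * A.card * (1 / 128) := by gcongr
        _ = _ := by ring
    have h5 := le_of_mul_le_mul_left h2 hAc
    linarith [le_abs_self (H (y0 + v) - H y0)]
  by_contra hcon
  push Not at hcon
  have hs1 : ∑ v : W, H (y0 + v) ≤ Fintype.card W * (1 / 16 * P.card) := by
    refine (Finset.sum_le_sum fun (v : W) _ => hinv v.1 v.2).trans ?_
    simp
  have hs2 : ∑ v : W, H (y0 + v) =
      ∑ u ∈ P, (∑ a ∈ A, ∑ v : W, ind B ((y0 + ∑ j, ((u j).1 - (u j).2) - a) + v)) / A.card := by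
    rw [Finset.sum_comm]
    refine Finset.sum_congr rfl fun u _ => ?_
    rw [Finset.sum_comm, Finset.sum_div]
    refine Finset.sum_congr rfl fun v _ => ?_
    unfold cv
    congr 1
    refine Finset.sum_congr rfl fun a _ => ?_
    congr 1
    abel
  have hPne : P.Nonempty := by
    rw [← Finset.card_pos]; exact_mod_cast hP0
  have hs3 : ∑ u ∈ P, (1 / 16 * (Fintype.card W : ℝ)) < ∑ v : W, H (y0 + v) := by
    rw [hs2]
    refine Finset.sum_lt_sum_of_nonempty hPne fun u _ => ?_
    rw [lt_div_iff₀ hAc]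
    calc 1 / 16 * (Fintype.card W : ℝ) * A.card = ∑ a ∈ A, 1 / 16 * (Fintype.card W : ℝ) := by
          rw [Finset.sum_const, nsmul_eq_mul]; ring
      _ < _ := Finset.sum_lt_sum_of_nonempty hA fun a _ => hcon _
  rw [Finset.sum_const, nsmul_eq_mul] at hs3
  linarith

lemma sum_le_max {V ι : Type} [Fintype V] (A : Finset V) (f : V → ℝ)
    (M : ℝ) (h : ∀ z, f z ≤ M) : ∑ z, ind A z * f z ≤ A.card * M := by
  rw [← sum_ind, Finset.sum_mul]
  exact Finset.sum_le_sum fun z _ => mul_le_mul_of_nonneg_left (h z) (ind_nonneg _ _)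

lemma increment {F V : Type} [Field F] [Fintype F] [AddCommGroup V] [Module F V] [Fintype V]
    (A S : Finset V) (L : ℝ) (hL : 3 / 5 ≤ L)
    (hA : (Fintype.card V : ℝ) ≤ Real.exp L * A.card)
    (hS : (Fintype.card V : ℝ) ≤ Real.exp L * S.card)
    (hfew : ∑ s ∈ S, corr A s ≤ 1 / 2 * ((A.card : ℝ) ^ 2 / Fintype.card V) * S.card) :
    ∃ W : Submodule F V,
      (Module.finrank F V : ℝ) ≤ Module.finrank F W + 2 ^ 25 * 234 ^ 4 * L ^ 8 ∧
      ∃ x, 21 / 20 * ((A.card : ℝ) / Fintype.card V) * Nat.card W ≤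
        ∑ w : W, ind A (x + w) := by
  have hV : (0 : ℝ) < Fintype.card V := by
    have : 0 < Fintype.card V := Fintype.card_pos_iff.2 ⟨0⟩
    exact_mod_cast this
  have hApos : (0 : ℝ) < A.card := by
    by_contra h
    have : (A.card : ℝ) = 0 := le_antisymm (not_lt.1 h) (Nat.cast_nonneg _)
    rw [this] at hA
    linarith
  have hAne : A.Nonempty := Finset.card_pos.1 (by exact_mod_cast hApos)
  obtain ⟨m, hm1, hm2⟩ : ∃ m : ℕ, 50 * L ≤ m ∧ (m : ℝ) ≤ 50 * L + 1 :=
    ⟨⌈50 * L⌉₊, Nat.le_ceil _, (Nat.ceil_lt_add_one (by linarith)).le⟩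
  have hpL : 99 * Real.exp L < (10 / 9 : ℝ) ^ (2 * m) := by
    have h1 : Real.exp (1 / 10) ≤ 10 / 9 := by
      rw [← Real.le_log_iff_exp_le (by norm_num)]
      have := Real.one_sub_inv_le_log_of_pos (show (0 : ℝ) < 10 / 9 by norm_num)
      norm_num at this ⊢
      linarith
    have h2 : Real.exp (1 / 10) ^ (2 * m) ≤ (10 / 9 : ℝ) ^ (2 * m) :=
      pow_le_pow_left₀ (Real.exp_pos _).le h1 _
    rw [← Real.exp_nat_mul] at h2
    have h3 : Real.exp (5 + L) ≤ Real.exp (((2 * m : ℕ) : ℝ) * (1 / 10)) := by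
      apply Real.exp_le_exp.2
      push_cast
      linarith
    have h4 : (99 : ℝ) < Real.exp 5 := by
      have h5 : Real.exp 5 = Real.exp 1 ^ 5 := by
        rw [← Real.exp_nat_mul]; norm_num
      have h6 : (2.7 : ℝ) ^ 5 ≤ Real.exp 1 ^ 5 :=
        pow_le_pow_left₀ (by norm_num) (by have := Real.exp_one_gt_d9; linarith) _
      rw [h5]
      norm_num at h6 ⊢
      linarith
    rw [Real.exp_add] at h3
    have := mul_lt_mul_of_pos_right h4 (Real.exp_pos L)
    linarith
  obtain ⟨A', hA'1, hA'2⟩ := sift A S (2 * m) L (even_two_mul m) hpL hAne hS hfew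
  obtain ⟨l, hl1, hl2⟩ : ∃ l : ℕ, L * (2 * m) ≤ l ∧ (l : ℝ) ≤ L * (2 * m) + 1 :=
    ⟨⌈L * (2 * m)⌉₊, Nat.le_ceil _, (Nat.ceil_lt_add_one (by positivity)).le⟩
  have hdens : Real.exp (-L) ≤ (A.card : ℝ) / Fintype.card V := by
    rw [le_div_iff₀ hV, Real.exp_neg, inv_mul_le_iff₀ (Real.exp_pos _)]
    exact hA
  have hA'3 : Real.exp (-(L * (2 * m))) * Fintype.card V ≤ A'.card := by
    refine le_trans (mul_le_mul_of_nonneg_right ?_ hV.le) hA'1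
    have := pow_le_pow_left₀ (Real.exp_pos _).le hdens (2 * m)
    rw [← Real.exp_nat_mul] at this
    refine le_trans (le_of_eq ?_) this
    congr 1
    push_cast
    ring
  have hA'ne : A'.Nonempty := by
    rw [← Finset.card_pos]
    have : (0 : ℝ) < A'.card := lt_of_lt_of_le (mul_pos (Real.exp_pos _) hV) hA'3
    exact_mod_cast this
  have hk : (Fintype.card V : ℝ) ≤ 2 ^ (2 * l + 7) * A'.card := by
    have h1 : Real.exp (L * (2 * m)) ≤ 2 ^ (2 * l + 7) := by
      have h2 : Real.exp (L * (2 * m)) ≤ Real.exp 1 ^ l := by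
        rw [← Real.exp_nat_mul]
        apply Real.exp_le_exp.2
        linarith
      have h3 : Real.exp 1 ^ l ≤ 4 ^ l :=
        pow_le_pow_left₀ (Real.exp_pos _).le (by have := Real.exp_one_lt_d9; linarith) _
      have h4 : (2 : ℝ) ^ (2 * l + 7) = 4 ^ l * 128 := by
        rw [pow_add, pow_mul]; norm_num
      have h5 : (0 : ℝ) < 4 ^ l := by positivity
      rw [h4]
      linarith
    rw [Real.exp_neg, inv_mul_le_iff₀ (Real.exp_pos _)] at hA'3
    exact hA'3.trans (mul_le_mul_of_nonneg_right h1 (Nat.cast_nonneg _))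
  obtain ⟨W, hW, x, hx⟩ := bogolyubov (F := F) A' _ hA'ne (2 * l + 7) (by omega) hk hA'2
  set μ : ℝ := (A.card : ℝ) ^ 2 / Fintype.card V with hμ
  have hμpos : 0 < μ := by positivity
  refine ⟨W, ?_, ?_⟩
  · have h1 : (Module.finrank F V : ℝ) ≤
        Module.finrank F W + 16 * (2 ^ 20 * (2 * l + 7) ^ 4 + 1) := by exact_mod_cast hW
    have h2 : (2 * l + 7 : ℝ) ≤ 234 * L ^ 2 := by nlinarith
    have h3 : (2 * l + 7 : ℝ) ^ 4 ≤ (234 * L ^ 2) ^ 4 :=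
      pow_le_pow_left₀ (by positivity) h2 _
    have h4 : (1 : ℝ) ≤ (2 * l + 7 : ℝ) ^ 4 := by
      apply one_le_pow₀
      have : (0 : ℝ) ≤ l := Nat.cast_nonneg _
      linarith
    have h5 : (234 * L ^ 2) ^ 4 = 234 ^ 4 * L ^ 8 := by ring
    rw [h5] at h3
    nlinarith
  · have hW0 : (0 : ℝ) < Fintype.card W := by
      have : 0 < Fintype.card W := Fintype.card_pos_iff.2 ⟨0⟩
      exact_mod_cast this
    have hlow : 135 / 128 * μ * Fintype.card W ≤ ∑ w : W, corr A (x + w) := by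
      have h1 : ∀ w : W, 9 / 8 * μ * (1 - ind (Finset.univ.filter fun x => corr A x <
          9 / 8 * μ) (x + w)) ≤ corr A (x + w) := by
        intro w
        by_cases h : corr A (x + w) < 9 / 8 * μ
        · have : ind (Finset.univ.filter fun x => corr A x < 9 / 8 * μ) (x + w) = 1 := by
            simp [ind, h]
          rw [this]
          simpa using corr_nonneg A (x + w)
        · have : ind (Finset.univ.filter fun x => corr A x < 9 / 8 * μ) (x + w) = 0 := by
            simp only [ind, Finset.mem_filter, Finset.mem_univ, true_and, if_neg h]
          rw [this]
          linarith
      have h2 := Finset.sum_le_sum fun w (_ : w ∈ (Finset.univ : Finset W)) => h1 w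
      rw [← Finset.mul_sum, Finset.sum_sub_distrib] at h2
      simp only [Finset.sum_const, Finset.card_univ, nsmul_eq_mul, mul_one] at h2
      refine le_trans ?_ h2
      have h3 : 15 / 16 * (Fintype.card W : ℝ) ≤ Fintype.card W - ∑ w : W,
        ind (Finset.univ.filter fun x => corr A x < 9 / 8 * μ) (x + w) := by linarith
      have := mul_le_mul_of_nonneg_left h3 (show 0 ≤ 9 / 8 * μ by positivity)
      linarith
    by_contra hcon
    push Not at hcon
    have hsw : ∑ w : W, corr A (x + w) = ∑ z, ind A z * ∑ w : W, ind A (z + x + w) := by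
      unfold corr
      rw [Finset.sum_comm]
      refine Finset.sum_congr rfl fun z _ => ?_
      rw [Finset.mul_sum]
      refine Finset.sum_congr rfl fun w _ => ?_
      rw [add_assoc]
    have hup := sum_le_max (ι := V) A (fun z => ∑ w : W, ind A (z + x + w)) _
      (fun z => (hcon (z + x)).le)
    rw [← hsw] at hup
    have e : (A.card : ℝ) * (21 / 20 * ((A.card : ℝ) / Fintype.card V) * Nat.card W) =
      21 / 20 * μ * Fintype.card W := by
      rw [hμ, Nat.card_eq_fintype_card]; ring
    rw [e] at hup
    have : 0 < μ * Fintype.card W := mul_pos hμpos hW0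
    linarith

noncomputable def cnt {F G : Type} [Field F] [AddCommGroup G] [Module F G] [Fintype G]
    (B : Finset G) (V : Submodule F G) (x : G) : ℝ := ∑ v : V, ind B (x + v)

lemma cnt_le {F G : Type} [Field F] [AddCommGroup G] [Module F G] [Fintype G]
    (B : Finset G) (V : Submodule F G) (x : G) : cnt B V x ≤ Nat.card V := by
  unfold cnt
  refine (Finset.sum_le_sum fun (v : V) _ => ind_le_one B (x + v)).trans ?_
  simp

lemma exists_dens {F G : Type} [Field F] [AddCommGroup G] [Module F G] [Fintype G]
    (B : Finset G) : ∃ D : Submodule F G → ℝ,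
      (∀ V x, cnt B V x ≤ D V * Nat.card V) ∧ ∀ V, ∃ x, cnt B V x = D V * Nat.card V := by
  have h : ∀ V : Submodule F G, ∃ x0, ∀ x, cnt B V x ≤ cnt B V x0 := fun V =>
    Finite.exists_max (cnt B V)
  choose x0 hx0 using h
  have hc : ∀ V : Submodule F G, (Nat.card V : ℝ) ≠ 0 := fun V => by
    exact_mod_cast Nat.card_pos.ne'
  refine ⟨fun V => cnt B V (x0 V) / Nat.card V, fun V x => ?_, fun V => ⟨x0 V, ?_⟩⟩
  · rw [div_mul_cancel₀ _ (hc V)]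
    exact hx0 V x
  · rw [div_mul_cancel₀ _ (hc V)]

lemma cnt_avg {F G : Type} [Field F] [AddCommGroup G] [Module F G] [Fintype G]
    (B : Finset G) (V V' : Submodule F G) (h : V' ≤ V) (x : G) (M : ℝ)
    (hM : ∀ y, cnt B V' y ≤ M) : cnt B V x * Nat.card V' ≤ Nat.card V * M := by
  have h1 : cnt B V x * Nat.card V' = ∑ v : V, cnt B V' (x + v) := by
    unfold cnt
    rw [Finset.sum_comm]
    have : ∀ w : V', ∑ v : V, ind B (x + v + w) = ∑ v : V, ind B (x + v) := by
      intro w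
      have := Equiv.sum_comp (Equiv.addRight (⟨w, h w.2⟩ : V)) (fun v : V => ind B (x + v))
      rw [← this]
      refine Finset.sum_congr rfl fun v _ => ?_
      simp [add_assoc]
    simp_rw [this]
    simp [mul_comm]
  rw [h1]
  refine (Finset.sum_le_sum fun (v : V) _ => hM (x + v)).trans ?_
  simp

lemma dens_mono {F G : Type} [Field F] [AddCommGroup G] [Module F G] [Fintype G]
    (B : Finset G) (D : Submodule F G → ℝ)
    (h1 : ∀ V x, cnt B V x ≤ D V * Nat.card V) (h2 : ∀ V, ∃ x, cnt B V x = D V * Nat.card V)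
    (V V' : Submodule F G) (h : V' ≤ V) : D V ≤ D V' := by
  obtain ⟨x, hx⟩ := h2 V
  have := cnt_avg B V V' h x _ (h1 V')
  rw [hx] at this
  have c1 : (0 : ℝ) < Nat.card V := by exact_mod_cast Nat.card_pos
  have c2 : (0 : ℝ) < Nat.card V' := by exact_mod_cast Nat.card_pos
  have c3 := mul_pos c1 c2
  have h4 : D V * (Nat.card V * Nat.card V') ≤ D V' * (Nat.card V * Nat.card V') := by linarith
  exact le_of_mul_le_mul_right h4 c3

lemma pigeon {F G : Type} [Field F] [AddCommGroup G] [Module F G] [Fintype G]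
    (r : ℕ) (hr : 0 < r) (A : Fin r → Finset G) (hA : ∀ x, ∃ i, x ∈ A i) (V : Submodule F G) :
    ∃ i, (Nat.card V : ℝ) ≤ r * cnt (A i) V 0 := by
  by_contra hcon
  push Not at hcon
  have h1 : (Nat.card V : ℝ) ≤ ∑ i, cnt (A i) V 0 := by
    unfold cnt
    rw [Finset.sum_comm]
    have : ∀ v : V, (1 : ℝ) ≤ ∑ i, ind (A i) (0 + v) := by
      intro v
      obtain ⟨i, hi⟩ := hA v
      have h3 := Finset.single_le_sum (f := fun i => ind (A i) (0 + (v : G)))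
        (fun i _ => ind_nonneg _ _) (Finset.mem_univ i)
      refine le_trans ?_ h3
      simp [ind, hi]
    have h4 := Finset.sum_le_sum fun v (_ : v ∈ (Finset.univ : Finset V)) => this v
    simpa using h4
  have : Nonempty (Fin r) := ⟨⟨0, hr⟩⟩
  have h2 : ∑ i : Fin r, (r : ℝ) * cnt (A i) V 0 < ∑ i : Fin r, (Nat.card V : ℝ) :=
    Finset.sum_lt_sum_of_nonempty Finset.univ_nonempty fun i _ => hcon i
  rw [← Finset.mul_sum] at h2
  simp only [Finset.sum_const, Finset.card_univ, Fintype.card_fin, nsmul_eq_mul] at h2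
  have hr' : (0 : ℝ) < r := by exact_mod_cast hr
  have := mul_le_mul_of_nonneg_left h1 hr'.le
  linarith

lemma sub_card {F G : Type} [Field F] [AddCommGroup G] [Module F G] [Fintype G]
    (B : Finset G) (V : Submodule F G) (x : G) :
    ((Finset.filter (fun v : V => x + (v : G) ∈ B) Finset.univ).card : ℝ) = cnt B V x := by
  unfold cnt
  rw [← sum_ind]
  refine Finset.sum_congr rfl fun v _ => ?_
  simp [ind]

lemma scale_card {F G : Type} [Field F] [AddCommGroup G] [Module F G] [Fintype G]
    (B : Finset G) (V : Submodule F G) (c : F) (hc : c ≠ 0) :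
    ((Finset.filter (fun v : V => c • (v : G) ∈ B) Finset.univ).card : ℝ) = cnt B V 0 := by
  unfold cnt
  rw [← sum_ind]
  rw [← Equiv.sum_comp (LinearEquiv.smulOfNeZero F V c hc).toEquiv (fun v : V => ind B (0 + v))]
  refine Finset.sum_congr rfl fun v _ => ?_
  simp [ind]

lemma increment_sub {F G : Type} [Field F] [Fintype F] [AddCommGroup G] [Module F G] [Fintype G]
    (B : Finset G) (V : Submodule F G) (x0 : G) (W : Submodule F V) (x : V) :
    ∑ w : W, ind (Finset.filter (fun v : V => x0 + (v : G) ∈ B) Finset.univ) (x + w) =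
      cnt B (W.map V.subtype) (x0 + x) := by
  unfold cnt
  rw [← Equiv.sum_comp (Submodule.equivMapOfInjective V.subtype V.injective_subtype W).toEquiv]
  refine Finset.sum_congr rfl fun w _ => ?_
  simp [ind, add_assoc]

lemma core {F G : Type} [Field F] [Fintype F] [AddCommGroup G] [Module F G] [Fintype G]
    (r : ℕ) (hr : 0 < r) (A : Fin r → Finset G) (hA : ∀ x, ∃ i, x ∈ A i) (c : F) (hc : c ≠ 0) :
    ∃ V : Submodule F G, ∃ i, ∃ x0 : G,
      (Module.finrank F G : ℝ) ≤ Module.finrank F V +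
        r * Real.log r * (2 * (2 ^ 25 * 234 ^ 4 * Real.log (2 * r) ^ 8) / Real.log (21 / 20)) ∧
      1 / 2 * (1 / r : ℝ) ^ 3 * (Nat.card V : ℝ) ^ 2 ≤
        ∑ s ∈ Finset.filter (fun v : V => c • (v : G) ∈ A i) Finset.univ,
          corr (Finset.filter (fun v : V => x0 + (v : G) ∈ A i) Finset.univ) s := by
  have hr1 : (1 : ℝ) ≤ r := by exact_mod_cast hr
  have hr0 : (0 : ℝ) < r := by linarith
  have hL : 3 / 5 ≤ Real.log (2 * r) := by
    have h1 : Real.log 2 ≤ Real.log (2 * r) := Real.log_le_log (by norm_num) (by linarith)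
    have := Real.log_two_gt_d9
    linarith
  have hexp : Real.exp (Real.log (2 * r)) = 2 * r := Real.exp_log (by linarith)
  have hlr : 0 ≤ Real.log r := Real.log_nonneg hr1
  obtain ⟨L, hLd⟩ : ∃ L, L = Real.log (2 * r) := ⟨_, rfl⟩
  rw [← hLd] at hL hexp ⊢
  have hL8 : 0 < L ^ 8 := pow_pos (by linarith) _
  obtain ⟨K, hK⟩ : ∃ K : ℝ, K = 2 ^ 25 * 234 ^ 4 * L ^ 8 := ⟨_, rfl⟩
  rw [← hK]
  have hK0 : 0 < K := by rw [hK]; positivity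
  have hlog : 0 < Real.log (21 / 20) := Real.log_pos (by norm_num)
  obtain ⟨κ, hκ⟩ : ∃ κ : ℝ, κ = Real.log (21 / 20) / (2 * K) := ⟨_, rfl⟩
  have hκ0 : 0 < κ := by rw [hκ]; positivity
  have hκK : κ * K = Real.log (21 / 20) / 2 := by rw [hκ]; field_simp
  have hD : ∀ i, ∃ D : Submodule F G → ℝ, (∀ V x, cnt (A i) V x ≤ D V * Nat.card V) ∧
    ∀ V, ∃ x, cnt (A i) V x = D V * Nat.card V := fun i => exists_dens (A i)
  choose D hD1 hD2 using hD
  have hcard : ∀ V : Submodule F G, (0 : ℝ) < Nat.card V := fun V => by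
    exact_mod_cast Nat.card_pos
  have hDle : ∀ i V, D i V ≤ 1 := by
    intro i V
    obtain ⟨x, hx⟩ := hD2 i V
    have := cnt_le (A i) V x
    rw [hx] at this
    nlinarith [hcard V]
  have hinv : (0 : ℝ) < 1 / r := by positivity
  have hinv1 : (1 : ℝ) / r ≤ 1 := by rw [div_le_one hr0]; exact hr1
  have : Finite (Submodule F G) := inferInstance
  obtain ⟨V, hV⟩ := Finite.exists_max (fun V : Submodule F G =>
    ∑ i, Real.log (max (D i V) (1 / r)) + κ * Module.finrank F V)
  have hmaxpos : ∀ i V, 0 < max (D i V) (1 / r) := fun i V => lt_max_of_lt_right hinv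
  obtain ⟨i, hi⟩ := pigeon r hr A hA V
  obtain ⟨x0, hx0⟩ := hD2 i V
  have hDi : 1 / (r : ℝ) ≤ D i V := by
    have h1 := hD1 i V 0
    rw [div_le_iff₀ hr0]
    have h2 := mul_le_mul_of_nonneg_left h1 hr0.le
    have h3 : 1 * (Nat.card V : ℝ) ≤ (D i V * r) * Nat.card V := by linarith
    exact le_of_mul_le_mul_right h3 (hcard V)
  refine ⟨V, i, x0, ?_, ?_⟩
  · have h1 := hV ⊤
    have h2 : ∑ i, Real.log (max (D i V) (1 / r)) ≤ 0 :=
      Finset.sum_nonpos fun i _ => Real.log_nonpos (hmaxpos i V).le (max_le (hDle i V) hinv1)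
    have h3 : -(r * Real.log r) ≤ ∑ i, Real.log (max (D i ⊤) (1 / r)) := by
      have h4 : ∀ i, -Real.log r ≤ Real.log (max (D i ⊤) (1 / r)) := by
        intro i
        rw [← Real.log_inv, ← one_div]
        exact Real.log_le_log hinv (le_max_right _ _)
      have h5 := Finset.sum_le_sum fun i (_ : i ∈ (Finset.univ : Finset (Fin r))) => h4 i
      simpa using h5
    rw [finrank_top] at h1
    have h6 : κ * ((Module.finrank F G : ℝ) - Module.finrank F V) ≤ r * Real.log r := by linarith
    have h7 : (Module.finrank F G : ℝ) - Module.finrank F V ≤ r * Real.log r / κ := by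
      rw [le_div_iff₀ hκ0]; linarith
    have h8 : r * Real.log r / κ = r * Real.log r * (2 * K / Real.log (21 / 20)) := by
      rw [hκ]; field_simp
    linarith
  · set S0 := Finset.filter (fun v : V => c • (v : G) ∈ A i) Finset.univ with hS0
    set A0 := Finset.filter (fun v : V => x0 + (v : G) ∈ A i) Finset.univ with hA0
    have hS0c : (S0.card : ℝ) = cnt (A i) V 0 := scale_card _ _ _ hc
    have hA0c : (A0.card : ℝ) = D i V * Nat.card V := by rw [← hx0]; exact sub_card _ _ _
    have hVc : (Fintype.card V : ℝ) = Nat.card V := by rw [Nat.card_eq_fintype_card]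
    have hA0l : (Nat.card V : ℝ) ≤ r * A0.card := by
      rw [hA0c]
      rw [div_le_iff₀ hr0] at hDi
      nlinarith [hcard V]
    by_cases hfew : ∑ s ∈ S0, corr A0 s ≤
        1 / 2 * ((A0.card : ℝ) ^ 2 / Fintype.card V) * S0.card
    · exfalso
      obtain ⟨W, hW, x, hx⟩ := increment (F := F) A0 S0 L hL
        (by rw [hVc, hexp]; have := (hcard V); linarith)
        (by rw [hVc, hexp, hS0c]; have := (hcard V); linarith) hfew
      rw [← hK] at hW
      rw [hA0, increment_sub, ← hA0] at hx
      have hfr : Module.finrank F (W.map V.subtype) = Module.finrank F W :=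
        (Submodule.equivMapOfInjective V.subtype V.injective_subtype W).finrank_eq.symm
      have hcc : Nat.card (W.map V.subtype) = Nat.card W :=
        Nat.card_congr (Submodule.equivMapOfInjective V.subtype V.injective_subtype W).toEquiv.symm
      obtain ⟨V', hV'⟩ : ∃ V', V' = W.map V.subtype := ⟨_, rfl⟩
      rw [← hV'] at hx hfr hcc
      have hle : V' ≤ V := by rw [hV']; exact Submodule.map_subtype_le V W
      have hx2 := hx.trans (hD1 i V' _)
      rw [hA0c, hVc, mul_div_cancel_right₀ _ (hcard V).ne', ← hcc] at hx2
      have hinc : 21 / 20 * D i V ≤ D i V' := le_of_mul_le_mul_right hx2 (hcard V')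
      have h1 := hV V'
      rw [hfr] at h1
      have h2 : ∑ j, Real.log (max (D j V) (1 / r)) + Real.log (21 / 20) ≤
          ∑ j, Real.log (max (D j V') (1 / r)) := by
        rw [← Finset.add_sum_erase _ _ (Finset.mem_univ i),
          ← Finset.add_sum_erase (a := i) Finset.univ (fun j => Real.log (max (D j V') (1 / r)))
            (Finset.mem_univ i)]
        have h3 : ∑ j ∈ Finset.univ.erase i, Real.log (max (D j V) (1 / r)) ≤
            ∑ j ∈ Finset.univ.erase i, Real.log (max (D j V') (1 / r)) :=
          Finset.sum_le_sum fun j _ => Real.log_le_log (hmaxpos j V)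
            (max_le_max (dens_mono (A j) (D j) (hD1 j) (hD2 j) V V' hle) le_rfl)
        have hDp : 0 < D i V := lt_of_lt_of_le hinv hDi
        have h4 : Real.log (max (D i V) (1 / r)) + Real.log (21 / 20) ≤
            Real.log (max (D i V') (1 / r)) := by
          rw [max_eq_left hDi, ← Real.log_mul hDp.ne' (by norm_num)]
          exact Real.log_le_log (by linarith) (le_max_of_le_left (by linarith))
        linarith
      have h5 := mul_le_mul_of_nonneg_left hW hκ0.le
      rw [mul_add, hκK] at h5
      linarith
    · push Not at hfew
      refine le_trans ?_ hfew.le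
      rw [hVc]
      have hS1 : (Nat.card V : ℝ) / r ≤ S0.card := by
        rw [div_le_iff₀ hr0, hS0c]; linarith
      have hA1 : (Nat.card V : ℝ) / r ≤ A0.card := by
        rw [div_le_iff₀ hr0]; linarith
      have hn : 0 ≤ (Nat.card V : ℝ) / r := div_nonneg (hcard V).le hr0.le
      have hA2 : ((Nat.card V : ℝ) / r) ^ 2 ≤ (A0.card : ℝ) ^ 2 := pow_le_pow_left₀ hn hA1 2
      have hA3 : ((Nat.card V : ℝ) / r) ^ 2 / Nat.card V ≤ (A0.card : ℝ) ^ 2 / Nat.card V :=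
        div_le_div_of_nonneg_right hA2 (hcard V).le
      have hA4 := mul_le_mul hA3 hS1 hn (div_nonneg (sq_nonneg _) (hcard V).le)
      have e : ((Nat.card V : ℝ) / r) ^ 2 / Nat.card V * ((Nat.card V : ℝ) / r) =
          (1 / r : ℝ) ^ 3 * (Nat.card V : ℝ) ^ 2 := by
        have := (hcard V).ne'
        field_simp
      rw [e] at hA4
      linarith

lemma corr_count {V : Type} [AddCommGroup V] [Fintype V] (A S : Finset V) :
    ∑ s ∈ S, corr A s =
      ((Finset.filter (fun p : V × V => p.1 ∈ S ∧ p.2 ∈ A ∧ p.2 + p.1 ∈ A) Finset.univ).card : ℝ) := by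
  have h : ∑ s ∈ S, corr A s = ∑ s, ∑ z, ind S s * (ind A z * ind A (z + s)) := by
    rw [← Finset.sum_filter_add_sum_filter_not Finset.univ (· ∈ S)]
    rw [Finset.sum_eq_zero (s := Finset.filter (fun x => x ∉ S) Finset.univ), add_zero]
    · have : Finset.filter (fun x => x ∈ S) Finset.univ = S := by ext; simp
      rw [this]
      refine Finset.sum_congr rfl fun s hs => ?_
      unfold corr
      simp [ind, hs]
    · intro s hs
      simp only [Finset.mem_filter, Finset.mem_univ, true_and] at hs
      simp [ind, hs]
  rw [h, ← sum_ind, ← Fintype.sum_prod_type']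
  refine Finset.sum_congr rfl fun p _ => ?_
  by_cases h1 : p.1 ∈ S <;> by_cases h2 : p.2 ∈ A <;> by_cases h3 : p.2 + p.1 ∈ A <;>
    simp [ind, h1, h2, h3]

/-- Toy theorem: for `a, b ∈ F_q^*` and any `r`-colouring of `F_q^n` there is a colour
class with `exp(−O_q(r log⁹ 2r))·|G|²` triples `(x,y,z)` with `a·x − a·y = b·z`. -/
theorem toy_model (F : Type) [Field F] [Fintype F] : ∃ C : ℝ, 0 < C ∧
    ∀ (a b : F), a ≠ 0 → b ≠ 0 → ∀ (n r : ℕ), 0 < r →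
      ∀ 𝒞 : Fin r → Set (Fin n → F), (∀ x, ∃ i, x ∈ 𝒞 i) →
      ∃ i : Fin r,
        Real.exp (-(C * r * (Real.log (2 * r)) ^ 9)) * (Fintype.card (Fin n → F) : ℝ) ^ 2 ≤
          Nat.card {t : (Fin n → F) × (Fin n → F) × (Fin n → F) //
            t.1 ∈ 𝒞 i ∧ t.2.1 ∈ 𝒞 i ∧ t.2.2 ∈ 𝒞 i ∧
              a • t.1 - a • t.2.1 = b • t.2.2} := by
  obtain ⟨M, hM⟩ : ∃ M : ℝ, M = 2 * (2 ^ 25 * 234 ^ 4) / Real.log (21 / 20) := ⟨_, rfl⟩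
  have hlog : 0 < Real.log (21 / 20) := Real.log_pos (by norm_num)
  have hM0 : 0 < M := by rw [hM]; positivity
  have hq : (1 : ℝ) < Fintype.card F := by exact_mod_cast Fintype.one_lt_card
  obtain ⟨l, hl⟩ : ∃ l : ℝ, l = Real.log (Fintype.card F) := ⟨_, rfl⟩
  have hl0 : 0 < l := by rw [hl]; exact Real.log_pos hq
  have hel : Real.exp l = Fintype.card F := by rw [hl]; exact Real.exp_log (by linarith)
  refine ⟨180 + 2 * (l * M), by positivity, ?_⟩
  intro a b ha hb n r hr 𝒞 h𝒞
  obtain ⟨V, i, x0, hcod, hcount⟩ := core (F := F) r hr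
    (fun i => Finset.filter (fun x => x ∈ 𝒞 i) Finset.univ)
    (fun x => by simpa using h𝒞 x) (a / b) (div_ne_zero ha hb)
  refine ⟨i, ?_⟩
  have hr1 : (1 : ℝ) ≤ r := by exact_mod_cast hr
  have hr0 : (0 : ℝ) < r := by linarith
  have hL : 3 / 5 ≤ Real.log (2 * r) := by
    have h1 : Real.log 2 ≤ Real.log (2 * r) := Real.log_le_log (by norm_num) (by linarith)
    have := Real.log_two_gt_d9
    linarith
  have hexp : Real.exp (Real.log (2 * r)) = 2 * r := Real.exp_log (by linarith)
  have hlr : Real.log r ≤ Real.log (2 * r) := Real.log_le_log hr0 (by linarith)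
  obtain ⟨L, hLd⟩ : ∃ L, L = Real.log (2 * r) := ⟨_, rfl⟩
  rw [← hLd] at hL hexp hlr hcod ⊢
  have hL0 : 0 < L := by linarith
  have hcod2 : (Module.finrank F (Fin n → F) : ℝ) ≤ Module.finrank F V + M * r * L ^ 9 := by
    refine hcod.trans (add_le_add le_rfl ?_)
    have e : r * Real.log r * (2 * (2 ^ 25 * 234 ^ 4 * L ^ 8) / Real.log (21 / 20)) =
      Real.log r * (M * r * L ^ 8) := by rw [hM]; ring
    rw [e]
    have h1 : 0 ≤ M * r * L ^ 8 := by positivity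
    have := mul_le_mul_of_nonneg_right hlr h1
    refine this.trans (le_of_eq ?_)
    ring
  have hGc : (Fintype.card (Fin n → F) : ℝ) = Real.exp (l * Module.finrank F (Fin n → F)) := by
    rw [Module.card_eq_pow_finrank (K := F), mul_comm, Real.exp_nat_mul, hel]
    push_cast
    rfl
  have hVc : (Nat.card V : ℝ) = Real.exp (l * Module.finrank F V) := by
    rw [Nat.card_eq_fintype_card, Module.card_eq_pow_finrank (K := F), mul_comm,
      Real.exp_nat_mul, hel]
    push_cast
    rfl
  have hmain : Real.exp (-((180 + 2 * (l * M)) * r * L ^ 9)) *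
      (Fintype.card (Fin n → F) : ℝ) ^ 2 ≤ 1 / 2 * (1 / r : ℝ) ^ 3 * (Nat.card V : ℝ) ^ 2 := by
    have h1 : Real.exp (-(3 * L)) ≤ 1 / 2 * (1 / r : ℝ) ^ 3 := by
      have e : Real.exp (-(3 * L)) = 1 / 8 * (1 / r : ℝ) ^ 3 := by
        have : Real.exp (3 * L) = (2 * r) ^ 3 := by
          rw [← hexp, ← Real.exp_nat_mul]; norm_num
        rw [Real.exp_neg, this]
        field_simp
        norm_num
      rw [e]
      have : 0 ≤ (1 / r : ℝ) ^ 3 := by positivity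
      linarith
    have h2 : 3 * L ≤ 180 * r * L ^ 9 := by
      have h3 : (3 / 5 : ℝ) ^ 8 ≤ L ^ 8 := pow_le_pow_left₀ (by norm_num) hL 8
      have h4 : 3 ≤ 180 * L ^ 8 := by norm_num at h3 ⊢; linarith
      have h5 : 180 * L ^ 8 * 1 ≤ 180 * L ^ 8 * r :=
        mul_le_mul_of_nonneg_left hr1 (by positivity)
      have h6 := mul_le_mul_of_nonneg_right (h4.trans (by linarith : 180 * L ^ 8 ≤ 180 * L ^ 8 * r)) hL0.le
      refine h6.trans (le_of_eq ?_)
      ring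
    refine le_trans ?_ (mul_le_mul_of_nonneg_right h1 (sq_nonneg _))
    rw [hGc, hVc, ← Real.exp_nat_mul, ← Real.exp_nat_mul, ← Real.exp_add, ← Real.exp_add]
    apply Real.exp_le_exp.2
    have h7 := mul_le_mul_of_nonneg_left hcod2 hl0.le
    push_cast
    linarith
  refine (hmain.trans hcount).trans ?_
  rw [corr_count, ← Fintype.card_subtype, ← Nat.card_eq_fintype_card, Nat.cast_le]
  refine Nat.card_le_card_of_injective (fun p => ⟨(x0 + (p.1.2 : Fin n → F) + (p.1.1 : Fin n → F),
    x0 + (p.1.2 : Fin n → F), (a / b) • (p.1.1 : Fin n → F)), ?_⟩) ?_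
  · obtain ⟨⟨s, z⟩, h1, h2, h3⟩ := p
    simp only [Finset.mem_filter, Finset.mem_univ, true_and] at h1 h2 h3
    refine ⟨?_, h2, h1, ?_⟩
    · simpa [add_assoc] using h3
    · simp only
      rw [smul_smul, mul_div_cancel₀ _ hb, ← smul_sub]
      congr 1
      abel
  · rintro ⟨⟨s, z⟩, h1⟩ ⟨⟨s', z'⟩, h2⟩ h
    simp only [Subtype.mk.injEq, Prod.mk.injEq] at h
    obtain ⟨e1, e2, -⟩ := h
    have e3 : z = z' := Subtype.ext (add_left_cancel e2)
    rw [e2] at e1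
    have e4 : s = s' := Subtype.ext (add_left_cancel e1)
    subst e3 e4
    rfl
end

section
/- Let G be a finite abelian group, η, α, ε, δ ∈ (0,1], k a natural number, and B₀, B₁ ⊆ G nonempty with μ_G(B₁ + B₀) ≤ (1+η)·μ_G(B₀). Let A ⊆ B₀ with μ_{B₀}(A) = α, let μ be a positive-definite probability measure supported on B₁ − B₁, and let D ⊆ G with μ(D) = δ. If |⟨1_A ∗ 1_{−A}, 1_D⟩_{L²(μ)} − δα²μ_G(B₀)| ≥ εδα²μ_G(B₀), then ‖1_A ∗ 1_{−A}‖_{L_{2k}(μ)} ≥ ((1+ε)(δ/2)^{1/2k} − C·η·α⁻¹)·α²·μ_G(B₀) for an absolute constant C > 0. -/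
open scoped Classical Pointwise

lemma sp_fourier {G : Type} [AddCommGroup G] [Fintype G] (g : G → ℝ) (x : G) :
    ((∑ z : G, g (z + x) * g z : ℝ) : ℂ) =
      ∑ χ : AddChar G ℂ, (((Fintype.card G : ℝ)⁻¹ * ‖∑ y : G, (g y : ℂ) * χ y‖ ^ 2 : ℝ) : ℂ)
        * χ (-x) := by
  have hN : (Fintype.card G : ℂ) ≠ 0 := by
    exact_mod_cast Fintype.card_ne_zero
  have h1 : ∀ χ : AddChar G ℂ,
      (((Fintype.card G : ℝ)⁻¹ * ‖∑ y : G, (g y : ℂ) * χ y‖ ^ 2 : ℝ) : ℂ) * χ (-x)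
      = ∑ y : G, ∑ z : G, (Fintype.card G : ℂ)⁻¹ * (g y * g z) * χ (y - (z + x)) := by
    intro χ
    have h2 : ((‖∑ y : G, (g y : ℂ) * χ y‖ ^ 2 : ℝ) : ℂ)
        = (∑ y : G, (g y : ℂ) * χ y) * (∑ z : G, (g z : ℂ) * χ (-z)) := by
      push_cast
      rw [← Complex.mul_conj']
      congr 1
      simp [map_sum, AddChar.map_neg_eq_conj]
    push_cast at h2 ⊢
    rw [h2, Finset.sum_mul_sum, Finset.mul_sum, Finset.sum_mul]
    refine Finset.sum_congr rfl fun y _ => ?_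
    rw [Finset.mul_sum, Finset.sum_mul]
    refine Finset.sum_congr rfl fun z _ => ?_
    have : y - (z + x) = y + (-z + -x) := by abel
    rw [this, AddChar.map_add_eq_mul, AddChar.map_add_eq_mul]
    ring
  simp_rw [h1]
  rw [Finset.sum_comm]
  conv_rhs =>
    enter [2, y]
    rw [Finset.sum_comm]
    enter [2, z]
    rw [← Finset.mul_sum, AddChar.sum_apply_eq_ite]
  rw [Finset.sum_comm]
  push_cast
  refine Finset.sum_congr rfl fun z _ => ?_
  rw [Finset.sum_eq_single (z + x)]
  · simp
    field_simp
  · intro b _ hb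
    have : b - (z + x) ≠ 0 := sub_ne_zero.mpr hb
    simp [this]
  · simp

lemma sp_moment {G : Type} [AddCommGroup G] [Fintype G] (w : G → ℝ)
    (hw : ∀ γ : AddChar G ℂ,
        (∑ x : G, (w x : ℂ) * (starRingEnd ℂ) (γ x)).im = 0 ∧
        0 ≤ (∑ x : G, (w x : ℂ) * (starRingEnd ℂ) (γ x)).re) (g : G → ℝ) (j : ℕ) :
    0 ≤ ∑ x : G, w x * (∑ z : G, g (z + x) * g z) ^ j := by
  have key : ∀ j : ℕ, ∀ γ : AddChar G ℂ, 
      (∑ x : G, (w x : ℂ) * ((∑ z : G, g (z + x) * g z : ℝ) : ℂ) ^ j * γ (-x)).im = 0 ∧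
      0 ≤ (∑ x : G, (w x : ℂ) * ((∑ z : G, g (z + x) * g z : ℝ) : ℂ) ^ j * γ (-x)).re := by
    intro j
    induction j with
    | zero =>
      intro γ
      simpa [AddChar.map_neg_eq_conj] using hw γ
    | succ j ih =>
      intro γ
      have : ∑ x : G, (w x : ℂ) * ((∑ z : G, g (z + x) * g z : ℝ) : ℂ) ^ (j+1) * γ (-x)
        = ∑ χ : AddChar G ℂ, (((Fintype.card G : ℝ)⁻¹ * ‖∑ y : G, (g y : ℂ) * χ y‖ ^ 2 : ℝ) : ℂ)
          * ∑ x : G, (w x : ℂ) * ((∑ z : G, g (z + x) * g z : ℝ) : ℂ) ^ j * (χ * γ) (-x) := by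
        simp_rw [Finset.mul_sum]
        rw [Finset.sum_comm]
        refine Finset.sum_congr rfl fun x _ => ?_
        rw [pow_succ]
        nth_rewrite 2 [sp_fourier g x]
        rw [Finset.mul_sum, Finset.mul_sum, Finset.sum_mul]
        refine Finset.sum_congr rfl fun χ _ => ?_
        rw [AddChar.mul_apply]
        ring
      rw [this, Complex.im_sum, Complex.re_sum]
      constructor
      · refine Finset.sum_eq_zero fun χ _ => ?_
        rw [Complex.im_ofReal_mul, (ih (χ * γ)).1, mul_zero]
      · refine Finset.sum_nonneg fun χ _ => ?_
        rw [Complex.re_ofReal_mul]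
        exact mul_nonneg (by positivity) (ih (χ * γ)).2
  have h := (key j 1).2
  have h2 : (∑ x : G, (w x : ℂ) * ((∑ z : G, g (z + x) * g z : ℝ) : ℂ) ^ j
      * (1 : AddChar G ℂ) (-x)) = ((∑ x : G, w x * (∑ z : G, g (z + x) * g z) ^ j : ℝ) : ℂ) := by
    push_cast
    simp
  rw [h2, Complex.ofReal_re] at h
  exact h

lemma sp_analytic {G : Type} [Fintype G] (w u : G → ℝ) (hw : ∀ x, 0 ≤ w x)
    (hm : ∀ j : ℕ, 0 ≤ ∑ x : G, w x * u x ^ j) (D : Set G) (δ t : ℝ) (hδ : 0 < δ) (ht : 0 ≤ t)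
    (hD : (∑ x : G, if x ∈ D then w x else 0) = δ)
    (hu : δ * t ≤ ∑ x : G, |u x| * (if x ∈ D then w x else 0)) (k : ℕ) :
    δ / 2 * (1 + t) ^ (2 * k) ≤ ∑ x : G, w x * (1 + u x) ^ (2 * k) := by
  have h1 : ∑ x : G, w x * (1 - u x) ^ (2 * k) ≤ ∑ x : G, w x * (1 + u x) ^ (2 * k) := by
    rw [← sub_nonneg, ← Finset.sum_sub_distrib]
    have : ∀ x, w x * (1 + u x) ^ (2 * k) - w x * (1 - u x) ^ (2 * k)
        = ∑ j ∈ Finset.range (2 * k + 1), ((2 * k).choose j * (1 - (-1) ^ j)) * (w x * u x ^ j) := by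
      intro x
      rw [add_comm 1 (u x), show 1 - u x = -u x + 1 by ring, add_pow, add_pow, Finset.mul_sum,
        Finset.mul_sum, ← Finset.sum_sub_distrib]
      refine Finset.sum_congr rfl fun j _ => ?_
      rw [neg_pow (u x)]
      simp
      ring
    simp_rw [this]
    rw [Finset.sum_comm]
    refine Finset.sum_nonneg fun j _ => ?_
    rw [← Finset.mul_sum]
    refine mul_nonneg (mul_nonneg (by positivity) ?_) (hm j)
    rcases neg_one_pow_eq_or ℝ j with h | h <;> rw [h] <;> norm_num
  have h2 : ∑ x : G, (1 + |u x|) ^ (2 * k) * (if x ∈ D then w x else 0) ≤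
      ∑ x : G, w x * (1 - u x) ^ (2 * k) + ∑ x : G, w x * (1 + u x) ^ (2 * k) := by
    rw [← Finset.sum_add_distrib]
    refine Finset.sum_le_sum fun x _ => ?_
    have e1 : 0 ≤ (1 - u x) ^ (2 * k) := (even_two_mul k).pow_nonneg _
    have e2 : 0 ≤ (1 + u x) ^ (2 * k) := (even_two_mul k).pow_nonneg _
    have e3 : (1 + |u x|) ^ (2 * k) ≤ (1 - u x) ^ (2 * k) + (1 + u x) ^ (2 * k) := by
      rcases abs_choice (u x) with h | h <;> rw [h]
      · linarith
      · rw [← sub_eq_add_neg]; linarith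
    have := hw x
    split_ifs
    · nlinarith
    · rw [mul_zero]; positivity
  have h3 : (1 + t) ^ (2 * k) ≤
      ∑ x : G, ((if x ∈ D then w x else 0) / δ) * (1 + |u x|) ^ (2 * k) := by
    have hj : (∑ x : G, ((if x ∈ D then w x else 0) / δ) * (1 + |u x|)) ^ (2 * k) ≤ _ :=
      Real.pow_arith_mean_le_arith_mean_pow Finset.univ
        (fun x => (if x ∈ D then w x else 0) / δ) (fun x => 1 + |u x|)
        (fun x _ => by
          have := hw x
          split_ifs <;> positivity)
        (by rw [← Finset.sum_div, hD, div_self hδ.ne'])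
        (fun x _ => by positivity) (2 * k)
    refine le_trans ?_ hj
    refine pow_le_pow_left₀ (by linarith) ?_ _
    have : ∑ x : G, ((if x ∈ D then w x else 0) / δ) * (1 + |u x|)
      = (∑ x : G, (if x ∈ D then w x else 0)) / δ
        + (∑ x : G, |u x| * (if x ∈ D then w x else 0)) / δ := by
      rw [Finset.sum_div, Finset.sum_div, ← Finset.sum_add_distrib]
      refine Finset.sum_congr rfl fun x _ => ?_
      ring
    rw [this, hD, div_self hδ.ne']
    have : t ≤ (∑ x : G, |u x| * (if x ∈ D then w x else 0)) / δ := by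
      rw [le_div_iff₀ hδ]; linarith
    linarith
  have h4 : ∑ x : G, ((if x ∈ D then w x else 0) / δ) * (1 + |u x|) ^ (2 * k)
      = (∑ x : G, (1 + |u x|) ^ (2 * k) * (if x ∈ D then w x else 0)) / δ := by
    rw [Finset.sum_div]
    refine Finset.sum_congr rfl fun x _ => ?_
    ring
  rw [h4, le_div_iff₀ hδ] at h3
  linarith

lemma sp_card {G : Type} [Fintype G] (S : Set G) :
    (∑ z : G, (if z ∈ S then (1 : ℝ) else 0)) = Nat.card S := by
  rw [Finset.sum_boole, Nat.card_eq_fintype_card, Fintype.card_subtype]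

lemma sp_shift {G : Type} [AddCommGroup G] [Fintype G] (f : G → ℝ) (x : G) :
    (∑ z : G, f (z + x)) = ∑ z : G, f z :=
  Equiv.sum_comp (Equiv.addRight x) f

lemma sp_error {G : Type} [AddCommGroup G] [Fintype G] (B₀ B₁ A : Set G) (η α M : ℝ)
    (hη : 0 < η) (hα : 0 < α) (hα1 : α ≤ 1) (hM : (Nat.card B₀ : ℝ) = M)
    (hS : (Nat.card (B₁ + B₀ : Set G) : ℝ) ≤ (1 + η) * M) (hAB : A ⊆ B₀)
    (hA : (Nat.card A : ℝ) = α * M) (x : G) (hx : x ∈ B₁ - B₁) :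
    |(∑ y : G, (if x - y ∈ A then (1 : ℝ) else 0) * (if y ∈ -A then 1 else 0)) - α ^ 2 * M
      - ∑ z : G, ((if z + x ∈ A then (1 : ℝ) else 0) - α * (if z + x ∈ B₀ then (1 : ℝ) else 0))
          * ((if z ∈ A then (1 : ℝ) else 0) - α * (if z ∈ B₀ then (1 : ℝ) else 0))|
      ≤ 3 * α * η * M := by
  have hF : (∑ y : G, (if x - y ∈ A then (1 : ℝ) else 0) * (if y ∈ -A then 1 else 0))
      = ∑ z : G, (if z + x ∈ A then (1 : ℝ) else 0) * (if z ∈ A then 1 else 0) := by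
    rw [← Equiv.sum_comp (Equiv.neg G)]
    refine Finset.sum_congr rfl fun z _ => ?_
    simp [add_comm]
  set a : G → ℝ := fun z => if z ∈ A then (1 : ℝ) else 0 with ha
  set b : G → ℝ := fun z => if z ∈ B₀ then (1 : ℝ) else 0 with hb
  obtain ⟨S, hSS⟩ : ∃ S : Set G, S = B₁ + B₀ := ⟨_, rfl⟩
  rw [← hSS] at hS
  set s : G → ℝ := fun z => if z ∈ S then (1 : ℝ) else 0 with hs
  have sa : ∑ z, a z = α * M := by rw [← hA]; exact sp_card A
  have sb : ∑ z, b z = M := by rw [← hM]; exact sp_card B₀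
  have ss : ∑ z, s z = Nat.card S := sp_card S
  have a0 : ∀ z, 0 ≤ a z := fun z => by simp only [ha]; split_ifs <;> norm_num
  have b0 : ∀ z, 0 ≤ b z := fun z => by simp only [hb]; split_ifs <;> norm_num
  have b1 : ∀ z, b z ≤ 1 := fun z => by simp only [hb]; split_ifs <;> norm_num
  have ab : ∀ z, a z ≤ b z := fun z => by
    simp only [ha, hb]
    by_cases h : z ∈ A
    · simp [h, hAB h]
    · simp only [h, if_false]; split_ifs <;> norm_num
  have sax : ∑ z, a (z + x) = α * M := by rw [sp_shift, sa]
  have sbx : ∑ z, b (z + x) = M := by rw [sp_shift, sb]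
  have hQ : ∑ z, b z * (1 - b (z + x)) ≤ η * M := by
    obtain ⟨p, hp, q, hq, rfl⟩ := hx
    have : ∑ z, b z * (1 - b (z + (p - q))) ≤ ∑ z, (s (z + p) - b (z + (p - q))) := by
      refine Finset.sum_le_sum fun z _ => ?_
      simp only [hb, hs]
      by_cases h1 : z + (p - q) ∈ B₀
      · have : z + p ∈ S := hSS ▸ ⟨q, hq, _, h1, by simp; abel⟩
        simp [h1, this]
      · by_cases h2 : z ∈ B₀
        · have : z + p ∈ S := hSS ▸ ⟨p, hp, z, h2, by simp [add_comm]⟩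
          simp [h1, h2, this]
        · simp only [h1, h2, if_false]; split_ifs <;> norm_num
    rw [Finset.sum_sub_distrib, sp_shift, ss, sbx] at this
    linarith
  have eQ : ∑ z, b z * (1 - b (z + x)) = M - ∑ z, b (z + x) * b z := by
    rw [← sb, ← Finset.sum_sub_distrib]
    exact Finset.sum_congr rfl fun z _ => by ring
  have X1 : α * M - ∑ z, a (z + x) * b z ≤ M - ∑ z, b (z + x) * b z := by
    rw [← sax, ← sbx, ← Finset.sum_sub_distrib, ← Finset.sum_sub_distrib]
    refine Finset.sum_le_sum fun z _ => ?_
    nlinarith [ab (z + x), b1 z]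
  have X1' : 0 ≤ α * M - ∑ z, a (z + x) * b z := by
    rw [← sax, ← Finset.sum_sub_distrib]
    refine Finset.sum_nonneg fun z _ => ?_
    nlinarith [a0 (z + x), b1 z]
  have X2 : α * M - ∑ z, b (z + x) * a z ≤ M - ∑ z, b (z + x) * b z := by
    rw [← sa, ← sb, ← Finset.sum_sub_distrib, ← Finset.sum_sub_distrib]
    refine Finset.sum_le_sum fun z _ => ?_
    nlinarith [ab z, b1 (z + x)]
  have X2' : 0 ≤ α * M - ∑ z, b (z + x) * a z := by
    rw [← sa, ← Finset.sum_sub_distrib]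
    refine Finset.sum_nonneg fun z _ => ?_
    nlinarith [a0 z, b1 (z + x)]
  have hH : ∑ z : G, (a (z + x) - α * b (z + x)) * (a z - α * b z)
      = ∑ z, a (z + x) * a z - α * ∑ z, a (z + x) * b z - α * ∑ z, b (z + x) * a z
        + α ^ 2 * ∑ z, b (z + x) * b z := by
    simp only [Finset.mul_sum, ← Finset.sum_sub_distrib, ← Finset.sum_add_distrib]
    exact Finset.sum_congr rfl fun z _ => by ring
  rw [hF]
  change |(∑ z, a (z + x) * a z) - α ^ 2 * M
    - ∑ z : G, (a (z + x) - α * b (z + x)) * (a z - α * b z)| ≤ _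
  rw [hH]
  rw [eQ] at hQ
  generalize (∑ z, a (z + x) * a z) = P at *
  generalize (∑ z, a (z + x) * b z) = Y1 at *
  generalize (∑ z, b (z + x) * a z) = Y2 at *
  generalize (∑ z, b (z + x) * b z) = R at *
  have k0 : 0 ≤ M - R := X1'.trans X1
  have k1 : α ^ 2 * (M - R) ≤ α * (η * M) := by
    calc α ^ 2 * (M - R) ≤ α * (M - R) := mul_le_mul_of_nonneg_right (by nlinarith) k0
      _ ≤ _ := mul_le_mul_of_nonneg_left hQ hα.le
  have k2 : 0 ≤ α ^ 2 * (M - R) := by positivity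
  have k3 := mul_le_mul_of_nonneg_left (X1.trans hQ) hα.le
  have k4 := mul_le_mul_of_nonneg_left (X2.trans hQ) hα.le
  have k5 := mul_nonneg hα.le X1'
  have k6 := mul_nonneg hα.le X2'
  have k7 : 0 ≤ α * (η * M) := k2.trans k1
  rw [abs_le]
  constructor <;> nlinarith

lemma sp_mink {G : Type} [Fintype G] (w f v : G → ℝ) (hw : ∀ x, 0 ≤ w x) (hw1 : ∑ x, w x = 1)
    (c : ℝ) (hc : 0 ≤ c) (h : ∀ x, w x ≠ 0 → |v x| ≤ |f x| + c) (k : ℕ) (hk : 0 < k) :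
    (∑ x, |v x| ^ (2 * k) * w x) ^ ((1 : ℝ) / (2 * k)) ≤
      (∑ x, |f x| ^ (2 * k) * w x) ^ ((1 : ℝ) / (2 * k)) + c := by
  have hk' : (1 : ℝ) ≤ k := by exact_mod_cast hk
  have hp : (1 : ℝ) ≤ 2 * k := by linarith
  set r : ℝ := 1 / (2 * k) with hr
  have hr0 : 0 < r := by positivity
  have e : ∀ a : ℝ, 0 ≤ a → ∀ x, (a * w x ^ r) ^ (2 * k : ℝ) = a ^ (2 * k) * w x := by
    intro a ha x
    rw [Real.mul_rpow ha (Real.rpow_nonneg (hw x) _), ← Real.rpow_mul (hw x), hr,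
      one_div_mul_cancel (by positivity), Real.rpow_one]
    congr 1
    rw [← Real.rpow_natCast]
    push_cast
    rfl
  have H := Real.Lp_add_le_of_nonneg Finset.univ (f := fun x => |f x| * w x ^ r)
    (g := fun x => c * w x ^ r) hp
    (fun x _ => mul_nonneg (abs_nonneg _) (Real.rpow_nonneg (hw x) _))
    (fun x _ => mul_nonneg hc (Real.rpow_nonneg (hw x) _))
  simp only [← add_mul] at H
  simp_rw [fun x => e _ (abs_nonneg (f x)) x, fun x => e c hc x,
    fun x => e _ (add_nonneg (abs_nonneg (f x)) hc) x] at H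
  rw [← Finset.mul_sum, hw1, mul_one] at H
  have hcc : (c ^ (2 * k)) ^ (1 / (2 * k : ℝ)) = c := by
    rw [← Real.rpow_natCast, ← Real.rpow_mul hc]
    push_cast
    rw [mul_one_div_cancel (by positivity), Real.rpow_one]
  rw [hcc] at H
  refine le_trans ?_ H
  refine Real.rpow_le_rpow (Finset.sum_nonneg fun x _ => mul_nonneg (by positivity) (hw x)) ?_ hr0.le
  refine Finset.sum_le_sum fun x _ => ?_
  by_cases hx : w x = 0
  · simp [hx]
  · exact mul_le_mul_of_nonneg_right (pow_le_pow_left₀ (abs_nonneg _) (h x hx) _) (hw x)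


/-- A local version of spectral positivity (Lemma `lem.specpos`). -/
theorem spectral_positivity : ∃ C : ℝ, 0 < C ∧
    ∀ (G : Type) [AddCommGroup G] [Fintype G]
      (η α ε δ : ℝ), η ∈ Set.Ioc (0 : ℝ) 1 → α ∈ Set.Ioc (0 : ℝ) 1 →
      ε ∈ Set.Ioc (0 : ℝ) 1 → δ ∈ Set.Ioc (0 : ℝ) 1 →
      ∀ k : ℕ, 0 < k →
      ∀ (B₀ B₁ A D : Set G), B₀.Nonempty → B₁.Nonempty →
      (Nat.card (B₁ + B₀) : ℝ) / Fintype.card G ≤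
        (1 + η) * ((Nat.card B₀ : ℝ) / Fintype.card G) →
      A ⊆ B₀ → (Nat.card A : ℝ) / Nat.card B₀ = α →
      ∀ w : G → ℝ, (∀ x, 0 ≤ w x) → (∑ x : G, w x) = 1 →
      (∀ x, w x ≠ 0 → x ∈ B₁ - B₁) →
      -- `μ` is positive definite: its Fourier–Stieltjes transform is a nonnegative real
      (∀ γ : AddChar G ℂ,
        (∑ x : G, (w x : ℂ) * (starRingEnd ℂ) (γ x)).im = 0 ∧
        0 ≤ (∑ x : G, (w x : ℂ) * (starRingEnd ℂ) (γ x)).re) →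
      (∑ x : G, if x ∈ D then w x else 0) = δ →
      ε * δ * α ^ 2 * ((Nat.card B₀ : ℝ) / Fintype.card G) ≤
        |(∑ x : G, ((Fintype.card G : ℝ)⁻¹ *
            ∑ y : G, (if x - y ∈ A then (1 : ℝ) else 0) * (if y ∈ -A then 1 else 0)) *
              (if x ∈ D then w x else 0)) -
          δ * α ^ 2 * ((Nat.card B₀ : ℝ) / Fintype.card G)| →
      ((1 + ε) * (δ / 2) ^ ((1 : ℝ) / (2 * k)) - C * η * α⁻¹) * α ^ 2 *
          ((Nat.card B₀ : ℝ) / Fintype.card G) ≤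
        (∑ x : G, |(Fintype.card G : ℝ)⁻¹ *
            ∑ y : G, (if x - y ∈ A then (1 : ℝ) else 0) * (if y ∈ -A then 1 else 0)| ^ (2 * k) *
              w x) ^ ((1 : ℝ) / (2 * k)) := by
  refine ⟨6, by norm_num, ?_⟩
  intro G _ _ η α ε δ hη hα hε hδ k hk B₀ B₁ A D hB₀ hB₁ hS hAB hA w hw hw1 hsupp hpd hD hbig
  have hN : (0 : ℝ) < Fintype.card G := by exact_mod_cast Fintype.card_pos
  obtain ⟨M, hM⟩ : ∃ M : ℝ, (Nat.card B₀ : ℝ) = M := ⟨_, rfl⟩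
  have hM0 : 0 < M := by
    rw [← hM]
    have : Nonempty B₀ := hB₀.to_subtype
    exact_mod_cast Nat.card_pos
  rw [hM] at hS hA hbig ⊢
  generalize (Fintype.card G : ℝ) = N at *
  have hS' : (Nat.card (B₁ + B₀ : Set G) : ℝ) ≤ (1 + η) * M := by
    rwa [← mul_div_assoc, div_le_div_iff_of_pos_right hN] at hS
  have hA' : (Nat.card A : ℝ) = α * M := by
    rw [← hA]; field_simp
  have herr := sp_error B₀ B₁ A η α M hη.1 hα.1 hα.2 hM hS' hAB hA'
  set g : G → ℝ := fun z => (if z ∈ A then (1 : ℝ) else 0) - α * (if z ∈ B₀ then (1 : ℝ) else 0)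
    with hg
  have hmom := sp_moment w hpd g
  change ∀ x ∈ B₁ - B₁, |_ - _ - ∑ z : G, g (z + x) * g z| ≤ _ at herr
  set H : G → ℝ := fun x => ∑ z : G, g (z + x) * g z with hH
  set F : G → ℝ := fun x =>
    ∑ y : G, (if x - y ∈ A then (1 : ℝ) else 0) * (if y ∈ -A then 1 else 0) with hF
  change ∀ x ∈ B₁ - B₁, |F x - _ - H x| ≤ _ at herr
  change ∀ j, 0 ≤ ∑ x, w x * H x ^ j at hmom
  change _ ≤ |(∑ x, (N⁻¹ * F x) * (if x ∈ D then w x else 0)) - _| at hbig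
  change _ ≤ (∑ x, |N⁻¹ * F x| ^ (2 * k) * w x) ^ ((1 : ℝ) / (2 * k))
  clear_value H F
  clear hg hH hF
  obtain ⟨hη0, hη1⟩ := hη
  obtain ⟨hα0, hα1⟩ := hα
  obtain ⟨hε0, hε1⟩ := hε
  obtain ⟨hδ0, hδ1⟩ := hδ
  set m : ℝ := α ^ 2 * (M / N) with hm
  have hm0 : 0 < m := by positivity
  set e : ℝ := 3 * η * α⁻¹ with he
  have he0 : 0 < e := by positivity
  set u : G → ℝ := fun x => (m * N)⁻¹ * H x with hu
  have hmu : ∀ x, m * u x = N⁻¹ * H x := by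
    intro x
    simp only [hu]
    field_simp
  have herr' : ∀ x, w x ≠ 0 → |N⁻¹ * F x - m - m * u x| ≤ m * e := by
    intro x hx
    have h := herr x (hsupp x hx)
    rw [hmu, show N⁻¹ * F x - m - N⁻¹ * H x = N⁻¹ * (F x - α ^ 2 * M - H x) by rw [hm]; ring,
      abs_mul, abs_of_pos (inv_pos.mpr hN)]
    refine (mul_le_mul_of_nonneg_left h (inv_pos.mpr hN).le).trans (le_of_eq ?_)
    rw [hm, he]
    field_simp
  have hmomu : ∀ j : ℕ, 0 ≤ ∑ x : G, w x * u x ^ j := by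
    intro j
    have : ∑ x : G, w x * u x ^ j = ((m * N)⁻¹) ^ j * ∑ x, w x * H x ^ j := by
      rw [Finset.mul_sum]
      refine Finset.sum_congr rfl fun x _ => ?_
      simp only [hu]
      ring
    rw [this]
    exact mul_nonneg (by positivity) (hmom j)
  have hd0 : ∀ x, 0 ≤ (if x ∈ D then w x else 0) := by
    intro x
    have := hw x
    split_ifs <;> simp [this]
  have hU0 : 0 ≤ ∑ x : G, |u x| * (if x ∈ D then w x else 0) :=
    Finset.sum_nonneg fun x _ => mul_nonneg (abs_nonneg _) (hd0 x)
  have hU : δ * (ε - e) ≤ ∑ x : G, |u x| * (if x ∈ D then w x else 0) := by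
    have h1 : (∑ x, (N⁻¹ * F x) * (if x ∈ D then w x else 0)) - δ * α ^ 2 * (M / N)
        = ∑ x, (N⁻¹ * F x - m) * (if x ∈ D then w x else 0) := by
      simp_rw [sub_mul]
      rw [Finset.sum_sub_distrib, ← Finset.mul_sum, hD, hm]
      ring
    rw [h1] at hbig
    have h2 := hbig.trans (Finset.abs_sum_le_sum_abs _ _)
    have h3 : ∑ x, |(N⁻¹ * F x - m) * (if x ∈ D then w x else 0)|
        ≤ ∑ x, m * (|u x| * (if x ∈ D then w x else 0) + e * (if x ∈ D then w x else 0)) := by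
      refine Finset.sum_le_sum fun x _ => ?_
      rw [abs_mul, abs_of_nonneg (hd0 x)]
      by_cases hx : w x = 0
      · simp [hx]
      · have h4 := herr' x hx
        have h5 : |N⁻¹ * F x - m| ≤ m * |u x| + m * e := by
          have h6 := abs_add_le (m * u x) (N⁻¹ * F x - m - m * u x)
          rw [abs_mul, abs_of_pos hm0] at h6
          have h7 : m * u x + (N⁻¹ * F x - m - m * u x) = N⁻¹ * F x - m := by ring
          rw [h7] at h6
          linarith
        calc _ ≤ (m * |u x| + m * e) * (if x ∈ D then w x else 0) :=
              mul_le_mul_of_nonneg_right h5 (hd0 x)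
          _ = _ := by ring
    have h8 := h2.trans h3
    rw [← Finset.mul_sum, Finset.sum_add_distrib, ← Finset.mul_sum, hD] at h8
    have h9 : ε * δ * α ^ 2 * (M / N) = m * (ε * δ) := by rw [hm]; ring
    rw [h9] at h8
    have := le_of_mul_le_mul_left h8 hm0
    linarith
  have hUt : δ * max (ε - e) 0 ≤ ∑ x : G, |u x| * (if x ∈ D then w x else 0) := by
    rcases max_choice (ε - e) 0 with h | h <;> rw [h]
    · exact hU
    · simpa using hU0
  have han := sp_analytic w u hw hmomu D δ _ hδ0 (le_max_right _ _) hD hUt k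
  have hmk := sp_mink w (fun x => N⁻¹ * F x) (fun x => m * (1 + u x)) hw hw1 (m * e)
    (by positivity) (fun x hx => by
      have h4 := herr' x hx
      have h6 := abs_sub (N⁻¹ * F x) (N⁻¹ * F x - m - m * u x)
      have h7 : N⁻¹ * F x - (N⁻¹ * F x - m - m * u x) = m * (1 + u x) := by ring
      rw [h7] at h6
      linarith) k hk
  set t := max (ε - e) 0 with ht
  have ht0 : 0 ≤ t := le_max_right _ _
  have ht1 : ε - e ≤ t := le_max_left _ _
  have hkk : (0 : ℝ) < k := by exact_mod_cast hk
  have hr0 : (0 : ℝ) < 1 / (2 * k) := by positivity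
  have hroot : ∀ a : ℝ, 0 ≤ a → (a ^ (2 * k)) ^ ((1 : ℝ) / (2 * k)) = a := by
    intro a ha
    rw [← Real.rpow_natCast, ← Real.rpow_mul ha]
    push_cast
    rw [mul_one_div_cancel (by positivity), Real.rpow_one]
  have hlow : m * ((δ / 2) ^ ((1 : ℝ) / (2 * k)) * (1 + t)) ≤
      (∑ x, |m * (1 + u x)| ^ (2 * k) * w x) ^ ((1 : ℝ) / (2 * k)) := by
    have h1 : ∑ x, |m * (1 + u x)| ^ (2 * k) * w x
        = m ^ (2 * k) * ∑ x, w x * (1 + u x) ^ (2 * k) := by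
      rw [Finset.mul_sum]
      refine Finset.sum_congr rfl fun x _ => ?_
      rw [(even_two_mul k).pow_abs, mul_pow]
      ring
    rw [h1]
    have h2 : m * ((δ / 2) ^ ((1 : ℝ) / (2 * k)) * (1 + t))
        = (m ^ (2 * k) * (δ / 2 * (1 + t) ^ (2 * k))) ^ ((1 : ℝ) / (2 * k)) := by
      rw [Real.mul_rpow (by positivity) (by positivity),
        Real.mul_rpow (by positivity) (by positivity), hroot m hm0.le, hroot (1 + t) (by positivity)]
    rw [h2]
    exact Real.rpow_le_rpow (by positivity)
      (mul_le_mul_of_nonneg_left han (by positivity)) hr0.le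
  have hc1 : (δ / 2) ^ ((1 : ℝ) / (2 * k)) ≤ 1 :=
    Real.rpow_le_one (by positivity) (by linarith) hr0.le
  have hc0 : 0 ≤ (δ / 2) ^ ((1 : ℝ) / (2 * k)) := by positivity
  have hfin := hlow.trans hmk
  generalize (δ / 2) ^ ((1 : ℝ) / (2 * k)) = c at *
  have h3 : (1 + ε) * c - e ≤ c * (1 + t) := by nlinarith
  have h4 := mul_le_mul_of_nonneg_left h3 hm0.le
  have h5 : ((1 + ε) * c - 6 * η * α⁻¹) * α ^ 2 * (M / N) = m * ((1 + ε) * c - e) - m * e := by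
    rw [hm, he]; ring
  rw [h5]
  linarith
end
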